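/- Let X₀(μ), X₁(μ), Y₀(ν), Y₁(ν) be 2-concave real-valued Banach function spaces, [E₀,E₁] and [F₀,F₁] interpolation couples of complex Banach spaces with E₀∩E₁ dense in E₀ and E₁ and F₀∩F₁ dense in F₀ and F₁, such that E₀', E₁', F₀', F₁' all have type 2. Then for 0 < θ < 1: [X₀(E₀)⊗̂_ε Y₀(F₀), X₁(E₁)⊗̂_ε Y₁(F₁)]_θ = [X₀(E₀),X₁(E₁)]_θ ⊗̂_ε [Y₀(F₀),Y₁(F₁)]_θ algebraically and topologically. -/

import Mathlib

open Complex MeasureTheory Finset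

noncomputable section

namespace Paper

/-- The closed unit strip in the complex plane. -/
def Strip : Set ℂ := {z : ℂ | 0 ≤ z.re ∧ z.re ≤ 1}

/-- The open unit strip in the complex plane. -/
def OStrip : Set ℂ := {z : ℂ | 0 < z.re ∧ z.re < 1}

/-- `N` is a norm on the complex vector space `V`. -/
def IsNormC {V : Type*} [AddCommGroup V] [Module ℂ V] (N : V → ℝ) : Prop :=
  (∀ x, 0 ≤ N x) ∧ (∀ x, N x = 0 → x = 0) ∧
  (∀ (c : ℂ) (x), N (c • x) = ‖c‖ * N x) ∧ (∀ x y, N (x + y) ≤ N x + N y)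

/-- `N` is a lattice norm on `ℝⁿ`. -/
def IsLatticeNorm {n : ℕ} (N : (Fin n → ℝ) → ℝ) : Prop :=
  (∀ x, 0 ≤ N x) ∧ (∀ x, N x = 0 → x = 0) ∧
  (∀ (c : ℝ) (x), N (c • x) = |c| * N x) ∧ (∀ x y, N (x + y) ≤ N x + N y) ∧
  (∀ x y, (∀ i, |x i| ≤ |y i|) → N x ≤ N y)

/-- The `r`-th power `X^r` of a lattice norm: `‖x‖_{X^r} = ‖ |x|^{1/r} ‖_X^r`. -/
def powNorm {n : ℕ} (r : ℝ) (N : (Fin n → ℝ) → ℝ) (x : Fin n → ℝ) : ℝ :=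
  (N fun i => |x i| ^ (1 / r)) ^ r

/-- `N` is `p`-convex with constant `C`. -/
def ConvexWith {n : ℕ} (p C : ℝ) (N : (Fin n → ℝ) → ℝ) : Prop :=
  ∀ (m : ℕ) (x : Fin m → Fin n → ℝ),
    N (fun j => (∑ i, |x i j| ^ p) ^ (1 / p)) ≤ C * (∑ i, N (x i) ^ p) ^ (1 / p)

/-- `N` is `p`-concave with constant `C`. -/
def ConcaveWith {n : ℕ} (p C : ℝ) (N : (Fin n → ℝ) → ℝ) : Prop :=
  ∀ (m : ℕ) (x : Fin m → Fin n → ℝ),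
    (∑ i, N (x i) ^ p) ^ (1 / p) ≤ C * N (fun j => (∑ i, |x i j| ^ p) ^ (1 / p))

/-- The dual lattice norm on `ℝⁿ`. -/
def dualNR {n : ℕ} (N : (Fin n → ℝ) → ℝ) (y : Fin n → ℝ) : ℝ :=
  sSup {r : ℝ | ∃ x, N x ≤ 1 ∧ r = |∑ i, x i * y i|}

/-- The Calderón product norm `X₀^{1-θ}X₁^θ` on `ℝⁿ`. -/
def calNorm {n : ℕ} (θ : ℝ) (N₀ N₁ : (Fin n → ℝ) → ℝ) (f : Fin n → ℝ) : ℝ :=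
  sInf {c : ℝ | ∃ g h : Fin n → ℝ, (∀ i, |f i| = |g i| ^ (1 - θ) * |h i| ^ θ) ∧
    c = N₀ g ^ (1 - θ) * N₁ h ^ θ}

/-- The complex interpolation norm `[N₀,N₁]_θ`, computed via analytic functions
of finite type `z ↦ ∑ φᵢ(z) • vᵢ` on the strip (which, by density, gives the
complex interpolation norm on the intersection for couples with dense intersection). -/
def interpN {D : Type*} [AddCommGroup D] [Module ℂ D]
    (θ : ℝ) (N₀ N₁ : D → ℝ) (x : D) : ℝ :=
  sInf {c : ℝ | ∃ (m : ℕ) (φ : Fin m → ℂ → ℂ) (v : Fin m → D),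
    (∀ i, ContinuousOn (φ i) Strip) ∧
    (∀ i, DifferentiableOn ℂ (φ i) OStrip) ∧
    (∀ i, ∃ B : ℝ, ∀ z ∈ Strip, ‖φ i z‖ ≤ B) ∧
    (∑ i, φ i (θ : ℂ) • v i) = x ∧
    (∀ t : ℝ, N₀ (∑ i, φ i (Complex.I * t) • v i) ≤ c) ∧
    (∀ t : ℝ, N₁ (∑ i, φ i (1 + Complex.I * t) • v i) ≤ c)}

/-- Operator "norm" of a map with respect to given norm functions. -/
def opN {X Y : Type*} (NX : X → ℝ) (NY : Y → ℝ) (T : X → Y) : ℝ :=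
  sSup {r : ℝ | ∃ x, NX x ≤ 1 ∧ r = NY (T x)}

/-- The Hilbert space `ℓ₂`. -/
abbrev Hilb := lp (fun _ : ℕ => ℂ) 2

def hilbNorm (x : Hilb) : ℝ := ‖x‖

/-- `d_θ[M₀,M₁]`: the norm of the identity
`L(ℓ₂,[M₀,M₁]_θ) → [L(ℓ₂,M₀),L(ℓ₂,M₁)]_θ`. -/
def dTheta {V : Type*} [NormedAddCommGroup V] [NormedSpace ℂ V]
    (θ : ℝ) (N₀ N₁ : V → ℝ) : ℝ :=
  sSup {r : ℝ | ∃ T : Hilb →L[ℂ] V,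
    opN hilbNorm (interpN θ N₀ N₁) ⇑T ≤ 1 ∧
    r = interpN θ (fun S : Hilb →L[ℂ] V => opN hilbNorm N₀ ⇑S)
        (fun S : Hilb →L[ℂ] V => opN hilbNorm N₁ ⇑S) T}

/-- Rademacher average `(2^{-m} ∑_ε ‖∑ ±xᵢ‖²)`. -/
def radAvg {V : Type*} [AddCommGroup V] (N : V → ℝ) {m : ℕ} (x : Fin m → V) : ℝ :=
  ((2 : ℝ) ^ m)⁻¹ * ∑ ε : Fin m → Bool, N (∑ i, if ε i then x i else -x i) ^ 2

/-- `N` has (Rademacher) type 2 with constant `C`. -/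
def Type2With {V : Type*} [AddCommGroup V] (N : V → ℝ) (C : ℝ) : Prop :=
  ∀ (m : ℕ) (x : Fin m → V), Real.sqrt (radAvg N x) ≤ C * Real.sqrt (∑ i, N (x i) ^ 2)

/-- `N` has (Rademacher) cotype 2 with constant `C`. -/
def Cotype2With {V : Type*} [AddCommGroup V] (N : V → ℝ) (C : ℝ) : Prop :=
  ∀ (m : ℕ) (x : Fin m → V), Real.sqrt (∑ i, N (x i) ^ 2) ≤ C * Real.sqrt (radAvg N x)

/-- The injective tensor norm of two norm functions. -/
def injN {V W : Type*} [AddCommGroup V] [Module ℂ V] [AddCommGroup W] [Module ℂ W]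
    (NV : V → ℝ) (NW : W → ℝ) (z : TensorProduct ℂ V W) : ℝ :=
  sSup {r : ℝ | ∃ (φ : V →ₗ[ℂ] ℂ) (ψ : W →ₗ[ℂ] ℂ),
    (∀ x, ‖φ x‖ ≤ NV x) ∧ (∀ y, ‖ψ y‖ ≤ NW y) ∧
    r = ‖TensorProduct.lift (((LinearMap.mul ℂ ℂ).comp φ).compl₂ ψ) z‖}

/-- Dual norm on linear functionals. -/
def dualNC {V : Type*} [AddCommGroup V] [Module ℂ V] (N : V → ℝ) (φ : V →ₗ[ℂ] ℂ) : ℝ :=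
  sSup {r : ℝ | ∃ x, N x ≤ 1 ∧ r = ‖φ x‖}

/-- The space of bounded linear functionals (dual space of the completion). -/
def BddDual {V : Type*} [AddCommGroup V] [Module ℂ V] (N : V → ℝ) :
    Submodule ℂ (V →ₗ[ℂ] ℂ) where
  carrier := {φ | ∃ c : ℝ, ∀ x, ‖φ x‖ ≤ c * N x}
  zero_mem' := ⟨0, by simp⟩
  add_mem' := by
    rintro φ ψ ⟨c, hc⟩ ⟨d, hd⟩
    exact ⟨c + d, fun x => by
      have h1 := hc x; have h2 := hd x
      calc ‖(φ + ψ) x‖ = ‖φ x + ψ x‖ := by simp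
        _ ≤ ‖φ x‖ + ‖ψ x‖ := norm_add_le _ _
        _ ≤ (c + d) * N x := by rw [add_mul]; exact add_le_add h1 h2⟩
  smul_mem' := by
    rintro a φ ⟨c, hc⟩
    exact ⟨‖a‖ * c, fun x => by
      have : ‖(a • φ) x‖ = ‖a‖ * ‖φ x‖ := by simp [norm_smul]
      rw [this, mul_assoc]
      exact mul_le_mul_of_nonneg_left (hc x) (norm_nonneg a)⟩

/-- Strictly simple functions with values in `V`: the span of
`v`-valued indicators of finite-measure measurable sets. -/
def SimpleSub {Ω : Type*} [MeasurableSpace Ω] (μ : Measure Ω)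
    (V : Type*) [AddCommGroup V] [Module ℂ V] : Submodule ℂ (Ω → V) :=
  Submodule.span ℂ {f | ∃ (s : Set Ω) (v : V), MeasurableSet s ∧ μ s < ⊤ ∧
    f = s.indicator fun _ => v}

/-- A Banach function space over a measure `μ`, with `K`-valued functions. -/
structure BFS (Ω : Type*) [MeasurableSpace Ω] (μ : Measure Ω) (K : Type*) [RCLike K] where
  mem : (Ω → K) → Prop
  nrm : (Ω → K) → ℝ
  mem_zero : mem 0
  mem_add : ∀ f g, mem f → mem g → mem (f + g)
  mem_smul : ∀ (c : K) (f), mem f → mem (c • f)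
  mem_meas : ∀ f, mem f → AEStronglyMeasurable f μ
  ideal : ∀ f g, AEStronglyMeasurable f μ → mem g →
    (∀ᵐ ω ∂μ, ‖f ω‖ ≤ ‖g ω‖) → mem f ∧ nrm f ≤ nrm g
  nrm_nonneg : ∀ f, 0 ≤ nrm f
  nrm_eq_zero : ∀ f, mem f → nrm f = 0 → f =ᵐ[μ] 0
  nrm_add : ∀ f g, mem f → mem g → nrm (f + g) ≤ nrm f + nrm g
  nrm_smul : ∀ (c : K) (f), nrm (c • f) = ‖c‖ * nrm f
  mem_indicator : ∀ s : Set Ω, MeasurableSet s → μ s < ⊤ →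
    mem (s.indicator fun _ => 1)
  complete : ∀ f : ℕ → Ω → K, (∀ k, mem (f k)) →
    (∀ ε : ℝ, 0 < ε → ∃ N : ℕ, ∀ p q, N ≤ p → N ≤ q → nrm (f p - f q) < ε) →
    ∃ g, mem g ∧ ∀ ε : ℝ, 0 < ε → ∃ N : ℕ, ∀ p, N ≤ p → nrm (f p - g) < ε

variable {Ω : Type*} [MeasurableSpace Ω] {μ : Measure Ω} {K : Type*} [RCLike K]

/-- `X` is `r`-convex with constant `C`. -/
def BFS.RConvexWith (X : BFS Ω μ K) (r C : ℝ) : Prop :=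
  ∀ (m : ℕ) (f : Fin m → Ω → K), (∀ i, X.mem (f i)) →
    X.mem (fun ω => ((((∑ i, ‖f i ω‖ ^ r) ^ (1 / r) : ℝ) : K))) ∧
    X.nrm (fun ω => ((((∑ i, ‖f i ω‖ ^ r) ^ (1 / r) : ℝ) : K))) ≤
      C * (∑ i, X.nrm (f i) ^ r) ^ (1 / r)

/-- `X` is `r`-concave with constant `C`. -/
def BFS.RConcaveWith (X : BFS Ω μ K) (r C : ℝ) : Prop :=
  ∀ (m : ℕ) (f : Fin m → Ω → K), (∀ i, X.mem (f i)) →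
    (∑ i, X.nrm (f i) ^ r) ^ (1 / r) ≤
      C * X.nrm (fun ω => ((((∑ i, ‖f i ω‖ ^ r) ^ (1 / r) : ℝ) : K)))

/-- The circle of length one. -/
abbrev Circ := AddCircle (1 : ℝ)

/-- Normalised Haar measure on the circle. -/
abbrev tm : Measure Circ := AddCircle.haarAddCircle

/-- Boundary values of bounded analytic functions on the disc. -/
structure HInf (f : Circ → ℂ) : Prop where
  meas : AEStronglyMeasurable f tm
  bdd : ∃ B : ℝ, ∀ᵐ t ∂tm, ‖f t‖ ≤ B
  van : ∀ k : ℕ, ∫ t, f t * fourier ((k : ℤ) + 1) t ∂tm = 0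

/-- Square-integrable boundary values. -/
structure HTwo (f : Circ → ℂ) : Prop where
  memLp : MemLp f 2 tm
  van : ∀ k : ℕ, ∫ t, f t * fourier ((k : ℤ) + 1) t ∂tm = 0

theorem HInf.hTwo {f : Circ → ℂ} (h : HInf f) : HTwo f := by
  obtain ⟨B, hB⟩ := h.bdd
  exact ⟨MemLp.of_bound h.meas B hB, h.van⟩

theorem HInf.memLp {f : Circ → ℂ} (h : HInf f) : MemLp f 2 tm := h.hTwo.memLp

theorem HTwo.integrable {f : Circ → ℂ} (h : HTwo f) : Integrable f tm :=
  h.memLp.integrable (by norm_num)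

theorem HInf.integrable {f : Circ → ℂ} (h : HInf f) : Integrable f tm := h.hTwo.integrable

theorem norm_fourier (n : ℤ) (t : Circ) : ‖fourier n t‖ = 1 := by
  rw [fourier_apply]; exact Circle.norm_coe _

theorem _root_.MeasureTheory.Integrable.mul_fourier {f : Circ → ℂ} (h : Integrable f tm) (n : ℤ) :
    Integrable (fun t => f t * fourier n t) tm := by
  refine h.mul_bdd (c := 1) ?_ ?_
  · exact (map_continuous (fourier n)).aestronglyMeasurable
  · exact Filter.Eventually.of_forall fun t => (norm_fourier n t).le

theorem HTwo.integral_mul {f g : Circ → ℂ} (hf : HTwo f) (hg : HTwo g) :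
    ∫ t, f t * g t ∂tm = (∫ t, f t ∂tm) * ∫ t, g t ∂tm := by
  have hF : MemLp (fun t => (starRingEnd ℂ) (f t)) 2 tm := hf.memLp.star
  let x : Lp ℂ 2 tm := hF.toLp
  let y : Lp ℂ 2 tm := hg.memLp.toLp
  have key := (fourierBasis (T := 1)).hasSum_inner_mul_inner x y
  have e1 : ∀ i, inner ℂ x (fourierBasis (T := 1) i) = ∫ t, f t * fourier i t ∂tm := by
    intro i
    rw [MeasureTheory.L2.inner_def]
    refine integral_congr_ae ?_
    have := coeFn_fourierLp (T := 1) 2 i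
    rw [← coe_fourierBasis] at this
    filter_upwards [this, hF.coeFn_toLp] with t h1 h2
    rw [h1]
    change inner ℂ (x t) _ = _
    rw [h2]
    simp [mul_comm]
  have e2 : ∀ i, inner ℂ (fourierBasis (T := 1) i) y = ∫ t, g t * fourier (-i) t ∂tm := by
    intro i
    rw [MeasureTheory.L2.inner_def]
    refine integral_congr_ae ?_
    have := coeFn_fourierLp (T := 1) 2 i
    rw [← coe_fourierBasis] at this
    filter_upwards [this, hg.memLp.coeFn_toLp] with t h1 h2
    rw [h1]
    change inner ℂ _ (y t) = _
    rw [h2]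
    simp
  have e3 : inner ℂ x y = ∫ t, f t * g t ∂tm := by
    rw [MeasureTheory.L2.inner_def]
    refine integral_congr_ae ?_
    filter_upwards [hF.coeFn_toLp, hg.memLp.coeFn_toLp] with t h1 h2
    change inner ℂ (x t) (y t) = _
    rw [h1, h2]
    simp [mul_comm]
  have h0 : ∀ i, i ≠ 0 →
      inner ℂ x (fourierBasis (T := 1) i) * inner ℂ (fourierBasis (T := 1) i) y = 0 := by
    intro i hi
    rcases lt_or_gt_of_ne hi with h | h
    · obtain ⟨k, hk⟩ : ∃ k : ℕ, -i = (k : ℤ) + 1 := ⟨(-i - 1).toNat, by lia⟩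
      rw [e2, hk, hg.van k, mul_zero]
    · obtain ⟨k, hk⟩ : ∃ k : ℕ, i = (k : ℤ) + 1 := ⟨(i - 1).toNat, by lia⟩
      rw [e1, hk, hf.van k, zero_mul]
  have := key.unique (hasSum_single 0 h0)
  rw [e3, e1, e2] at this
  simpa using this

theorem HInf.integral_mul {f g : Circ → ℂ} (hf : HInf f) (hg : HInf g) :
    ∫ t, f t * g t ∂tm = (∫ t, f t ∂tm) * ∫ t, g t ∂tm :=
  hf.hTwo.integral_mul hg.hTwo

theorem HTwo.mul_fourier {f : Circ → ℂ} (hf : HTwo f) (k : ℕ) :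
    HTwo (fun t => f t * fourier ((k : ℤ) + 1) t) ∧
      ∫ t, f t * fourier ((k : ℤ) + 1) t ∂tm = 0 := by
  refine ⟨⟨?_, fun j => ?_⟩, hf.van k⟩
  · refine hf.memLp.of_le ?_ ?_
    · exact hf.memLp.1.mul (map_continuous (fourier _)).aestronglyMeasurable
    · exact Filter.Eventually.of_forall fun t => by rw [norm_mul, norm_fourier, mul_one]
  · have := hf.van (k + j + 1)
    rw [← this]
    congr 1; ext t
    rw [mul_assoc, ← fourier_add]
    congr 3
    push_cast; ring

theorem HInf.mul {f g : Circ → ℂ} (hf : HInf f) (hg : HInf g) : HInf (fun t => f t * g t) := by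
  obtain ⟨B, hB⟩ := hf.bdd
  obtain ⟨C, hC⟩ := hg.bdd
  refine ⟨hf.meas.mul hg.meas, ⟨B * C, ?_⟩, fun k => ?_⟩
  · filter_upwards [hB, hC] with t h1 h2
    rw [norm_mul]
    exact mul_le_mul h1 h2 (norm_nonneg _) ((norm_nonneg _).trans h1)
  · have h := hg.hTwo.mul_fourier k
    have := hf.hTwo.integral_mul h.1
    rw [h.2, mul_zero] at this
    simpa only [mul_assoc] using this

theorem integral_fourier_succ (k : ℕ) : ∫ t : Circ, fourier ((k : ℤ) + 1) t ∂tm = 0 := by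
  have h := integral_add_right_eq_self (μ := tm) (fun t : Circ => fourier ((k : ℤ) + 1) t)
    (((1 : ℝ) / 2 / ((k : ℤ) + 1 : ℤ) : ℝ) : Circ)
  have h2 : ∀ t : Circ, fourier ((k : ℤ) + 1)
      (t + (((1 : ℝ) / 2 / ((k : ℤ) + 1 : ℤ) : ℝ) : Circ)) = -fourier ((k : ℤ) + 1) t := by
    intro t
    exact fourier_add_half_inv_index (T := 1) (n := (k : ℤ) + 1) (by lia) one_pos t
  simp only [h2] at h
  rw [integral_neg] at h
  exact self_eq_neg.mp h.symm

theorem HInf.const (c : ℂ) : HInf (fun _ => c) := by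
  refine ⟨aestronglyMeasurable_const, ⟨‖c‖, by simp⟩, fun k => ?_⟩
  rw [integral_const_mul, integral_fourier_succ, mul_zero]

theorem hInf_fourier (n : ℕ) : HInf (fun t => fourier (n : ℤ) t) := by
  refine ⟨(map_continuous (fourier _)).aestronglyMeasurable, ⟨1, ?_⟩, fun k => ?_⟩
  · exact Filter.Eventually.of_forall fun t => (norm_fourier _ t).le
  · have := integral_fourier_succ (n + k)
    rw [← this]; congr 1; ext t
    rw [← fourier_add]; congr 2

theorem HInf.add {f g : Circ → ℂ} (hf : HInf f) (hg : HInf g) : HInf (fun t => f t + g t) := by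
  obtain ⟨B, hB⟩ := hf.bdd
  obtain ⟨C, hC⟩ := hg.bdd
  refine ⟨hf.meas.add hg.meas, ⟨B + C, ?_⟩, fun k => ?_⟩
  · filter_upwards [hB, hC] with t h1 h2 using (norm_add_le _ _).trans (add_le_add h1 h2)
  · simp only [add_mul]
    rw [integral_add (hf.integrable.mul_fourier _) (hg.integrable.mul_fourier _),
      hf.van, hg.van, add_zero]

theorem HInf.const_mul {f : Circ → ℂ} (c : ℂ) (hf : HInf f) : HInf (fun t => c * f t) :=
  (HInf.const c).mul hf

theorem HInf.sum {ι : Type*} (s : Finset ι) {f : ι → Circ → ℂ} (hf : ∀ i ∈ s, HInf (f i)) :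
    HInf (fun t => ∑ i ∈ s, f i t) := by
  classical
  induction s using Finset.induction_on with
  | empty => simpa using HInf.const 0
  | insert a s ha ih =>
    simp only [Finset.sum_insert ha]
    exact (hf a (by simp)).add (ih fun i hi => hf i (by simp [hi]))

theorem HInf.pow {f : Circ → ℂ} (hf : HInf f) (n : ℕ) : HInf (fun t => f t ^ n) ∧
    ∫ t, f t ^ n ∂tm = (∫ t, f t ∂tm) ^ n := by
  induction n with
  | zero => simpa using HInf.const 1
  | succ n ih =>
    simp only [pow_succ]
    exact ⟨ih.1.mul hf, by rw [ih.1.integral_mul hf, ih.2]⟩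

/-- Bounded pointwise limits of `H^∞` functions. -/
theorem HInf.lim {f : ℕ → Circ → ℂ} {g : Circ → ℂ} (hf : ∀ n, HInf (f n)) (B : ℝ)
    (hB : ∀ n, ∀ᵐ t ∂tm, ‖f n t‖ ≤ B)
    (hl : ∀ᵐ t ∂tm, Filter.Tendsto (fun n => f n t) Filter.atTop (nhds (g t))) :
    HInf g ∧ Filter.Tendsto (fun n => ∫ t, f n t ∂tm) Filter.atTop (nhds (∫ t, g t ∂tm)) := by
  have hg : AEStronglyMeasurable g tm :=
    aestronglyMeasurable_of_tendsto_ae Filter.atTop (fun n => (hf n).meas) hl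
  refine ⟨⟨hg, ⟨B, ?_⟩, fun k => ?_⟩, ?_⟩
  · filter_upwards [hl, ae_all_iff.2 hB] with t h1 h2
    exact le_of_tendsto h1.norm (Filter.Eventually.of_forall h2)
  · have h := tendsto_integral_of_dominated_convergence (μ := tm)
      (F := fun n t => f n t * fourier ((k : ℤ) + 1) t)
      (f := fun t => g t * fourier ((k : ℤ) + 1) t) (fun _ => B)
      (fun n => ((hf n).integrable.mul_fourier _).1) (integrable_const _)
      (fun n => by
        filter_upwards [hB n] with t ht
        rw [norm_mul, norm_fourier, mul_one]; exact ht)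
      (by filter_upwards [hl] with t ht using ht.mul_const _)
    simp only [(hf _).van] at h
    exact (tendsto_nhds_unique h tendsto_const_nhds)
  · exact tendsto_integral_of_dominated_convergence (fun _ => B) (fun n => (hf n).meas)
      (integrable_const _) hB hl

theorem HInf.exp {f : Circ → ℂ} (hf : HInf f) : HInf (fun t => cexp (f t)) ∧
    ∫ t, cexp (f t) ∂tm = cexp (∫ t, f t ∂tm) := by
  obtain ⟨B, hB⟩ := hf.bdd
  have hs : ∀ z : ℂ, HasSum (fun k : ℕ => (k.factorial : ℂ)⁻¹ * z ^ k) (cexp z) := by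
    intro z
    have := NormedSpace.expSeries_div_hasSum_exp (𝔸 := ℂ) z
    rw [← Complex.exp_eq_exp_ℂ] at this
    simpa [div_eq_inv_mul] using this
  have h1 : ∀ n, HInf (fun t => ∑ k ∈ range n, (k.factorial : ℂ)⁻¹ * f t ^ k) := fun n =>
    HInf.sum _ fun k _ => (hf.pow k).1.const_mul _
  have h2 := HInf.lim (g := fun t => cexp (f t)) h1 (Real.exp B) (fun n => by
    filter_upwards [hB] with t ht
    refine (norm_sum_le _ _).trans ?_
    refine (Finset.sum_le_sum (g := fun k => B ^ k / k.factorial) fun k _ => ?_).trans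
      (Real.sum_le_exp_of_nonneg ((norm_nonneg _).trans ht) n)
    rw [norm_mul, norm_inv, norm_pow, RCLike.norm_natCast, div_eq_inv_mul]
    gcongr)
    (Filter.Eventually.of_forall fun t => (hs _).tendsto_sum_nat)
  refine ⟨h2.1, tendsto_nhds_unique h2.2 ?_⟩
  have h3 : ∀ n, ∫ t, (∑ k ∈ range n, (k.factorial : ℂ)⁻¹ * f t ^ k) ∂tm =
      ∑ k ∈ range n, (k.factorial : ℂ)⁻¹ * (∫ t, f t ∂tm) ^ k := by
    intro n
    rw [integral_finsetSum _ fun k _ => ((hf.pow k).1.const_mul _).integrable]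
    refine Finset.sum_congr rfl fun k _ => ?_
    rw [integral_const_mul, (hf.pow k).2]
  simp only [h3]
  exact (hs _).tendsto_sum_nat

theorem HInf.polynomial (P : Polynomial ℂ) : HInf (fun t => P.eval (fourier 1 t)) ∧
    ∫ t, P.eval (fourier 1 t) ∂tm = P.coeff 0 := by
  have h1 : HInf (fun t => fourier (1 : ℤ) t) := by simpa using hInf_fourier 1
  have h0 : ∫ t, fourier (1 : ℤ) t ∂tm = 0 := by simpa using integral_fourier_succ 0
  simp only [Polynomial.eval_eq_sum_range]
  refine ⟨HInf.sum _ fun i _ => (h1.pow i).1.const_mul _, ?_⟩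
  rw [integral_finsetSum _ fun k _ => ((h1.pow k).1.const_mul _).integrable]
  rw [Finset.sum_eq_single 0]
  · simp
  · intro k _ hk
    rw [integral_const_mul, (h1.pow k).2, h0, zero_pow hk, mul_zero]
  · simp

theorem exists_polynomial_re (v : C(Circ, ℝ)) {ε : ℝ} (hε : 0 < ε) :
    ∃ P : Polynomial ℂ, (P.coeff 0).im = 0 ∧ ∀ t, |(P.eval (fourier 1 t)).re - v t| ≤ ε := by
  let V : C(Circ, ℂ) := ⟨fun t => (v t : ℂ), by fun_prop⟩
  have hV : V ∈ (Submodule.span ℂ (Set.range (fourier (T := 1)))).topologicalClosure := by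
    rw [span_fourier_closure_eq_top]; trivial
  obtain ⟨p, hp, hd⟩ := Metric.mem_closure_iff.1 hV ε hε
  have : ∃ P Q : Polynomial ℂ, ∀ t, p t = P.eval (fourier 1 t) +
      (starRingEnd ℂ) (Q.eval (fourier 1 t)) := by
    clear hd
    induction hp using Submodule.span_induction with
    | mem x hx =>
      obtain ⟨n, rfl⟩ := hx
      have hpow : ∀ (k : ℕ) (t : Circ), fourier (k : ℤ) t = (fourier 1 t) ^ k := by
        intro k t
        induction k with
        | zero => simp
        | succ k ih => push_cast; rw [fourier_add, ih, pow_succ]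
      rcases le_total 0 n with h | h
      · obtain ⟨k, rfl⟩ := Int.eq_ofNat_of_zero_le h
        exact ⟨Polynomial.X ^ k, 0, fun t => by simpa using hpow k t⟩
      · obtain ⟨k, hk⟩ := Int.eq_ofNat_of_zero_le (neg_nonneg.2 h)
        refine ⟨0, Polynomial.X ^ k, fun t => ?_⟩
        have : n = -(k : ℤ) := by lia
        rw [this, fourier_neg, hpow]; simp
    | zero => exact ⟨0, 0, by simp⟩
    | add x y _ _ hx hy =>
      obtain ⟨P, Q, h⟩ := hx
      obtain ⟨P', Q', h'⟩ := hy
      refine ⟨P + P', Q + Q', fun t => ?_⟩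
      simp only [ContinuousMap.add_apply, h, h', Polynomial.eval_add, map_add]; ring
    | smul c x _ hx =>
      obtain ⟨P, Q, h⟩ := hx
      refine ⟨Polynomial.C c * P, Polynomial.C ((starRingEnd ℂ) c) * Q, fun t => ?_⟩
      simp only [ContinuousMap.smul_apply, h, Polynomial.eval_mul, Polynomial.eval_C, map_mul,
        smul_eq_mul, mul_add, Complex.conj_conj]
  obtain ⟨P, Q, h⟩ := this
  refine ⟨P + Q - Polynomial.C (((P + Q).coeff 0).im * I), by simp, fun t => ?_⟩
  have h1 : dist (V t) (p t) ≤ ε := (ContinuousMap.dist_apply_le_dist t).trans hd.le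
  have h2 : ((P + Q - Polynomial.C (((P + Q).coeff 0).im * I)).eval (fourier 1 t)).re - v t =
      (p t - V t).re := by
    rw [h]; simp [V]
  rw [h2]
  refine (Complex.abs_re_le_norm _).trans ?_
  rwa [← dist_eq_norm, dist_comm]

theorem HInf.integral_norm_sq_le {q : Circ → ℂ} (hq : HInf q) (h0 : (∫ t, q t ∂tm).im = 0) :
    ∫ t, ‖q t‖ ^ 2 ∂tm ≤ 2 * ∫ t, (q t).re ^ 2 ∂tm := by
  have h1 := hq.integral_mul hq
  have h2 : Integrable (fun t => q t * q t) tm := (hq.mul hq).integrable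
  have h3 : ∫ t, (q t * q t).re ∂tm = ((∫ t, q t ∂tm) * ∫ t, q t ∂tm).re := by
    rw [← h1]; exact integral_re h2
  rw [Complex.mul_re, h0, mul_zero, sub_zero] at h3
  have hre : Integrable (fun t => (q t).re ^ 2) tm := by
    have := hq.memLp.re
    simpa using this.integrable_sq
  have him : Integrable (fun t => (q t).im ^ 2) tm := by
    have := hq.memLp.im
    simpa using this.integrable_sq
  have h4 : ∫ t, (q t * q t).re ∂tm = ∫ t, (q t).re ^ 2 ∂tm - ∫ t, (q t).im ^ 2 ∂tm := by
    rw [← integral_sub hre him]; congr 1; ext t; rw [Complex.mul_re]; ring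
  have h5 : ∫ t, ‖q t‖ ^ 2 ∂tm = ∫ t, (q t).re ^ 2 ∂tm + ∫ t, (q t).im ^ 2 ∂tm := by
    rw [← integral_add hre him]; congr 1; ext t
    rw [Complex.sq_norm, Complex.normSq_apply]; ring
  nlinarith [mul_self_nonneg (∫ t, q t ∂tm).re]

theorem exists_continuous_approx {u : Circ → ℝ} (hu : AEStronglyMeasurable u tm) {B : ℝ}
    (hB : ∀ᵐ t ∂tm, |u t| ≤ B) {ε : ℝ} (hε : 0 < ε) :
    ∃ v : C(Circ, ℝ), (∀ t, |v t| ≤ B) ∧ eLpNorm (u - (v : Circ → ℝ)) 2 tm ≤ ENNReal.ofReal ε := by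
  have hB0 : 0 ≤ B := by
    obtain ⟨t, ht⟩ := hB.exists
    exact (abs_nonneg _).trans ht
  have hm : MemLp u 2 tm := MemLp.of_bound hu B hB
  obtain ⟨g, hg, hg2⟩ := hm.exists_boundedContinuous_eLpNorm_sub_le (by norm_num)
    (ε := ENNReal.ofReal ε) (by simpa using hε)
  refine ⟨⟨fun t => max (-B) (min B (g t)), by fun_prop⟩, fun t => ?_, le_trans ?_ hg⟩
  · simp only [ContinuousMap.coe_mk, abs_le]
    exact ⟨le_max_left _ _, max_le (by linarith) (min_le_left _ _)⟩
  · refine eLpNorm_mono_ae ?_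
    filter_upwards [hB] with t ht
    simp only [Pi.sub_apply, ContinuousMap.coe_mk, Real.norm_eq_abs]
    rw [abs_le] at ht
    rcases le_total B (g t) with h1 | h1
    · rw [min_eq_left h1, max_eq_right (by linarith), abs_le]
      constructor <;> linarith [neg_abs_le (u t - g t)]
    · rw [min_eq_right h1]
      rcases le_total (-B) (g t) with h2 | h2
      · rw [max_eq_right h2]
      · rw [max_eq_left h2, abs_le]
        constructor <;> linarith [le_abs_self (u t - g t)]

theorem exists_outer {u : Circ → ℝ} (hu : AEStronglyMeasurable u tm) {B : ℝ}
    (hB : ∀ᵐ t ∂tm, |u t| ≤ B) :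
    ∃ a : Circ → ℂ, HInf a ∧ HInf (fun t => (a t)⁻¹) ∧
      (∀ᵐ t ∂tm, ‖a t‖ = Real.exp (u t)) ∧ ‖∫ t, a t ∂tm‖ = Real.exp (∫ t, u t ∂tm) := by
  have hm : MemLp u 2 tm := MemLp.of_bound hu B hB
  have hpos : ∀ n : ℕ, (0 : ℝ) < 1 / (n + 1) := fun n => by positivity
  choose v hv hv2 using fun n : ℕ => exists_continuous_approx hu hB (hpos n)
  choose P hP0 hP using fun n : ℕ => exists_polynomial_re (v n) (hpos n)
  set q : ℕ → Circ → ℂ := fun n t => (P n).eval (fourier 1 t) with hqdef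
  have hq : ∀ n, HInf (q n) := fun n => (HInf.polynomial (P n)).1
  have hqi : ∀ n, (∫ t, q n t ∂tm).im = 0 := fun n => by
    rw [(HInf.polynomial (P n)).2, hP0]
  have hmre : ∀ n, MemLp (fun t => (q n t).re) 2 tm := fun n => (hq n).memLp.re
  have hlim : Filter.Tendsto (fun n => eLpNorm ((fun t => (q n t).re) - u) 2 tm)
      Filter.atTop (nhds 0) := by
    have h1 : ∀ n : ℕ, eLpNorm ((fun t => (q n t).re) - u) 2 tm ≤
        ENNReal.ofReal (1 / ((n : ℝ) + 1)) + ENNReal.ofReal (1 / ((n : ℝ) + 1)) := by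
      intro n
      have e : ((fun t => (q n t).re) - u) = ((fun t => (q n t).re) - (v n : Circ → ℝ)) + ((v n : Circ → ℝ) - u) := by
        ext t; simp
      have hvm : AEStronglyMeasurable (v n) tm := (map_continuous (v n)).aestronglyMeasurable
      rw [e]
      refine (eLpNorm_add_le ((hmre n).1.sub hvm) (hvm.sub hu) (by norm_num)).trans
        (add_le_add ?_ ?_)
      · refine (eLpNorm_le_of_ae_bound (C := 1 / ((n : ℝ) + 1))
          (Filter.Eventually.of_forall fun t => ?_)).trans ?_
        · exact hP n t
        · simp
      · rw [← eLpNorm_neg, neg_sub]; exact hv2 n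
    refine tendsto_of_tendsto_of_tendsto_of_le_of_le tendsto_const_nhds ?_
      (fun _ => zero_le) h1
    have : Filter.Tendsto (fun n : ℕ => ENNReal.ofReal (1 / ((n : ℝ) + 1))) Filter.atTop
        (nhds 0) := by
      simpa using ENNReal.tendsto_ofReal tendsto_one_div_add_atTop_nhds_zero_nat
    simpa using this.add this
  set V : ℕ → Lp ℝ 2 tm := fun n => (hmre n).toLp with hVdef
  set Q : ℕ → Lp ℂ 2 tm := fun n => (hq n).memLp.toLp with hQdef
  have hV : Filter.Tendsto V Filter.atTop (nhds (hm.toLp u)) :=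
    (Lp.tendsto_Lp_iff_tendsto_eLpNorm'' _ hmre u hm).2 hlim
  have hd : ∀ n m, dist (Q n) (Q m) ≤ 2 * dist (V n) (V m) := by
    intro n m
    have hs : HInf (fun t => q n t + (-1) * q m t) := (hq n).add ((hq m).const_mul _)
    have h1 := hs.integral_norm_sq_le (by
      rw [integral_add (hq n).integrable ((hq m).const_mul _).integrable, integral_const_mul]
      simp [hqi])
    have e1 : dist (Q n) (Q m) ^ 2 = ∫ t, ‖q n t + (-1) * q m t‖ ^ 2 ∂tm := by
      rw [dist_eq_norm, ← MemLp.toLp_sub, Lp.norm_toLp, 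
        MemLp.eLpNorm_eq_integral_rpow_norm (by norm_num) (by norm_num)
          ((hq n).memLp.sub (hq m).memLp), ENNReal.toReal_ofReal (by positivity)]
      simp only [ENNReal.toReal_ofNat, Real.rpow_ofNat]
      rw [← Real.rpow_natCast, ← Real.rpow_mul (by positivity)]
      norm_num [sub_eq_add_neg]
    have e2 : dist (V n) (V m) ^ 2 = ∫ t, (q n t + (-1) * q m t).re ^ 2 ∂tm := by
      rw [dist_eq_norm, ← MemLp.toLp_sub, Lp.norm_toLp, 
        MemLp.eLpNorm_eq_integral_rpow_norm (by norm_num) (by norm_num)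
          ((hmre n).sub (hmre m)), ENNReal.toReal_ofReal (by positivity)]
      simp only [ENNReal.toReal_ofNat, Real.rpow_ofNat]
      rw [← Real.rpow_natCast, ← Real.rpow_mul (by positivity)]
      norm_num [sub_eq_add_neg]
    rw [← e1, ← e2] at h1
    have := dist_nonneg (x := V n) (y := V m)
    refine abs_le_of_sq_le_sq' ?_ (by positivity) |>.2
    nlinarith [sq_nonneg (dist (V n) (V m))]
  have hQ : CauchySeq Q := by
    rw [Metric.cauchySeq_iff]
    intro ε hε
    obtain ⟨N, hN⟩ := Metric.cauchySeq_iff.1 hV.cauchySeq (ε / 2) (by positivity)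
    exact ⟨N, fun m hm n hn => (hd m n).trans_lt (by linarith [hN m hm n hn])⟩
  obtain ⟨R, hR⟩ := cauchySeq_tendsto_of_complete hQ
  obtain ⟨ns, hns, h1⟩ := (tendstoInMeasure_of_tendsto_Lp hR).exists_seq_tendsto_ae
  obtain ⟨ms, hms, h2⟩ := (tendstoInMeasure_of_tendsto_Lp
    (hV.comp hns.tendsto_atTop)).exists_seq_tendsto_ae
  set k : ℕ → ℕ := ns ∘ ms
  have hk1 : ∀ᵐ t ∂tm, Filter.Tendsto (fun n => q (k n) t) Filter.atTop (nhds (R t)) := by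
    have := ae_all_iff.2 fun n => (hq n).memLp.coeFn_toLp
    filter_upwards [h1, this] with t ht ht2
    refine (ht.comp hms.tendsto_atTop).congr fun n => ?_
    exact ht2 _
  have hk2 : ∀ᵐ t ∂tm, Filter.Tendsto (fun n => (q (k n) t).re) Filter.atTop (nhds (u t)) := by
    have := ae_all_iff.2 fun n => (hmre n).coeFn_toLp
    filter_upwards [h2, this, hm.coeFn_toLp] with t ht ht2 ht3
    rw [ht3] at ht
    refine ht.congr fun n => ?_
    exact ht2 _
  have hre : ∀ᵐ t ∂tm, (R t).re = u t := by
    filter_upwards [hk1, hk2] with t h1 h2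
    exact tendsto_nhds_unique ((Complex.continuous_re.tendsto _).comp h1) h2
  have hb : ∀ n t, |(q n t).re| ≤ B + 1 := by
    intro n t
    have h1 := hP n t
    have h2 := hv n t
    have h3 : (1 : ℝ) / (n + 1) ≤ 1 := by
      rw [div_le_one (by positivity)]; linarith [(Nat.cast_nonneg n : (0 : ℝ) ≤ n)]
    rw [abs_le] at h1 h2 ⊢
    constructor <;> linarith [h1.1, h1.2]
  have key1 := HInf.lim (g := fun t => cexp (R t)) (fun n => (hq (k n)).exp.1) (Real.exp (B + 1))
    (fun n => Filter.Eventually.of_forall fun t => by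
      rw [Complex.norm_exp]; exact Real.exp_le_exp.2 (abs_le.1 (hb _ t)).2)
    (by filter_upwards [hk1] with t ht using (Complex.continuous_exp.tendsto _).comp ht)
  have key2 := HInf.lim (g := fun t => cexp (-1 * R t))
    (fun n => ((hq (k n)).const_mul (-1)).exp.1) (Real.exp (B + 1))
    (fun n => Filter.Eventually.of_forall fun t => by
      rw [Complex.norm_exp]; refine Real.exp_le_exp.2 ?_
      have := (abs_le.1 (hb (k n) t)).1
      simp; linarith)
    (by
      filter_upwards [hk1] with t ht 
      exact (Complex.continuous_exp.tendsto _).comp (ht.const_mul _))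
  refine ⟨fun t => cexp (R t), key1.1, ?_, ?_, ?_⟩
  · simpa [Complex.exp_neg] using key2.1
  · filter_upwards [hre] with t ht
    rw [Complex.norm_exp, ht]
  · have e1 : ∀ n, ‖∫ t, cexp (q (k n) t) ∂tm‖ = Real.exp (∫ t, (q (k n) t).re ∂tm) := by
      intro n
      rw [(hq (k n)).exp.2, Complex.norm_exp]
      congr 1
      exact (integral_re (hq (k n)).integrable).symm
    have t1 := key1.2.norm
    simp only [e1] at t1
    refine tendsto_nhds_unique t1 ((Real.continuous_exp.tendsto _).comp ?_)
    exact tendsto_integral_of_dominated_convergence (fun _ => B + 1) (fun n => (hmre _).1)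
      (integrable_const _) (fun n => Filter.Eventually.of_forall (hb _)) hk2

theorem integral_circle_eq_circleAverage (G : ℂ → ℂ) (r : ℝ) :
    ∫ t : Circ, G (r * fourier 1 t) ∂tm = Real.circleAverage G 0 r := by
  rw [AddCircle.integral_haarAddCircle, inv_one, one_smul,
    ← AddCircle.intervalIntegral_preimage 1 0, Real.circleAverage_def]
  have h := intervalIntegral.integral_comp_mul_left (a := 0) (b := 1)
    (fun x => G (circleMap 0 r x)) (c := 2 * Real.pi) (by positivity)
  simp only [mul_zero, mul_one] at h
  rw [← h]
  simp only [zero_add]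
  refine intervalIntegral.integral_congr fun x _ => ?_
  simp only [fourier_coe_apply, circleMap, zero_add]
  push_cast
  congr 3; ring

theorem HInf.of_differentiableOn {G : ℂ → ℂ} (hG : DifferentiableOn ℂ G (Metric.ball 0 1))
    {r : ℝ} (hr0 : 0 ≤ r) (hr : r < 1) :
    HInf (fun t => G (r * fourier 1 t)) ∧ ∫ t : Circ, G (r * fourier 1 t) ∂tm = G 0 := by
  have hsub : Metric.closedBall (0 : ℂ) r ⊆ Metric.ball 0 1 := Metric.closedBall_subset_ball hr
  have hmean : ∀ F : ℂ → ℂ, DifferentiableOn ℂ F (Metric.ball 0 1) →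
      ∫ t : Circ, F (r * fourier 1 t) ∂tm = F 0 := by
    intro F hF
    rw [integral_circle_eq_circleAverage]
    refine circleAverage_of_differentiable_on_off_countable Set.countable_empty ?_ ?_
    · rw [abs_of_nonneg hr0]; exact hF.continuousOn.mono hsub
    · rw [abs_of_nonneg hr0]
      intro z hz
      exact hF.differentiableAt (Metric.isOpen_ball.mem_nhds
        (hsub (Metric.ball_subset_closedBall hz.1)))
  have hmem : ∀ t : Circ, (r : ℂ) * fourier 1 t ∈ Metric.closedBall (0 : ℂ) r := by
    intro t
    rw [mem_closedBall_zero_iff, norm_mul, norm_fourier, mul_one, Complex.norm_real,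
      Real.norm_of_nonneg hr0]
  have hcont : Continuous fun t : Circ => G (r * fourier 1 t) := by
    refine (hG.continuousOn.mono hsub).comp_continuous (by fun_prop) hmem
  refine ⟨⟨hcont.aestronglyMeasurable, ?_, fun k => ?_⟩, hmean G hG⟩
  · obtain ⟨C, hC⟩ := (isCompact_closedBall (0 : ℂ) r).exists_bound_of_continuousOn
      (hG.continuousOn.mono hsub)
    exact ⟨C, Filter.Eventually.of_forall fun t => hC _ (hmem t)⟩
  · rcases hr0.eq_or_lt with h0 | h0
    · subst h0
      simp only [Complex.ofReal_zero, zero_mul]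
      rw [integral_const_mul, integral_fourier_succ, mul_zero]
    · have h := hmean (fun z => G z * z ^ (k + 1)) (hG.mul (by fun_prop))
      simp only [ne_eq, Nat.add_eq_zero_iff, one_ne_zero, and_false, not_false_eq_true, zero_pow,
        mul_zero] at h
      have hf : ∀ t : Circ, fourier ((k : ℤ) + 1) t = (fourier 1 t) ^ (k + 1) := by
        intro t
        simp only [fourier_apply, one_smul]
        rw [AddCircle.toCircle_zsmul]
        norm_cast
      have h2 : ∀ t : Circ, G (r * fourier 1 t) * (r * fourier 1 t) ^ (k + 1) =
          (r : ℂ) ^ (k + 1) * (G (r * fourier 1 t) * fourier ((k : ℤ) + 1) t) := by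
        intro t; rw [hf]; ring
      simp only [h2] at h
      rw [integral_const_mul] at h
      exact (mul_eq_zero.1 h).resolve_left (pow_ne_zero _ (by exact_mod_cast ne_of_gt h0))

/-- The point `e^{iπθ}`. -/
def unitPt (θ : ℝ) : ℂ := cexp ((Real.pi * θ : ℝ) * I)

theorem unitPt_re (θ : ℝ) : (unitPt θ).re = Real.cos (Real.pi * θ) := Complex.exp_ofReal_mul_I_re _

theorem unitPt_im (θ : ℝ) : (unitPt θ).im = Real.sin (Real.pi * θ) := Complex.exp_ofReal_mul_I_im _

theorem unitPt_sq (θ : ℝ) : (unitPt θ).re ^ 2 + (unitPt θ).im ^ 2 = 1 := by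
  rw [unitPt_re, unitPt_im]; exact Real.cos_sq_add_sin_sq _

theorem unitPt_im_pos {θ : ℝ} (h0 : 0 < θ) (h1 : θ < 1) : 0 < (unitPt θ).im := by
  rw [unitPt_im]
  refine Real.sin_pos_of_pos_of_lt_pi (by positivity) ?_
  nlinarith [Real.pi_pos]

/-- The sign of this function decides which side of the strip a boundary point belongs to. -/
def sideFn (θ : ℝ) (t : Circ) : ℝ :=
  2 * (unitPt θ).re - 2 * ((starRingEnd ℂ) (unitPt θ) * fourier 1 t).re

/-- Boundary points on the side `Re z = 0`. -/
def side (θ : ℝ) (t : Circ) : Bool := decide (0 ≤ sideFn θ t)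

theorem continuous_sideFn (θ : ℝ) : Continuous (sideFn θ) := by
  unfold sideFn; fun_prop

theorem measurable_side (θ : ℝ) : Measurable (side θ) := by
  refine measurable_to_bool ?_
  have : side θ ⁻¹' {true} = {t | 0 ≤ sideFn θ t} := by ext t; simp [side]
  rw [this]
  exact measurableSet_le measurable_const (continuous_sideFn θ).measurable

/-- The conformal map of the disc onto the upper half plane. -/
def halfMap (θ : ℝ) (ζ : ℂ) : ℂ := (unitPt θ - (starRingEnd ℂ) (unitPt θ) * ζ) / (1 - ζ)

/-- The conformal map of the disc onto the strip. -/
def stripMap (θ : ℝ) (ζ : ℂ) : ℂ := 1 / 2 + log (-I * halfMap θ ζ) / (Real.pi * I)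

theorem halfMap_eq (θ : ℝ) (ζ : ℂ) : halfMap θ ζ =
    ((Complex.normSq (1 - ζ))⁻¹ : ℝ) *
      ((unitPt θ - (starRingEnd ℂ) (unitPt θ) * ζ) * (starRingEnd ℂ) (1 - ζ)) := by
  rw [halfMap, div_eq_mul_inv, Complex.inv_def]
  ring

theorem halfMap_im (θ : ℝ) (ζ : ℂ) : (halfMap θ ζ).im =
    (Complex.normSq (1 - ζ))⁻¹ * ((unitPt θ).im * (1 - ‖ζ‖ ^ 2)) := by
  rw [halfMap_eq, Complex.im_ofReal_mul, Complex.sq_norm, Complex.normSq_apply ζ]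
  congr 1
  simp
  ring

theorem fourier_one_sq (t : Circ) : (fourier 1 t : ℂ).re ^ 2 + (fourier 1 t : ℂ).im ^ 2 = 1 := by
  have := Complex.sq_norm (fourier 1 t)
  rw [norm_fourier, Complex.normSq_apply] at this; nlinarith

theorem halfMap_re (θ : ℝ) (t : Circ) : (halfMap θ (fourier 1 t)).re =
    (Complex.normSq (1 - fourier 1 t))⁻¹ * sideFn θ t := by
  rw [halfMap_eq, Complex.re_ofReal_mul]
  have h2 := fourier_one_sq t
  congr 1
  unfold sideFn
  generalize (fourier 1 t : ℂ) = z at *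
  simp only [Complex.mul_re, Complex.sub_re, Complex.sub_im, Complex.mul_im, Complex.conj_re,
    Complex.conj_im, Complex.one_re, Complex.one_im, map_sub, map_one]
  linear_combination (unitPt θ).re * h2

theorem stripMap_re (θ : ℝ) (ζ : ℂ) :
    (stripMap θ ζ).re = 1 / 2 + arg (-I * halfMap θ ζ) / Real.pi := by
  have : stripMap θ ζ = (1 / 2 : ℝ) + (-I * log (-I * halfMap θ ζ)) / (Real.pi : ℝ) := by
    unfold stripMap
    push_cast
    congr 1
    field_simp
    linear_combination (log (-(I * halfMap θ ζ))) * I_sq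
  rw [this, Complex.add_re, Complex.ofReal_re, Complex.div_ofReal_re, mul_comm (-I) (log _)]
  simp [Complex.log_im]

theorem stripMap_mem_oStrip {θ : ℝ} (h0 : 0 < θ) (h1 : θ < 1) {ζ : ℂ} (hζ : ‖ζ‖ < 1) :
    0 < (-I * halfMap θ ζ).re ∧ stripMap θ ζ ∈ OStrip := by
  have hne : (1 - ζ) ≠ 0 := by
    intro h
    rw [sub_eq_zero] at h
    rw [← h] at hζ; simp at hζ
  have hre : 0 < (-I * halfMap θ ζ).re := by
    have : (-I * halfMap θ ζ).re = (halfMap θ ζ).im := by simp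
    rw [this, halfMap_im]
    have := unitPt_im_pos h0 h1
    have h3 := Complex.normSq_pos.2 hne
    have : 0 < 1 - ‖ζ‖ ^ 2 := by nlinarith [norm_nonneg ζ]
    positivity
  refine ⟨hre, ?_⟩
  have ha := Complex.abs_arg_lt_pi_div_two_iff.2 (Or.inl hre)
  rw [abs_lt] at ha
  constructor <;> rw [stripMap_re]
  · have : -(1/2) < arg (-I * halfMap θ ζ) / Real.pi := by
      rw [lt_div_iff₀ Real.pi_pos]; linarith
    linarith
  · have : arg (-I * halfMap θ ζ) / Real.pi < 1/2 := by
      rw [div_lt_iff₀ Real.pi_pos]; linarith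
    linarith

theorem stripMap_zero {θ : ℝ} (h0 : 0 < θ) (h1 : θ < 1) : stripMap θ 0 = θ := by
  have h : halfMap θ 0 = unitPt θ := by simp [halfMap]
  have h2 : -I * unitPt θ = cexp ((Real.pi * θ - Real.pi / 2 : ℝ) * I) := by
    have : ((Real.pi * θ - Real.pi / 2 : ℝ) * I : ℂ) =
        (-(Real.pi / 2 * I)) + (Real.pi * θ : ℝ) * I := by push_cast; ring
    rw [this, Complex.exp_add, Complex.exp_neg, Complex.exp_pi_div_two_mul_I, Complex.inv_I,
      unitPt]
  have hp := Real.pi_pos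
  rw [stripMap, h, h2, Complex.log_exp]
  · have : (Real.pi : ℂ) ≠ 0 := by exact_mod_cast hp.ne'
    push_cast
    field_simp
    ring
  · simp; nlinarith
  · simp; nlinarith

theorem differentiableOn_stripMap {θ : ℝ} (h0 : 0 < θ) (h1 : θ < 1) :
    DifferentiableOn ℂ (stripMap θ) (Metric.ball 0 1) := by
  intro ζ hζ
  rw [mem_ball_zero_iff] at hζ
  have hne : (1 - ζ) ≠ 0 := by
    intro h
    rw [sub_eq_zero] at h
    rw [← h] at hζ; simp at hζ
  have h2 : DifferentiableAt ℂ (fun ζ => -I * halfMap θ ζ) ζ := by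
    unfold halfMap
    fun_prop (disch := exact hne)
  have h3 : DifferentiableAt ℂ (fun ζ => log (-I * halfMap θ ζ)) ζ :=
    h2.clog (Or.inl (stripMap_mem_oStrip h0 h1 hζ).1)
  have : DifferentiableAt ℂ (fun ζ => 1 / 2 + log (-I * halfMap θ ζ) / (Real.pi * I)) ζ := by
    fun_prop
  exact this.differentiableWithinAt

theorem circle_null (c : ℂ) : ∀ᵐ t : Circ ∂tm, fourier 1 t ≠ c := by
  have hs : {t : Circ | fourier 1 t = c}.Subsingleton := by
    intro s hs t ht
    have h : (fourier 1 s : ℂ) = fourier 1 t := by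
      exact (show fourier 1 s = c from hs).trans (show fourier 1 t = c from ht).symm
    rw [fourier_one, fourier_one] at h
    exact AddCircle.injective_toCircle one_ne_zero (Subtype.ext h)
  have hna : ∀ t : Circ, tm {t} = 0 := by
    intro t
    have hv : (volume : Measure Circ) {t} = 0 := by
      have := AddCircle.volume_closedBall (T := 1) (x := t) 0
      simpa using this
    rw [AddCircle.volume_eq_smul_haarAddCircle] at hv
    simpa using hv
  have : tm {t : Circ | fourier 1 t = c} = 0 := by
    rcases hs.eq_empty_or_singleton with h | ⟨t, h⟩
    · rw [h]; simp
    · rw [h]; exact hna t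
  exact measure_eq_zero_iff_ae_notMem.1 this

theorem exists_bdryMap {θ : ℝ} (h0 : 0 < θ) (h1 : θ < 1) :
    ∃ Z : Circ → ℂ, (∀ᵐ t ∂tm, (side θ t = true → ∃ τ : ℝ, Z t = I * τ) ∧
      (side θ t = false → ∃ τ : ℝ, Z t = 1 + I * τ)) ∧
      ∀ φ : ℂ → ℂ, ContinuousOn φ Strip → DifferentiableOn ℂ φ OStrip →
        (∃ B : ℝ, ∀ z ∈ Strip, ‖φ z‖ ≤ B) →
        HInf (fun t => φ (Z t)) ∧ ∫ t, φ (Z t) ∂tm = φ θ := by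
  have hpi : (Real.pi : ℂ) ≠ 0 := by exact_mod_cast Real.pi_ne_zero
  have hgood : ∀ᵐ t : Circ ∂tm, (fourier 1 t : ℂ) ≠ 1 ∧ halfMap θ (fourier 1 t) ≠ 0 := by
    have hα : (starRingEnd ℂ) (unitPt θ) ≠ 0 := by
      intro h
      have := unitPt_im_pos h0 h1
      rw [map_eq_zero] at h
      rw [h] at this; simp at this
    filter_upwards [circle_null 1, circle_null (unitPt θ / (starRingEnd ℂ) (unitPt θ))] with t a b
    refine ⟨a, fun h => b ?_⟩
    rw [halfMap, div_eq_zero_iff] at h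
    rcases h with h | h
    · rw [eq_div_iff hα]; linear_combination -h
    · exact absurd (sub_eq_zero.1 h).symm a
  have hreal : ∀ t : Circ, halfMap θ (fourier 1 t) = ((halfMap θ (fourier 1 t)).re : ℝ) := by
    intro t
    apply Complex.ext
    · simp
    · rw [halfMap_im, norm_fourier]; simp
  refine ⟨fun t => stripMap θ (fourier 1 t), ?_, ?_⟩
  · filter_upwards [hgood] with t ⟨ha, hb⟩
    have hn : 0 < (Complex.normSq (1 - fourier 1 t))⁻¹ :=
      inv_pos.2 (Complex.normSq_pos.2 (sub_ne_zero.2 (Ne.symm ha)))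
    have hre := halfMap_re θ t
    set x := (halfMap θ (fourier 1 t)).re with hx
    rw [hreal t, ← hx] at hb
    have hx0 : x ≠ 0 := by exact_mod_cast hb
    constructor
    · intro hs
      simp only [side, decide_eq_true_eq] at hs
      have hxp : 0 < x := lt_of_le_of_ne (by rw [hre]; positivity) (Ne.symm hx0)
      refine ⟨-(Real.log x / Real.pi), ?_⟩
      rw [stripMap, hreal t, ← hx]
      rw [mul_comm, Complex.log_ofReal_mul hxp (neg_ne_zero.2 I_ne_zero), Complex.log_neg_I]
      push_cast
      field_simp
      linear_combination (2 * (Real.log x : ℂ)) * I_sq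
    · intro hs
      simp only [side, decide_eq_false_iff_not, not_le] at hs
      have hxp : 0 < -x := by rw [hre]; nlinarith
      refine ⟨-(Real.log (-x) / Real.pi), ?_⟩
      rw [stripMap, hreal t, ← hx]
      have : -I * (x : ℂ) = ((-x : ℝ) : ℂ) * I := by push_cast; ring
      rw [this, Complex.log_ofReal_mul hxp I_ne_zero, Complex.log_I]
      push_cast
      field_simp
      linear_combination (2 * (Real.log (-x) : ℂ)) * I_sq
  · intro φ hφc hφd ⟨B, hB⟩
    have hOS : ∀ {z}, z ∈ OStrip → z ∈ Strip := fun hz => ⟨hz.1.le, hz.2.le⟩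
    have hd : DifferentiableOn ℂ (fun ζ => φ (stripMap θ ζ)) (Metric.ball 0 1) :=
      hφd.comp (differentiableOn_stripMap h0 h1) fun ζ hζ =>
        (stripMap_mem_oStrip h0 h1 (mem_ball_zero_iff.1 hζ)).2
    set r : ℕ → ℝ := fun n => 1 - 1 / ((n : ℝ) + 1) with hr
    have hr0 : ∀ n, 0 ≤ r n := fun n => by
      have : (1 : ℝ) / (n + 1) ≤ 1 := by
        rw [div_le_one (by positivity)]; linarith [(Nat.cast_nonneg n : (0 : ℝ) ≤ n)]
      simp only [hr]; linarith
    have hr1 : ∀ n, r n < 1 := fun n => by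
      have : (0 : ℝ) < 1 / (n + 1) := by positivity
      simp only [hr]; linarith
    have hrl : Filter.Tendsto r Filter.atTop (nhds 1) := by
      simpa [hr] using tendsto_one_div_add_atTop_nhds_zero_nat.const_sub (1 : ℝ)
    have hball : ∀ n (t : Circ), ‖(r n : ℂ) * fourier 1 t‖ < 1 := by
      intro n t
      rw [norm_mul, norm_fourier, mul_one, Complex.norm_real, Real.norm_of_nonneg (hr0 n)]
      exact hr1 n
    have hH := fun n => HInf.of_differentiableOn hd (hr0 n) (hr1 n)
    have hl := HInf.lim (g := fun t => φ (stripMap θ (fourier 1 t))) (fun n => (hH n).1) B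
      (fun n => Filter.Eventually.of_forall fun t =>
        hB _ (hOS (stripMap_mem_oStrip h0 h1 (hball n t)).2))
      (by
        filter_upwards [hgood] with t ⟨ha, hb⟩
        have hne : (1 - fourier 1 t : ℂ) ≠ 0 := sub_ne_zero.2 (Ne.symm ha)
        have hz : Filter.Tendsto (fun n => (r n : ℂ) * fourier 1 t) Filter.atTop
            (nhds (fourier 1 t)) := by
          have h := ((Complex.continuous_ofReal.tendsto _).comp hrl).mul_const
            (fourier 1 t : ℂ)
          simpa using h
        have hslit : -I * halfMap θ (fourier 1 t) ∈ slitPlane := by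
          refine Or.inr ?_
          have : (-I * halfMap θ (fourier 1 t)).im = -(halfMap θ (fourier 1 t)).re := by simp
          rw [this, neg_ne_zero]
          intro h
          rw [hreal t, h] at hb; simp at hb
        have hcH : ContinuousAt (fun ζ => -I * halfMap θ ζ) (fourier 1 t) := by
          unfold halfMap
          fun_prop (disch := exact hne)
        have hcL : ContinuousAt (stripMap θ) (fourier 1 t) := by
          have := hcH.clog hslit
          have : ContinuousAt (fun ζ => 1 / 2 + log (-I * halfMap θ ζ) / (Real.pi * I))
            (fourier 1 t) := by fun_prop
          exact this
        have hS : ∀ n, stripMap θ (r n * fourier 1 t) ∈ Strip := fun n =>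
          hOS (stripMap_mem_oStrip h0 h1 (hball n t)).2
        have hclosed : IsClosed Strip := by
          have : Strip = Complex.re ⁻¹' Set.Icc 0 1 := rfl
          rw [this]; exact isClosed_Icc.preimage Complex.continuous_re
        have hlimS := hcL.tendsto.comp hz
        have hmem : stripMap θ (fourier 1 t) ∈ Strip :=
          hclosed.mem_of_tendsto hlimS (Filter.Eventually.of_forall hS)
        exact (hφc _ hmem).tendsto.comp (tendsto_nhdsWithin_iff.2
          ⟨hlimS, Filter.Eventually.of_forall hS⟩))
    refine ⟨hl.1, tendsto_nhds_unique hl.2 ?_⟩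
    simp only [(hH _).2]
    rw [stripMap_zero h0 h1]
    exact tendsto_const_nhds

/-- Hahn–Banach for a functional given through a (not necessarily injective) map. -/
theorem exists_dominated_extension {P E : Type*} [AddCommGroup P] [Module ℂ P] [AddCommGroup E]
    [Module ℂ E] (J : P →ₗ[ℂ] E) (L : P →ₗ[ℂ] ℂ) (p : Seminorm ℂ E)
    (h : ∀ x, ‖L x‖ ≤ p (J x)) :
    ∃ l : E →ₗ[ℂ] ℂ, (∀ x, l (J x) = L x) ∧ ∀ y, ‖l y‖ ≤ p y := by
  have hker : J.ker ≤ L.ker := by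
    intro x hx
    rw [LinearMap.mem_ker] at hx ⊢
    have := h x
    rw [hx, map_zero] at this
    exact norm_le_zero_iff.1 this
  let f : Module.Dual ℂ J.range := (J.ker.liftQ L hker).comp J.quotKerEquivRange.symm.toLinearMap
  have hf : ∀ x, f ⟨J x, LinearMap.mem_range_self J x⟩ = L x := by
    intro x
    have : J.quotKerEquivRange.symm ⟨J x, LinearMap.mem_range_self J x⟩ =
        J.ker.mkQ x := by
      rw [LinearEquiv.symm_apply_eq]; rfl
    simp only [f, LinearMap.comp_apply, LinearEquiv.coe_coe, this]
    simp
  obtain ⟨g, hg, hg2⟩ := Module.Dual.exists_extension_of_le_seminorm J.range f (p := p) (by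
    rintro ⟨_, x, rfl⟩
    rw [hf]; exact h x)
  exact ⟨g, fun x => by rw [← hf]; exact hg ⟨J x, LinearMap.mem_range_self J x⟩, hg2⟩

/-- A seminorm with prescribed value at a point is attained by a functional. -/
theorem exists_dual_vector_seminorm {E : Type*} [AddCommGroup E] [Module ℂ E] (p : Seminorm ℂ E)
    (x : E) : ∃ l : E →ₗ[ℂ] ℂ, l x = p x ∧ ∀ y, ‖l y‖ ≤ p y := by
  obtain ⟨l, h1, h2⟩ := exists_dominated_extension (LinearMap.toSpanSingleton ℂ E x)
    ((p x : ℂ) • LinearMap.id) p (fun c => by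
      simp [map_smul_eq_mul, abs_of_nonneg (apply_nonneg p x), mul_comm])
  exact ⟨l, by simpa using h1 1, h2⟩

section FiniteDim

variable {A : Type*} [Fintype A]

theorem seminorm_le_sum_pi (N : Seminorm ℂ (A → ℂ)) [DecidableEq A] (x : A → ℂ) :
    N x ≤ ∑ a, ‖x a‖ * N (Pi.single a 1) := by
  have : x = ∑ a, x a • (Pi.single a 1 : A → ℂ) := by
    ext b
    simp [Finset.sum_apply, Pi.single_apply]
  calc N x = N (∑ a, x a • (Pi.single a 1 : A → ℂ)) := by rw [← this]
    _ ≤ ∑ a, N (x a • (Pi.single a 1 : A → ℂ)) := Finset.le_sum_of_subadditive N (map_zero N).le (map_add_le_add N) _ _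
    _ = _ := by simp [map_smul_eq_mul]

theorem seminorm_exists_bound_pi (N : Seminorm ℂ (A → ℂ)) :
    ∃ C : ℝ, 0 ≤ C ∧ ∀ x, N x ≤ C * ‖x‖ := by
  classical
  refine ⟨∑ a, N (Pi.single a 1), Finset.sum_nonneg fun _ _ => apply_nonneg _ _, fun x => ?_⟩
  refine (seminorm_le_sum_pi N x).trans ?_
  rw [Finset.sum_mul]
  refine Finset.sum_le_sum fun a _ => ?_
  rw [mul_comm]
  exact mul_le_mul_of_nonneg_left (norm_le_pi_norm x a) (apply_nonneg _ _)

theorem seminorm_continuous_pi (N : Seminorm ℂ (A → ℂ)) : Continuous N := by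
  obtain ⟨C, hC, h⟩ := seminorm_exists_bound_pi N
  refine Seminorm.continuous_of_le (q := C.toNNReal • normSeminorm ℂ (A → ℂ)) ?_ ?_
  · have : (⇑(C.toNNReal • normSeminorm ℂ (A → ℂ))) = fun x => C * ‖x‖ := by
      ext x
      simp [NNReal.smul_def, Real.coe_toNNReal _ hC]
    rw [this]; fun_prop
  · intro x
    simpa [NNReal.smul_def, Real.coe_toNNReal _ hC] using h x

theorem aestronglyMeasurable_sideNorm (N : Bool → Seminorm ℂ (A → ℂ)) {b : Circ → Bool}
    (hb : Measurable b) {f : Circ → A → ℂ} (hf : ∀ a, AEStronglyMeasurable (fun t => f t a) tm) :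
    AEStronglyMeasurable (fun t => N (b t) (f t)) tm := by
  have h1 : AEStronglyMeasurable (fun t => (b t, f t)) tm :=
    hb.aestronglyMeasurable.prodMk
      (aemeasurable_pi_iff.2 fun a => (hf a).aemeasurable).aestronglyMeasurable
  have h2 : Continuous (fun x : Bool × (A → ℂ) => N x.1 x.2) :=
    continuous_prod_of_discrete_left.2 fun c => seminorm_continuous_pi (N c)
  exact h2.comp_aestronglyMeasurable h1

theorem exists_bound_side (N : Bool → Seminorm ℂ (A → ℂ)) :
    ∃ C : ℝ, 0 ≤ C ∧ ∀ b x, N b x ≤ C * ‖x‖ := by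
  obtain ⟨C, hC, h⟩ := seminorm_exists_bound_pi (N true)
  obtain ⟨D, hD, h'⟩ := seminorm_exists_bound_pi (N false)
  refine ⟨max C D, le_max_of_le_left hC, fun b x => ?_⟩
  cases b
  · exact (h' x).trans (mul_le_mul_of_nonneg_right (le_max_right _ _) (norm_nonneg _))
  · exact (h x).trans (mul_le_mul_of_nonneg_right (le_max_left _ _) (norm_nonneg _))

theorem memLp_sideNorm (N : Bool → Seminorm ℂ (A → ℂ)) {b : Circ → Bool}
    (hb : Measurable b) {f : Circ → A → ℂ} (hf : ∀ a, MemLp (fun t => f t a) 2 tm) :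
    MemLp (fun t => N (b t) (f t)) 2 tm := by
  obtain ⟨C, hC, h⟩ := exists_bound_side N
  have h2 : MemLp f 2 tm := MemLp.of_eval hf
  refine (h2.norm.const_mul C).of_le (aestronglyMeasurable_sideNorm N hb fun a => (hf a).1) ?_
  refine Filter.Eventually.of_forall fun t => ?_
  rw [Real.norm_of_nonneg (apply_nonneg _ _)]
  exact (h _ _).trans (le_abs_self _)

end FiniteDim

/-- The inverse of `stripMap`. -/
def discMap (θ : ℝ) (z : ℂ) : ℂ :=
  (cexp (Real.pi * I * z) - unitPt θ) / (cexp (Real.pi * I * z) - (starRingEnd ℂ) (unitPt θ))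

theorem exp_strip_im {z : ℂ} (hz : z ∈ Strip) : 0 ≤ (cexp (Real.pi * I * z)).im := by
  rw [Complex.exp_im]
  refine mul_nonneg (Real.exp_pos _).le ?_
  have : (Real.pi * I * z).im = Real.pi * z.re := by simp
  rw [this]
  refine Real.sin_nonneg_of_nonneg_of_le_pi (mul_nonneg Real.pi_pos.le hz.1) ?_
  nlinarith [Real.pi_pos, hz.2]

theorem discMap_den_ne {θ : ℝ} (h0 : 0 < θ) (h1 : θ < 1) {z : ℂ} (hz : z ∈ Strip) :
    cexp (Real.pi * I * z) - (starRingEnd ℂ) (unitPt θ) ≠ 0 := by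
  intro h
  have h2 := exp_strip_im hz
  have h3 := unitPt_im_pos h0 h1
  rw [sub_eq_zero.1 h] at h2
  simp at h2
  linarith

theorem differentiableAt_discMap {θ : ℝ} (h0 : 0 < θ) (h1 : θ < 1) {z : ℂ} (hz : z ∈ Strip) :
    DifferentiableAt ℂ (discMap θ) z := by
  unfold discMap
  have := discMap_den_ne h0 h1 hz
  fun_prop (disch := exact this)

theorem norm_discMap_le {θ : ℝ} (h0 : 0 < θ) (h1 : θ < 1) {z : ℂ} (hz : z ∈ Strip) :
    ‖discMap θ z‖ ≤ 1 := by
  have hd := discMap_den_ne h0 h1 hz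
  rw [discMap, norm_div, div_le_one (norm_pos_iff.2 hd)]
  have h2 := exp_strip_im hz
  have h3 := unitPt_im_pos h0 h1
  generalize cexp (Real.pi * I * z) = w at *
  rw [← sq_le_sq₀ (norm_nonneg _) (norm_nonneg _), Complex.sq_norm, Complex.sq_norm,
    Complex.normSq_apply, Complex.normSq_apply]
  simp
  nlinarith

theorem discMap_self (θ : ℝ) : discMap θ θ = 0 := by
  rw [discMap, unitPt]
  have : (Real.pi * I * θ : ℂ) = (Real.pi * θ : ℝ) * I := by push_cast; ring
  rw [this]; simp

theorem discMap_boundary {θ : ℝ} (h0 : 0 < θ) (h1 : θ < 1) {z : ℂ} (hz : z ∈ Strip) (x : ℝ)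
    (hx : cexp (Real.pi * I * z) = x) :
    ∃ t : Circ, fourier 1 t = discMap θ z ∧ (0 ≤ x → 0 ≤ sideFn θ t) ∧
      (x ≤ 0 → sideFn θ t ≤ 0) := by
  have hd := discMap_den_ne h0 h1 hz
  have hn : ‖discMap θ z‖ = 1 := by
    rw [discMap, norm_div, div_eq_one_iff_eq (norm_ne_zero_iff.2 hd), hx]
    have : (x : ℂ) - unitPt θ = (starRingEnd ℂ) ((x : ℂ) - (starRingEnd ℂ) (unitPt θ)) := by simp
    rw [this, RCLike.norm_conj]
  obtain ⟨t, ht⟩ := (AddCircle.homeomorphCircle (one_ne_zero (α := ℝ))).surjective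
    (⟨discMap θ z, mem_sphere_zero_iff_norm.2 hn⟩ : Circle)
  have ht' : fourier 1 t = discMap θ z := by
    rw [fourier_one, ← AddCircle.homeomorphCircle_apply one_ne_zero, ht]
  have hs : sideFn θ t * Complex.normSq (x - (starRingEnd ℂ) (unitPt θ)) =
      4 * x * (unitPt θ).im ^ 2 := by
    rw [hx] at hd
    have e : ((starRingEnd ℂ) (unitPt θ) * discMap θ z).re *
        Complex.normSq (x - (starRingEnd ℂ) (unitPt θ)) =
        ((starRingEnd ℂ) (unitPt θ) * (x - unitPt θ) * (x - unitPt θ)).re := by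
      rw [mul_comm, ← Complex.re_ofReal_mul, discMap, hx, Complex.normSq_eq_conj_mul_self]
      congr 1
      field_simp
      simp
      ring
    rw [sideFn, ht', sub_mul, mul_assoc 2 (Complex.re (_ * _)), e, Complex.normSq_apply]
    simp
    ring
  have hpos : 0 < Complex.normSq (x - (starRingEnd ℂ) (unitPt θ)) := by
    rw [hx] at hd; exact Complex.normSq_pos.2 hd
  refine ⟨t, ht', fun h => ?_, fun h => ?_⟩
  · by_contra hc
    nlinarith [mul_nonneg h (sq_nonneg (unitPt θ).im)]
  · by_contra hc
    push Not at hc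
    nlinarith [mul_pos hc hpos, mul_nonneg (neg_nonneg.2 h) (sq_nonneg (unitPt θ).im)]

theorem sideFn_ne_zero (θ : ℝ) : ∀ᵐ t ∂tm, sideFn θ t ≠ 0 := by
  filter_upwards [circle_null 1, circle_null (unitPt θ * unitPt θ)] with t h1 h2 h3
  have ha := unitPt_sq θ
  have hb := fourier_one_sq t
  set w : ℂ := (starRingEnd ℂ) (unitPt θ) * fourier 1 t with hw
  have hre : w.re = (unitPt θ).re := by
    unfold sideFn at h3; linarith
  have hα : unitPt θ * (starRingEnd ℂ) (unitPt θ) = 1 := by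
    rw [Complex.mul_conj, Complex.normSq_apply]; norm_cast; nlinarith
  have hζ : fourier 1 t = unitPt θ * w := by rw [hw, ← mul_assoc, hα, one_mul]
  have hn : w.re ^ 2 + w.im ^ 2 = 1 := by
    have := Complex.sq_norm w
    have h4 : Complex.normSq (unitPt θ) = 1 := by rw [Complex.normSq_apply]; nlinarith
    rw [hw, norm_mul, norm_fourier, RCLike.norm_conj, mul_one, Complex.sq_norm, h4, ← hw,
      Complex.normSq_apply] at this
    nlinarith
  have him : w.im ^ 2 = (unitPt θ).im ^ 2 := by rw [hre] at hn; linarith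
  rcases sq_eq_sq_iff_eq_or_eq_neg.1 him with h | h
  · have : w = unitPt θ := Complex.ext hre h
    exact h2 (by rw [hζ, this])
  · have : w = (starRingEnd ℂ) (unitPt θ) := Complex.ext (by simpa using hre) (by simpa using h)
    exact h1 (by rw [hζ, this, hα])

theorem interpN_le {D : Type*} [AddCommGroup D] [Module ℂ D] {θ : ℝ} {N₀ N₁ : D → ℝ}
    (hN : ∀ x, 0 ≤ N₀ x) {ι : Type*} [Fintype ι] (φ : ι → ℂ → ℂ) (v : ι → D)
    (hc : ∀ i, ContinuousOn (φ i) Strip) (hd : ∀ i, DifferentiableOn ℂ (φ i) OStrip)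
    (hb : ∀ i, ∃ B : ℝ, ∀ z ∈ Strip, ‖φ i z‖ ≤ B) {x : D} (hx : ∑ i, φ i (θ : ℂ) • v i = x)
    {c : ℝ} (h0 : ∀ t : ℝ, N₀ (∑ i, φ i (Complex.I * t) • v i) ≤ c)
    (h1 : ∀ t : ℝ, N₁ (∑ i, φ i (1 + Complex.I * t) • v i) ≤ c) : interpN θ N₀ N₁ x ≤ c := by
  let e := Fintype.equivFin ι
  have key : ∀ z : ℂ, ∑ i, φ (e.symm i) z • v (e.symm i) = ∑ i, φ i z • v i := fun z =>
    Equiv.sum_comp e.symm (fun i => φ i z • v i)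
  refine csInf_le ⟨0, ?_⟩ ⟨Fintype.card ι, fun i => φ (e.symm i), fun i => v (e.symm i),
    fun i => hc _, fun i => hd _, fun i => hb _, ?_, ?_, ?_⟩
  · rintro c ⟨m, φ, v, -, -, -, -, h, -⟩
    exact (hN _).trans (h 0)
  · rw [key]; exact hx
  · intro t; rw [key]; exact h0 t
  · intro t; rw [key]; exact h1 t

section Dual

variable {A : Type*} [Fintype A]

theorem norm_apply_le_of_majorant {θ : ℝ} (h0 : 0 < θ) (h1 : θ < 1)
    (N : Bool → Seminorm ℂ (A → ℂ)) (L : (A → ℂ) →ₗ[ℂ] ℂ)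
    (hL : ∀ x, ‖L x‖ ≤ interpN θ (N true) (N false) x) (p : A → Polynomial ℂ) (v : C(Circ, ℝ))
    (hv : ∀ t, 0 < v t)
    (hv1 : ∀ t, 0 ≤ sideFn θ t → N true (fun a => (p a).eval (fourier 1 t)) ≤ v t)
    (hv2 : ∀ t, sideFn θ t ≤ 0 → N false (fun a => (p a).eval (fourier 1 t)) ≤ v t) :
    ‖L (fun a => (p a).coeff 0)‖ ≤ ∫ t, v t ∂tm := by
  classical
  have main : ∀ ε : ℝ, 0 < ε →
      ‖L (fun a => (p a).coeff 0)‖ ≤ Real.exp (2 * ε) * ∫ t, v t ∂tm := by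
    intro ε hε
    let u : C(Circ, ℝ) := ⟨fun t => Real.log (v t),
      (map_continuous v).log fun t => (hv t).ne'⟩
    obtain ⟨P, hP0, hP⟩ := exists_polynomial_re u hε
    have hgc : ∀ Q : Polynomial ℂ, ContinuousOn (fun z => Q.eval (discMap θ z)) Strip :=
      fun Q => Q.continuous.comp_continuousOn fun z hz =>
        (differentiableAt_discMap h0 h1 hz).continuousAt.continuousWithinAt
    have hgd : ∀ Q : Polynomial ℂ, DifferentiableOn ℂ (fun z => Q.eval (discMap θ z)) OStrip :=
      fun Q z hz => (Q.differentiable.differentiableAt.comp z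
        (differentiableAt_discMap h0 h1 ⟨hz.1.le, hz.2.le⟩)).differentiableWithinAt
    have hgb : ∀ Q : Polynomial ℂ, ∃ B : ℝ, ∀ z ∈ Strip, ‖Q.eval (discMap θ z)‖ ≤ B := by
      intro Q
      obtain ⟨B, hB⟩ := (isCompact_closedBall (0 : ℂ) 1).exists_bound_of_continuousOn
        Q.continuous.continuousOn
      exact ⟨B, fun z hz => hB _ (mem_closedBall_zero_iff.2 (norm_discMap_le h0 h1 hz))⟩
    let φ : A → ℂ → ℂ := fun a z => cexp (-P.eval (discMap θ z)) * (p a).eval (discMap θ z)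
    have hsum : ∀ z, ∑ a, φ a z • (Pi.single a 1 : A → ℂ) =
        cexp (-P.eval (discMap θ z)) • fun a => (p a).eval (discMap θ z) := by
      intro z
      ext b
      simp [φ, Finset.sum_apply, Pi.single_apply]
    have hest : ∀ (b : Bool) (t : Circ),
        N b (fun a => (p a).eval (fourier 1 t)) ≤ v t →
        N b (cexp (-P.eval (fourier 1 t)) • fun a => (p a).eval (fourier 1 t)) ≤ Real.exp ε := by
      intro b t hb
      rw [map_smul_eq_mul, Complex.norm_exp, Complex.neg_re]
      have h2 := (abs_le.1 (hP t)).1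
      have h3 : u t = Real.log (v t) := rfl
      calc _ ≤ Real.exp (-(P.eval (fourier 1 t)).re) * v t := by gcongr
        _ = Real.exp (-(P.eval (fourier 1 t)).re + u t) := by
          rw [Real.exp_add, h3, Real.exp_log (hv t)]
        _ ≤ _ := Real.exp_le_exp.2 (by linarith)
    have hle := interpN_le (θ := θ) (N₀ := N true) (N₁ := N false) (fun x => apply_nonneg _ x) φ
      (fun a => (Pi.single a 1 : A → ℂ))
      (fun a => (Complex.continuous_exp.comp_continuousOn (hgc P).neg).mul (hgc (p a)))
      (fun a => ((hgd P).neg.cexp).mul (hgd (p a)))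
      (fun a => by
        obtain ⟨B, hB⟩ := hgb P
        obtain ⟨C, hC⟩ := hgb (p a)
        refine ⟨Real.exp B * C, fun z hz => ?_⟩
        rw [norm_mul]
        have : ‖cexp (-P.eval (discMap θ z))‖ ≤ Real.exp B := by
          rw [Complex.norm_exp]
          refine Real.exp_le_exp.2 ((Complex.re_le_norm _).trans ?_)
          rw [norm_neg]; exact hB z hz
        exact mul_le_mul this (hC z hz) (norm_nonneg _) (Real.exp_pos _).le)
      rfl (c := Real.exp ε)
      (fun τ => by
        have hz : (I * τ : ℂ) ∈ Strip := by simp [Strip]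
        have he : cexp (Real.pi * I * (I * τ)) = (Real.exp (-(Real.pi * τ)) : ℝ) := by
          rw [Complex.ofReal_exp]; congr 1; push_cast
          linear_combination (Real.pi * τ : ℂ) * I_sq
        obtain ⟨t, ht, ht1, -⟩ := discMap_boundary h0 h1 hz _ he
        rw [hsum, ← ht]
        exact hest true t (hv1 t (ht1 (Real.exp_pos _).le)))
      (fun τ => by
        have hz : (1 + I * τ : ℂ) ∈ Strip := by simp [Strip]
        have he : cexp (Real.pi * I * (1 + I * τ)) = (-Real.exp (-(Real.pi * τ)) : ℝ) := by
          have : (Real.pi * I * (1 + I * τ) : ℂ) = Real.pi * I + (-(Real.pi * τ) : ℝ) := by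
            push_cast; linear_combination (Real.pi * τ : ℂ) * I_sq
          rw [this, Complex.exp_add, Complex.exp_pi_mul_I]; push_cast; ring
        obtain ⟨t, ht, -, ht1⟩ := discMap_boundary h0 h1 hz _ he
        rw [hsum, ← ht]
        exact hest false t (hv2 t (ht1 (by simpa using (Real.exp_pos _).le))))
    rw [hsum, discMap_self] at hle
    have hL2 := (hL _).trans hle
    simp only [← Polynomial.coeff_zero_eq_eval_zero] at hL2
    rw [map_smul, norm_smul, Complex.norm_exp, Complex.neg_re] at hL2
    have hPre : (P.coeff 0).re ≤ (∫ t, u t ∂tm) + ε := by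
      have hi := (HInf.polynomial P)
      have : (P.coeff 0).re = ∫ t, (P.eval (fourier 1 t)).re ∂tm := by
        rw [← hi.2]; exact (integral_re hi.1.integrable).symm
      have hu : Integrable (fun t => u t) tm := u.continuous.integrable_of_hasCompactSupport
        (HasCompactSupport.of_compactSpace _)
      have h4 : ∫ t, (u t + ε) ∂tm = (∫ t, u t ∂tm) + ε := by
        rw [integral_add hu (integrable_const _)]; simp
      rw [this, ← h4]
      refine integral_mono hi.1.integrable.re (hu.add (integrable_const _)) fun t => ?_
      have := (abs_le.1 (hP t)).2
      change (P.eval (fourier 1 t)).re ≤ u t + ε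
      linarith
    have hJ : Real.exp (∫ t, u t ∂tm) ≤ ∫ t, v t ∂tm := by
      have hu : Integrable (fun t => u t) tm := u.continuous.integrable_of_hasCompactSupport
        (HasCompactSupport.of_compactSpace _)
      have hvv : Integrable (fun t => v t) tm := v.continuous.integrable_of_hasCompactSupport
        (HasCompactSupport.of_compactSpace _)
      have hev : (fun t => Real.exp (u t)) = fun t => v t := by
        ext t; exact Real.exp_log (hv t)
      have := convexOn_exp.map_integral_le (μ := tm) (f := fun t => u t)
        Real.continuous_exp.continuousOn isClosed_univ (by simp) hu
        (by change Integrable (fun t => Real.exp (u t)) tm; rw [hev]; exact hvv)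
      rwa [hev] at this
    calc ‖L (fun a => (p a).coeff 0)‖
        = Real.exp (P.coeff 0).re * (Real.exp (-(P.coeff 0).re) *
          ‖L (fun a => (p a).coeff 0)‖) := by
          rw [← mul_assoc, ← Real.exp_add]; simp
      _ ≤ Real.exp ((∫ t, u t ∂tm) + ε) * Real.exp ε := by
          refine mul_le_mul (Real.exp_le_exp.2 hPre) hL2 (by positivity) (Real.exp_pos _).le
      _ = Real.exp (2 * ε) * Real.exp (∫ t, u t ∂tm) := by
          rw [← Real.exp_add, ← Real.exp_add]; ring_nf
      _ ≤ _ := by gcongr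
  have hlim : Filter.Tendsto (fun ε : ℝ => Real.exp (2 * ε) * ∫ t, v t ∂tm)
      (nhdsWithin 0 (Set.Ioi 0)) (nhds (Real.exp (2 * 0) * ∫ t, v t ∂tm)) := by
    refine Filter.Tendsto.mono_left ?_ nhdsWithin_le_nhds
    exact Continuous.tendsto (by fun_prop) 0
  have := ge_of_tendsto hlim (by
    filter_upwards [self_mem_nhdsWithin] with ε hε using main ε hε)
  simpa using this

theorem norm_apply_le_integral {θ : ℝ} (h0 : 0 < θ) (h1 : θ < 1)
    (N : Bool → Seminorm ℂ (A → ℂ)) (L : (A → ℂ) →ₗ[ℂ] ℂ)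
    (hL : ∀ x, ‖L x‖ ≤ interpN θ (N true) (N false) x) (p : A → Polynomial ℂ) :
    ‖L (fun a => (p a).coeff 0)‖ ≤
      ∫ t, N (side θ t) (fun a => (p a).eval (fourier 1 t)) ∂tm := by
  have hpc : Continuous fun t : Circ => fun a => (p a).eval (fourier 1 t) :=
    continuous_pi fun a => (p a).continuous.comp (map_continuous (fourier 1))
  have hNc : ∀ b, Continuous fun t : Circ => N b fun a => (p a).eval (fourier 1 t) := fun b =>
    (seminorm_continuous_pi (N b)).comp hpc
  let f : Bool → Circ → ℝ := fun b t => N b fun a => (p a).eval (fourier 1 t)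
  have hf0 : ∀ b t, 0 ≤ f b t := fun b t => apply_nonneg _ _
  have hsc := continuous_sideFn θ
  let v : ℕ → C(Circ, ℝ) := fun n =>
    ⟨fun t => max 0 (min 1 (1 + n * sideFn θ t)) * f true t +
      max 0 (min 1 (1 - n * sideFn θ t)) * f false t + 1 / ((n : ℝ) + 1), by
        have h1 : Continuous (f true) := hNc true
        have h2 : Continuous (f false) := hNc false
        fun_prop⟩
  have hpos : ∀ n : ℕ, (0 : ℝ) < 1 / ((n : ℝ) + 1) := fun n => by positivity
  have hχ : ∀ x : ℝ, 0 ≤ max 0 (min 1 x) := fun x => le_max_left _ _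
  have hχ1 : ∀ x : ℝ, max 0 (min 1 x) ≤ 1 := fun x => max_le zero_le_one (min_le_left _ _)
  have hle : ∀ n, ‖L (fun a => (p a).coeff 0)‖ ≤ ∫ t, v n t ∂tm := by
    intro n
    refine norm_apply_le_of_majorant h0 h1 N L hL p (v n) (fun t => ?_) (fun t ht => ?_)
      (fun t ht => ?_)
    · have := mul_nonneg (hχ (1 + n * sideFn θ t)) (hf0 true t)
      have := mul_nonneg (hχ (1 - n * sideFn θ t)) (hf0 false t)
      have := hpos n
      simp only [v, ContinuousMap.coe_mk]; linarith
    · have e : max 0 (min 1 (1 + n * sideFn θ t)) = 1 := by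
        rw [min_eq_left, max_eq_right zero_le_one]
        have := mul_nonneg (Nat.cast_nonneg (α := ℝ) n) ht; linarith
      have := mul_nonneg (hχ (1 - n * sideFn θ t)) (hf0 false t)
      have := hpos n
      simp only [v, ContinuousMap.coe_mk, e, one_mul]
      change f true t ≤ _
      linarith
    · have e : max 0 (min 1 (1 - n * sideFn θ t)) = 1 := by
        rw [min_eq_left, max_eq_right zero_le_one]
        have := mul_nonneg (Nat.cast_nonneg (α := ℝ) n) (neg_nonneg.2 ht); linarith
      have := mul_nonneg (hχ (1 + n * sideFn θ t)) (hf0 true t)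
      have := hpos n
      simp only [v, ContinuousMap.coe_mk, e, one_mul]
      change f false t ≤ _
      linarith
  have hbd : ∀ b, Integrable (f b) tm := fun b =>
    (hNc b).integrable_of_hasCompactSupport (HasCompactSupport.of_compactSpace _)
  have hlim : Filter.Tendsto (fun n => ∫ t, v n t ∂tm) Filter.atTop
      (nhds (∫ t, f (side θ t) t ∂tm)) := by
    refine tendsto_integral_of_dominated_convergence (fun t => f true t + f false t + 1)
      (fun n => (v n).continuous.aestronglyMeasurable)
      (((hbd true).add (hbd false)).add (integrable_const 1)) (fun n => ?_) ?_
    · refine Filter.Eventually.of_forall fun t => ?_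
      have a1 := mul_nonneg (hχ (1 + n * sideFn θ t)) (hf0 true t)
      have a2 := mul_nonneg (hχ (1 - n * sideFn θ t)) (hf0 false t)
      have a3 := hpos n
      have b1 := mul_le_mul_of_nonneg_right (hχ1 (1 + n * sideFn θ t)) (hf0 true t)
      have b2 := mul_le_mul_of_nonneg_right (hχ1 (1 - n * sideFn θ t)) (hf0 false t)
      have b3 : (1 : ℝ) / ((n : ℝ) + 1) ≤ 1 := by
        rw [div_le_one (by positivity)]; linarith [(Nat.cast_nonneg n : (0 : ℝ) ≤ n)]
      simp only [v, ContinuousMap.coe_mk]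
      rw [Real.norm_of_nonneg (by linarith)]
      linarith
    · filter_upwards [sideFn_ne_zero θ] with t ht
      have hn : Filter.Tendsto (fun n : ℕ => 1 / ((n : ℝ) + 1)) Filter.atTop (nhds 0) :=
        tendsto_one_div_add_atTop_nhds_zero_nat
      have hev : ∀ c : ℝ, 0 < c → ∀ᶠ n : ℕ in Filter.atTop, 1 ≤ n * c := by
        intro c hc
        obtain ⟨m, hm⟩ := exists_nat_gt (1 / c)
        filter_upwards [Filter.eventually_ge_atTop m] with n hn
        have : (m : ℝ) ≤ n := by exact_mod_cast hn
        rw [div_lt_iff₀ hc] at hm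
        nlinarith
      rcases lt_or_gt_of_ne ht with h | h
      · have hb : side θ t = false := by simp [side, h]
        rw [hb]
        have : Filter.Tendsto (fun n : ℕ => f false t + 1 / ((n : ℝ) + 1)) Filter.atTop
            (nhds (f false t)) := by simpa using hn.const_add (f false t)
        refine this.congr' ?_
        filter_upwards [hev (-sideFn θ t) (by linarith)] with n hn
        simp only [v, ContinuousMap.coe_mk]
        rw [min_eq_right (a := (1 : ℝ)) (b := 1 + n * sideFn θ t) (by linarith),
          max_eq_left (by linarith), min_eq_left (by linarith), max_eq_right zero_le_one]
        ring
      · have hb : side θ t = true := by simp [side, h.le]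
        rw [hb]
        have : Filter.Tendsto (fun n : ℕ => f true t + 1 / ((n : ℝ) + 1)) Filter.atTop
            (nhds (f true t)) := by simpa using hn.const_add (f true t)
        refine this.congr' ?_
        filter_upwards [hev (sideFn θ t) h] with n hn
        simp only [v, ContinuousMap.coe_mk]
        rw [min_eq_left (a := (1 : ℝ)) (b := 1 + n * sideFn θ t) (by linarith),
          max_eq_right zero_le_one, min_eq_right (by linarith), max_eq_left (by linarith)]
        ring
  exact ge_of_tendsto hlim (Filter.Eventually.of_forall hle)

theorem integrable_sideNorm (N : Bool → Seminorm ℂ (A → ℂ)) {b : Circ → Bool}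
    (hb : Measurable b) {f : Circ → A → ℂ} (hf : ∀ a, MemLp (fun t => f t a) 2 tm) :
    Integrable (fun t => N (b t) (f t)) tm :=
  (memLp_sideNorm N hb hf).integrable (by norm_num)

/-- The seminorm `∫ N (b t) (f t)` on vectors of square-integrable functions. -/
def intSeminorm (N : Bool → Seminorm ℂ (A → ℂ)) (b : Circ → Bool) (hb : Measurable b) :
    Seminorm ℂ (A → Lp ℂ 2 tm) :=
  Seminorm.of (fun f => ∫ t, N (b t) (fun a => f a t) ∂tm)
    (fun f g => by
      have hf := integrable_sideNorm N hb (f := fun t a => f a t) fun a => Lp.memLp (f a)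
      have hg := integrable_sideNorm N hb (f := fun t a => g a t) fun a => Lp.memLp (g a)
      rw [← integral_add hf hg]
      refine integral_mono_ae (integrable_sideNorm N hb (f := fun t a => (f + g) a t)
        fun a => Lp.memLp ((f + g) a)) (hf.add hg) ?_
      have : ∀ᵐ t ∂tm, ∀ a, (f + g) a t = f a t + g a t :=
        ae_all_iff.2 fun a => Lp.coeFn_add (f a) (g a)
      filter_upwards [this] with t ht
      simp only [ht]
      exact map_add_le_add (N (b t)) (fun a => f a t) (fun a => g a t))
    (fun c f => by
      rw [← integral_const_mul]
      refine integral_congr_ae ?_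
      have : ∀ᵐ t ∂tm, ∀ a, (c • f) a t = c * f a t :=
        ae_all_iff.2 fun a => Lp.coeFn_smul c (f a)
      filter_upwards [this] with t ht
      simp only [ht]
      exact map_smul_eq_mul (N (b t)) c (fun a => f a t))

theorem intSeminorm_toLp (N : Bool → Seminorm ℂ (A → ℂ)) {b : Circ → Bool} (hb : Measurable b)
    {f : Circ → A → ℂ} (hf : ∀ a, MemLp (fun t => f t a) 2 tm) :
    intSeminorm N b hb (fun a => (hf a).toLp) = ∫ t, N (b t) (f t) ∂tm := by
  change ∫ t, N (b t) (fun a => (hf a).toLp _ t) ∂tm = _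
  refine integral_congr_ae ?_
  have : ∀ᵐ t ∂tm, ∀ a, (hf a).toLp _ t = f t a := ae_all_iff.2 fun a => (hf a).coeFn_toLp
  filter_upwards [this] with t ht
  simp only [ht]

theorem intSeminorm_single_le [DecidableEq A] (N : Bool → Seminorm ℂ (A → ℂ)) {b : Circ → Bool}
    (hb : Measurable b) (a : A) : ∃ C : ℝ, ∀ f : Lp ℂ 2 tm,
      intSeminorm N b hb (Pi.single a f) ≤ C * ‖f‖ := by
  obtain ⟨C, hC, h⟩ := exists_bound_side N
  refine ⟨C, fun f => ?_⟩
  have h1 : intSeminorm N b hb (Pi.single a f) ≤ ∫ t, C * ‖f t‖ ∂tm := by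
    change ∫ t, N (b t) (fun a' => (Pi.single a f : A → Lp ℂ 2 tm) a' t) ∂tm ≤ _
    have hfi : Integrable (fun t => f t) tm := (Lp.memLp f).integrable (by norm_num)
    refine integral_mono_ae (integrable_sideNorm N hb
      (f := fun t a' => (Pi.single a f : A → Lp ℂ 2 tm) a' t) fun a' => Lp.memLp _)
      (hfi.norm.const_mul C) ?_
    have : ∀ᵐ t ∂tm, (0 : Lp ℂ 2 tm) t = 0 := Lp.coeFn_zero _ _ _
    filter_upwards [this] with t ht
    refine (h _ _).trans (mul_le_mul_of_nonneg_left ?_ hC)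
    refine (pi_norm_le_iff_of_nonneg (norm_nonneg _)).2 fun a' => ?_
    by_cases e : a' = a
    · subst e; simp
    · rw [Pi.single_eq_of_ne e, ht]; simp
  refine h1.trans ?_
  rw [integral_const_mul]
  refine mul_le_mul_of_nonneg_left ?_ hC
  have h2 : eLpNorm f 1 tm ≤ eLpNorm f 2 tm :=
    eLpNorm_le_eLpNorm_of_exponent_le (by norm_num) (Lp.memLp f).1
  rw [Lp.norm_def, integral_norm_eq_lintegral_enorm (Lp.memLp f).1, ← eLpNorm_one_eq_lintegral_enorm]
  exact ENNReal.toReal_mono (Lp.memLp f).2.ne h2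

theorem exists_analytic_dual {θ : ℝ} (h0 : 0 < θ) (h1 : θ < 1) [DecidableEq A]
    (N : Bool → Seminorm ℂ (A → ℂ)) (L : (A → ℂ) →ₗ[ℂ] ℂ)
    (hL : ∀ x, ‖L x‖ ≤ interpN θ (N true) (N false) x) :
    ∃ W : Circ → A → ℂ, (∀ a, HInf (fun t => W t a)) ∧
      (∀ a, ∫ t, W t a ∂tm = L (Pi.single a 1)) ∧
      ∀ᵐ t ∂tm, ∀ v : A → ℂ, ‖∑ a, W t a * v a‖ ≤ N (side θ t) v := by
  have hb := measurable_side θ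
  have hpm : ∀ P : Polynomial ℂ, MemLp (fun t : Circ => P.eval (fourier 1 t)) 2 tm :=
    fun P => (HInf.polynomial P).1.memLp
  let J : (A → Polynomial ℂ) →ₗ[ℂ] (A → Lp ℂ 2 tm) :=
    { toFun := fun p a => (hpm (p a)).toLp
      map_add' := fun p q => by
        ext1 a
        simp only [Pi.add_apply, ← MemLp.toLp_add]
        congr 1; ext t; simp
      map_smul' := fun c p => by
        ext1 a
        simp only [Pi.smul_apply, ← MemLp.toLp_const_smul, RingHom.id_apply]
        congr 1; ext t; simp }
  let Z : (A → Polynomial ℂ) →ₗ[ℂ] (A → ℂ) :=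
    { toFun := fun p a => (p a).coeff 0
      map_add' := fun p q => by ext a; simp
      map_smul' := fun c p => by ext a; simp }
  let L0 : (A → Polynomial ℂ) →ₗ[ℂ] ℂ := L.comp Z
  obtain ⟨l, hl1, hl2⟩ := exists_dominated_extension J L0 (intSeminorm N (side θ) hb) (fun p => by
    have := norm_apply_le_integral h0 h1 N L hL p
    rwa [← intSeminorm_toLp N hb (f := fun t a => (p a).eval (fourier 1 t)) fun a => hpm (p a)]
      at this)
  have hla : ∀ a, ∃ w : Lp ℂ 2 tm, ∀ f, l (Pi.single a f) = inner ℂ w f := by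
    intro a
    obtain ⟨C, hC⟩ := intSeminorm_single_le N hb a
    let la : Lp ℂ 2 tm →L[ℂ] ℂ := (l.comp (LinearMap.single ℂ (fun _ : A => Lp ℂ 2 tm) a)).mkContinuous C
      fun f => (hl2 _).trans (hC f)
    refine ⟨(InnerProductSpace.toDual ℂ (Lp ℂ 2 tm)).symm la, fun f => ?_⟩
    rw [InnerProductSpace.toDual_symm_apply]; rfl
  choose w hw using hla
  let W : Circ → A → ℂ := fun t a => (starRingEnd ℂ) (w a t)
  have hW : ∀ a, MemLp (fun t => W t a) 2 tm := fun a => (Lp.memLp (w a)).star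
  have hlf : ∀ {f : Circ → A → ℂ} (hf : ∀ a, MemLp (fun t => f t a) 2 tm),
      l (fun a => (hf a).toLp) = ∑ a, ∫ t, f t a * W t a ∂tm := by
    intro f hf
    have : (fun a => (hf a).toLp) = ∑ a, (Pi.single a ((hf a).toLp) : A → Lp ℂ 2 tm) := by
      rw [Finset.univ_sum_single]
    rw [this, map_sum]
    refine Finset.sum_congr rfl fun a _ => ?_
    rw [hw, MeasureTheory.L2.inner_def]
    refine integral_congr_ae ?_
    filter_upwards [(hf a).coeFn_toLp] with t ht
    rw [ht]; rfl
  have hlp : ∀ a (P : Polynomial ℂ), ∫ t, W t a * P.eval (fourier 1 t) ∂tm =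
      P.coeff 0 * L (Pi.single a 1) := by
    intro a P
    have e1 := hl1 (Pi.single a P)
    have e2 := hlf (f := fun t a' => ((Pi.single a P : A → Polynomial ℂ) a').eval (fourier 1 t))
      fun a' => hpm _
    change l (fun a' => (hpm ((Pi.single a P : A → Polynomial ℂ) a')).toLp) = L _ at e1
    rw [e2, Finset.sum_eq_single a] at e1
    · have : ∀ t : Circ, W t a * P.eval (fourier 1 t) =
        ((Pi.single a P : A → Polynomial ℂ) a).eval (fourier 1 t) * W t a := by
        intro t; rw [Pi.single_eq_same, mul_comm]
      simp only [this, e1]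
      rw [← smul_eq_mul, ← map_smul]
      congr 1
      ext a'
      by_cases h : a' = a
      · subst h; simp [Z]
      · simp [Z, h]
    · intro a' _ ha'
      simp [ha']
    · simp
  have hae : ∀ v : A → ℂ, ∀ᵐ t ∂tm, ‖∑ a, W t a * v a‖ ≤ N (side θ t) v := by
    intro v
    have hg : MemLp (fun t => ∑ a, W t a * v a) 2 tm :=
      memLp_finsetSum _ fun a _ => (hW a).mul_const (v a)
    have hgi : Integrable (fun t => ∑ a, W t a * v a) tm := hg.integrable (by norm_num)
    have hNi : Integrable (fun t => N (side θ t) v) tm :=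
      integrable_sideNorm N hb (f := fun _ => v) fun a => memLp_const _
    refine ae_le_of_forall_setIntegral_le hgi.norm hNi fun S hS _ => ?_
    set g := fun t => ∑ a, W t a * v a with hgdef
    let u : Circ → ℂ := S.indicator fun t => (starRingEnd ℂ) (g t) / ‖g t‖
    have hu1 : ∀ t, ‖u t‖ ≤ 1 := by
      intro t
      refine (norm_indicator_le_norm_self _ _).trans ?_
      rw [norm_div, RCLike.norm_conj, Complex.norm_real, norm_norm]
      exact div_self_le_one _
    have hum : AEStronglyMeasurable u tm := by
      refine AEStronglyMeasurable.indicator ?_ hS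
      exact (((Complex.continuous_conj.comp_aestronglyMeasurable hg.1).aemeasurable).div
        (Complex.continuous_ofReal.comp_aestronglyMeasurable
        hg.1.norm).aemeasurable).aestronglyMeasurable
    have hum2 : MemLp u 2 tm := MemLp.of_bound hum 1 (Filter.Eventually.of_forall hu1)
    have hf : ∀ a, MemLp (fun t => u t * v a) 2 tm := fun a => hum2.mul_const (v a)
    have e1 := hl2 (fun a => (hf a).toLp)
    rw [hlf (f := fun t a => u t * v a) hf, intSeminorm_toLp N hb (f := fun t a => u t * v a) hf] at e1
    have e2 : ∑ a, ∫ t, (u t * v a) * W t a ∂tm = ((∫ t in S, ‖g t‖ ∂tm : ℝ) : ℂ) := by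
      have hfW : ∀ a, Integrable (fun t => u t * v a * W t a) tm := fun a =>
        (hf a).integrable_mul (hW a)
      rw [← integral_finsetSum _ fun a _ => hfW a]
      have : ∀ t, ∑ a, (u t * v a) * W t a = ((S.indicator (fun t => ‖g t‖) t : ℝ) : ℂ) := by
        intro t
        have e3 : ∑ a, (u t * v a) * W t a = u t * g t := by
          rw [hgdef, Finset.mul_sum]; exact Finset.sum_congr rfl fun a _ => by ring
        rw [e3]
        by_cases ht : t ∈ S
        · simp only [u, Set.indicator_of_mem ht]
          by_cases h : g t = 0
          · simp [h]
          · have : (‖g t‖ : ℂ) ≠ 0 := by exact_mod_cast norm_ne_zero_iff.2 h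
            field_simp
            rw [mul_comm, Complex.mul_conj, Complex.normSq_eq_norm_sq]; push_cast; ring
        · simp [u, Set.indicator_of_notMem ht]
      simp only [this]
      rw [← integral_indicator hS]
      exact integral_ofReal
    rw [e2, Complex.norm_real, Real.norm_of_nonneg
      (integral_nonneg fun t => norm_nonneg _)] at e1
    refine e1.trans ?_
    rw [← integral_indicator hS]
    refine integral_mono_ae (integrable_sideNorm N hb hf) (hNi.indicator hS) ?_
    refine Filter.Eventually.of_forall fun t => ?_
    have : (fun a => u t * v a) = u t • v := rfl
    simp only [this, map_smul_eq_mul]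
    by_cases ht : t ∈ S
    · rw [Set.indicator_of_mem ht]
      exact mul_le_of_le_one_left (apply_nonneg _ _) (hu1 t)
    · simp [u, Set.indicator_of_notMem ht]
  have hall : ∀ᵐ t ∂tm, ∀ v : A → ℂ, ‖∑ a, W t a * v a‖ ≤ N (side θ t) v := by
    have := ae_all_iff.2 fun n => hae (TopologicalSpace.denseSeq (A → ℂ) n)
    filter_upwards [this] with t ht v
    have hc : IsClosed {v : A → ℂ | ‖∑ a, W t a * v a‖ ≤ N (side θ t) v} :=
      isClosed_le (by fun_prop) (seminorm_continuous_pi _)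
    have hsub : Set.range (TopologicalSpace.denseSeq (A → ℂ)) ⊆
      {v : A → ℂ | ‖∑ a, W t a * v a‖ ≤ N (side θ t) v} := by
        rintro _ ⟨n, rfl⟩; exact ht n
    exact hc.closure_subset_iff.2 hsub (TopologicalSpace.denseRange_denseSeq (A → ℂ) v)
  refine ⟨W, fun a => ⟨(hW a).1, ?_, fun k => ?_⟩, fun a => ?_, hall⟩
  · obtain ⟨C, hC, h⟩ := exists_bound_side N
    refine ⟨C * ‖(Pi.single a 1 : A → ℂ)‖, ?_⟩
    filter_upwards [hall] with t ht
    have := (ht (Pi.single a 1)).trans (h _ _)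
    simpa [Pi.single_apply] using this
  · have := hlp a (Polynomial.X ^ (k + 1))
    simp only [Polynomial.eval_pow, Polynomial.eval_X, Polynomial.coeff_X_pow] at this
    simp only [Nat.zero_ne_add_one, if_false, zero_mul] at this
    rw [← this]
    congr 1; ext t
    congr 1
    rw [fourier_apply, fourier_apply]
    rw [← Circle.coe_pow, ← AddCircle.toCircle_nsmul]
    congr 2
    rw [one_zsmul]
    norm_cast
  · have := hlp a 1
    simpa using this

end Dual

section Rademacher

variable {V : Type*} [AddCommGroup V]

/-- Rademacher sum with signs `e`. -/
def radSum {ι : Type*} [Fintype ι] (e : ι → Bool) (x : ι → V) : V :=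
  ∑ i, if e i then x i else -x i

/-- Squared form of type 2. -/
def TypeTwo (N : V → ℝ) (T : ℝ) : Prop :=
  ∀ (m : ℕ) (x : Fin m → V),
    ∑ e : Fin m → Bool, N (radSum e x) ^ 2 ≤ 2 ^ m * (T ^ 2 * ∑ i, N (x i) ^ 2)

theorem radSum_equiv {ι κ : Type*} [Fintype ι] [Fintype κ] (s : ι ≃ κ) (e : κ → Bool) (x : κ → V) :
    radSum (e ∘ s) (x ∘ s) = radSum e x :=
  Equiv.sum_comp s fun k => if e k then x k else -x k

theorem radSum_map {W : Type*} [AddCommGroup W] (f : V →+ W) {ι : Type*} [Fintype ι]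
    (e : ι → Bool) (x : ι → V) : f (radSum e x) = radSum e fun i => f (x i) := by
  simp [radSum, map_sum, apply_ite f]

theorem TypeTwo.sum_le {N : V → ℝ} {T : ℝ} (h : TypeTwo N T) {ι : Type*} [Fintype ι]
    [DecidableEq ι] (x : ι → V) :
    ∑ e : ι → Bool, N (radSum e x) ^ 2 ≤ 2 ^ Fintype.card ι * (T ^ 2 * ∑ i, N (x i) ^ 2) := by
  let s := Fintype.equivFin ι
  have := h (Fintype.card ι) (x ∘ s.symm)
  have e1 : ∑ i, N ((x ∘ s.symm) i) ^ 2 = ∑ i, N (x i) ^ 2 :=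
    Equiv.sum_comp s.symm fun i => N (x i) ^ 2
  rw [e1] at this
  refine le_trans (le_of_eq ?_) this
  rw [← Equiv.sum_comp (s.symm.arrowCongr (Equiv.refl Bool))]
  refine Finset.sum_congr rfl fun e _ => ?_
  congr 2
  rw [← radSum_equiv s.symm]
  congr 1
  ext i; simp [Equiv.arrowCongr]

theorem TypeTwo.mono {N : V → ℝ} {T T' : ℝ} (h : TypeTwo N T) (h0 : 0 ≤ T) (hT : T ≤ T') :
    TypeTwo N T' := fun m x => (h m x).trans (by
  have : 0 ≤ ∑ i, N (x i) ^ 2 := Finset.sum_nonneg fun i _ => sq_nonneg _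
  gcongr)

end Rademacher

section ThetaNorm

variable {A : Type*}

/-- Bounded analytic representations of `φ` with boundary values dominated by `r`. -/
def thetaSet (n : Bool → Seminorm ℂ (A → ℂ)) (b : Circ → Bool) (φ : A → ℂ) : Set ℝ :=
  {r | 0 ≤ r ∧ ∃ f : Circ → A → ℂ, (∀ a, HInf (fun t => f t a)) ∧ (∀ a, ∫ t, f t a ∂tm = φ a) ∧
    ∀ᵐ t ∂tm, n (b t) (f t) ≤ r}

theorem thetaSet_bddBelow (n : Bool → Seminorm ℂ (A → ℂ)) (b : Circ → Bool) (φ : A → ℂ) :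
    BddBelow (thetaSet n b φ) := ⟨0, fun _ h => h.1⟩

theorem thetaSet_smul {n : Bool → Seminorm ℂ (A → ℂ)} {b : Circ → Bool} {φ : A → ℂ} {r : ℝ}
    (h : r ∈ thetaSet n b φ) (c : ℂ) : ‖c‖ * r ∈ thetaSet n b (c • φ) := by
  obtain ⟨h0, f, h1, h2, h3⟩ := h
  refine ⟨by positivity, fun t => c • f t, fun a => (h1 a).const_mul c, fun a => ?_, ?_⟩
  · simp [integral_const_mul, h2]
  · filter_upwards [h3] with t ht
    rw [map_smul_eq_mul]; gcongr

variable [Fintype A]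

theorem thetaSet_nonempty (n : Bool → Seminorm ℂ (A → ℂ)) (b : Circ → Bool) (φ : A → ℂ) :
    (thetaSet n b φ).Nonempty := by
  obtain ⟨C, hC, h⟩ := exists_bound_side n
  exact ⟨C * ‖φ‖, by positivity, fun _ => φ, fun a => HInf.const _, fun a => by simp,
    Filter.Eventually.of_forall fun t => h _ _⟩

/-- The interpolation norm of the couple `n`, computed on the circle. -/
def thetaNorm (n : Bool → Seminorm ℂ (A → ℂ)) (b : Circ → Bool) : Seminorm ℂ (A → ℂ) :=
  Seminorm.ofSMulLE (fun φ => sInf (thetaSet n b φ))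
    (le_antisymm (csInf_le (thetaSet_bddBelow n b 0) ⟨le_rfl, fun _ => 0, fun a => HInf.const 0,
      fun a => by simp, by simp⟩) (le_csInf (thetaSet_nonempty n b 0) fun r h => h.1))
    (fun φ ψ => by
      rw [← csInf_add (thetaSet_nonempty n b φ) (thetaSet_bddBelow n b φ)
        (thetaSet_nonempty n b ψ) (thetaSet_bddBelow n b ψ)]
      refine csInf_le_csInf (thetaSet_bddBelow n b _)
        ((thetaSet_nonempty n b φ).add (thetaSet_nonempty n b ψ)) ?_
      rintro _ ⟨r, ⟨h0, f, h1, h2, h3⟩, s, ⟨k0, g, k1, k2, k3⟩, rfl⟩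
      refine ⟨add_nonneg h0 k0, fun t => f t + g t, fun a => (h1 a).add (k1 a), fun a => ?_, ?_⟩
      · change ∫ t, (f t a + g t a) ∂tm = _
        rw [integral_add (h1 a).integrable (k1 a).integrable, h2, k2]; rfl
      · filter_upwards [h3, k3] with t ht kt
        exact (map_add_le_add _ _ _).trans (add_le_add ht kt))
    (fun c φ => by
      rw [← smul_eq_mul, ← Real.sInf_smul_of_nonneg (norm_nonneg c)]
      refine csInf_le_csInf (thetaSet_bddBelow n b _) ((thetaSet_nonempty n b φ).smul_set) ?_
      rintro _ ⟨r, h, rfl⟩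
      exact thetaSet_smul h c)

theorem thetaNorm_le {n : Bool → Seminorm ℂ (A → ℂ)} {b : Circ → Bool} {f : Circ → A → ℂ}
    (hf : ∀ a, HInf (fun t => f t a)) {r : ℝ} (hr : 0 ≤ r) (h : ∀ᵐ t ∂tm, n (b t) (f t) ≤ r) :
    thetaNorm n b (fun a => ∫ t, f t a ∂tm) ≤ r :=
  csInf_le (thetaSet_bddBelow n b _) ⟨hr, f, hf, fun _ => rfl, h⟩

theorem exists_of_thetaNorm_lt {n : Bool → Seminorm ℂ (A → ℂ)} {b : Circ → Bool} {φ : A → ℂ}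
    {r : ℝ} (h : thetaNorm n b φ < r) : ∃ f : Circ → A → ℂ, (∀ a, HInf (fun t => f t a)) ∧
      (∀ a, ∫ t, f t a ∂tm = φ a) ∧ ∀ᵐ t ∂tm, n (b t) (f t) ≤ r := by
  obtain ⟨s, ⟨-, f, h1, h2, h3⟩, hs⟩ := exists_lt_of_csInf_lt (thetaSet_nonempty n b φ) h
  refine ⟨f, h1, h2, ?_⟩
  filter_upwards [h3] with t ht using ht.trans hs.le

theorem thetaNorm_integral_le (n : Bool → Seminorm ℂ (A → ℂ)) {b : Circ → Bool}
    (hb : Measurable b) {f : Circ → A → ℂ} (hf : ∀ a, HInf (fun t => f t a)) :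
    thetaNorm n b (fun a => ∫ t, f t a ∂tm) ≤ ∫ t, n (b t) (f t) ∂tm := by
  have hni : Integrable (fun t => n (b t) (f t)) tm := integrable_sideNorm n hb fun a => (hf a).memLp
  refine le_of_forall_pos_le_add fun δ hδ => ?_
  obtain ⟨C, hC, hCn⟩ := exists_bound_side n
  have hbf : ∃ B : ℝ, 0 ≤ B ∧ ∀ᵐ t ∂tm, ‖f t‖ ≤ B := by
    choose B hB using fun a => (hf a).bdd
    refine ⟨∑ a, |B a|, by positivity, ?_⟩
    filter_upwards [ae_all_iff.2 hB] with t ht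
    refine (pi_norm_le_iff_of_nonneg (by positivity)).2 fun a => (ht a).trans ((le_abs_self _).trans ?_)
    exact Finset.single_le_sum (f := fun a => |B a|) (fun a _ => abs_nonneg _) (Finset.mem_univ a)
  obtain ⟨B, hB0, hB⟩ := hbf
  let u : Circ → ℝ := fun t => Real.log (n (b t) (f t) + δ)
  have hpos : ∀ t, 0 < n (b t) (f t) + δ := fun t => add_pos_of_nonneg_of_pos (apply_nonneg _ _) hδ
  have hum : AEStronglyMeasurable u tm :=
    (Real.measurable_log.comp_aemeasurable (hni.1.aemeasurable.add_const δ)).aestronglyMeasurable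
  have hub : ∀ᵐ t ∂tm, |u t| ≤ |Real.log δ| + |Real.log (C * B + δ)| := by
    filter_upwards [hB] with t ht
    have h1 : Real.log δ ≤ u t := Real.log_le_log hδ (by linarith [apply_nonneg (n (b t)) (f t)])
    have h2 : u t ≤ Real.log (C * B + δ) := Real.log_le_log (hpos t) (by
      have := (hCn (b t) (f t)).trans (mul_le_mul_of_nonneg_left ht hC); linarith)
    rw [abs_le]
    constructor
    · linarith [neg_abs_le (Real.log δ), abs_nonneg (Real.log (C * B + δ))]
    · linarith [le_abs_self (Real.log (C * B + δ)), abs_nonneg (Real.log δ)]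
  obtain ⟨a, ha, hai, hna, hia⟩ := exists_outer hum hub
  have hg : ∀ i, HInf (fun t => ((a t)⁻¹ • f t) i) := fun i => hai.mul (hf i)
  have hgn : ∀ᵐ t ∂tm, n (b t) ((a t)⁻¹ • f t) ≤ 1 := by
    filter_upwards [hna] with t ht
    rw [map_smul_eq_mul, norm_inv, ht, Real.exp_log (hpos t), inv_mul_le_iff₀ (hpos t)]
    linarith
  have h1 := thetaNorm_le hg zero_le_one hgn
  have h2 : (fun i => ∫ t, f t i ∂tm) = (∫ t, a t ∂tm) • fun i => ∫ t, ((a t)⁻¹ • f t) i ∂tm := by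
    ext i
    rw [Pi.smul_apply, smul_eq_mul, ← ha.integral_mul (hg i)]
    refine integral_congr_ae ?_
    filter_upwards [hna] with t ht
    have : a t ≠ 0 := norm_pos_iff.1 (by rw [ht]; exact Real.exp_pos _)
    simp only [Pi.smul_apply, smul_eq_mul]
    field_simp
  rw [h2, map_smul_eq_mul, hia]
  have hui : Integrable u tm := Integrable.of_bound hum _ hub
  have hev : (fun t => Real.exp (u t)) = fun t => n (b t) (f t) + δ := by
    ext t; exact Real.exp_log (hpos t)
  have hJ := convexOn_exp.map_integral_le (μ := tm) (f := u)
    Real.continuous_exp.continuousOn isClosed_univ (by simp) hui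
    (by change Integrable (fun t => Real.exp (u t)) tm; rw [hev]; exact hni.add (integrable_const δ))
  rw [hev, integral_add hni (integrable_const δ)] at hJ
  calc _ ≤ Real.exp (∫ t, u t ∂tm) * 1 := by gcongr
    _ ≤ _ := by simpa using hJ

theorem thetaNorm_integral_sq_le (n : Bool → Seminorm ℂ (A → ℂ)) {b : Circ → Bool}
    (hb : Measurable b) {f : Circ → A → ℂ} (hf : ∀ a, HInf (fun t => f t a)) :
    thetaNorm n b (fun a => ∫ t, f t a ∂tm) ^ 2 ≤ ∫ t, n (b t) (f t) ^ 2 ∂tm := by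
  have hm := memLp_sideNorm n hb fun a => (hf a).memLp
  have h1 := thetaNorm_integral_le n hb hf
  have h2 := (convexOn_pow (𝕜 := ℝ) 2).map_integral_le (μ := tm) (f := fun t => n (b t) (f t))
    (continuous_pow 2).continuousOn isClosed_Ici
    (Filter.Eventually.of_forall fun t => apply_nonneg (n (b t)) (f t)) (hm.integrable (by norm_num))
    hm.integrable_sq
  exact (pow_le_pow_left₀ (apply_nonneg _ _) h1 2).trans h2

theorem typeTwo_thetaNorm {n : Bool → Seminorm ℂ (A → ℂ)} {b : Circ → Bool}
    (hb : Measurable b) {T : ℝ} (hT : ∀ c, TypeTwo (n c) T) : TypeTwo (thetaNorm n b) T := by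
  intro m x
  have main : ∀ δ : ℝ, 0 < δ → ∑ e : Fin m → Bool, thetaNorm n b (radSum e x) ^ 2 ≤
      2 ^ m * (T ^ 2 * ∑ i, (thetaNorm n b (x i) + δ) ^ 2) := by
    intro δ hδ
    choose f hf1 hf2 hf3 using fun i => exists_of_thetaNorm_lt (n := n) (b := b) (φ := x i)
      (r := thetaNorm n b (x i) + δ) (by linarith)
    have hF : ∀ (e : Fin m → Bool) a, HInf (fun t => radSum e (fun i => f i t) a) := by
      intro e a
      have : (fun t => radSum e (fun i => f i t) a) =
          fun t => ∑ i, (if e i then (1 : ℂ) else -1) * f i t a := by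
        ext t
        simp only [radSum, Finset.sum_apply]
        refine Finset.sum_congr rfl fun i _ => ?_
        split_ifs <;> simp
      rw [this]
      exact HInf.sum _ fun i _ => (hf1 i a).const_mul _
    have hFi : ∀ e : Fin m → Bool, (fun a => ∫ t, radSum e (fun i => f i t) a ∂tm) = radSum e x := by
      intro e
      ext a
      simp only [radSum, Finset.sum_apply]
      rw [integral_finsetSum]
      · refine Finset.sum_congr rfl fun i _ => ?_
        split_ifs
        · exact hf2 i a
        · simp [integral_neg, hf2]
      · intro i _
        split_ifs
        · exact (hf1 i a).integrable
        · exact (hf1 i a).integrable.neg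
    have hint : ∀ e : Fin m → Bool, Integrable (fun t => n (b t) (radSum e fun i => f i t) ^ 2) tm :=
      fun e => (memLp_sideNorm n hb fun a => (hF e a).memLp).integrable_sq
    calc ∑ e : Fin m → Bool, thetaNorm n b (radSum e x) ^ 2
        ≤ ∑ e : Fin m → Bool, ∫ t, n (b t) (radSum e fun i => f i t) ^ 2 ∂tm := by
          refine Finset.sum_le_sum fun e _ => ?_
          rw [← hFi e]
          exact thetaNorm_integral_sq_le n hb (hF e)
      _ = ∫ t, ∑ e : Fin m → Bool, n (b t) (radSum e fun i => f i t) ^ 2 ∂tm :=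
          (integral_finsetSum _ fun e _ => hint e).symm
      _ ≤ ∫ _, 2 ^ m * (T ^ 2 * ∑ i, (thetaNorm n b (x i) + δ) ^ 2) ∂tm := by
          refine integral_mono_ae (integrable_finsetSum _ fun e _ => hint e)
            (integrable_const _) ?_
          filter_upwards [ae_all_iff.2 hf3] with t ht
          refine (hT (b t) m _).trans ?_
          have : ∑ i, n (b t) (f i t) ^ 2 ≤ ∑ i, (thetaNorm n b (x i) + δ) ^ 2 :=
            Finset.sum_le_sum fun i _ => pow_le_pow_left₀ (apply_nonneg _ _) (ht i) 2
          gcongr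
      _ = _ := by simp
  have hlim : Filter.Tendsto (fun δ : ℝ => 2 ^ m * (T ^ 2 * ∑ i, (thetaNorm n b (x i) + δ) ^ 2))
      (nhdsWithin 0 (Set.Ioi 0))
      (nhds (2 ^ m * (T ^ 2 * ∑ i, (thetaNorm n b (x i) + 0) ^ 2))) := by
    refine Filter.Tendsto.mono_left ?_ nhdsWithin_le_nhds
    exact Continuous.tendsto (by fun_prop) 0
  have := ge_of_tendsto hlim (by
    filter_upwards [self_mem_nhdsWithin] with δ hδ using main δ hδ)
  simpa using this

end ThetaNorm

theorem integral_mul_continuous_eq_zero {G : Circ → ℂ} (hG : Integrable G tm)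
    (h : ∀ n : ℤ, ∫ t, G t * fourier n t ∂tm = 0) (v : C(Circ, ℂ)) :
    ∫ t, G t * v t ∂tm = 0 := by
  have hint : ∀ v : C(Circ, ℂ), Integrable (fun t => G t * v t) tm := fun v =>
    hG.mul_bdd (c := ‖v‖) (map_continuous v).aestronglyMeasurable
      (Filter.Eventually.of_forall fun t => v.norm_coe_le_norm t)
  let l : C(Circ, ℂ) →ₗ[ℂ] ℂ :=
    { toFun := fun v => ∫ t, G t * v t ∂tm
      map_add' := fun v w => by
        rw [← integral_add (hint v) (hint w)]; congr 1; ext t; simp [mul_add]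
      map_smul' := fun c v => by
        rw [RingHom.id_apply, smul_eq_mul, ← integral_const_mul]; congr 1; ext t; simp; ring }
  let L : C(Circ, ℂ) →L[ℂ] ℂ := l.mkContinuous (∫ t, ‖G t‖ ∂tm) fun v => by
    refine (norm_integral_le_integral_norm _).trans ?_
    rw [← integral_mul_const]
    refine integral_mono (hint v).norm (hG.norm.mul_const _) fun t => ?_
    change ‖G t * v t‖ ≤ ‖G t‖ * ‖v‖
    rw [norm_mul]
    exact mul_le_mul_of_nonneg_left (v.norm_coe_le_norm t) (norm_nonneg _)
  have hsub : (Submodule.span ℂ (Set.range (fourier (T := 1)))).topologicalClosure ≤ L.ker := by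
    refine Submodule.topologicalClosure_minimal _ (Submodule.span_le.2 ?_) L.isClosed_ker
    rintro _ ⟨n, rfl⟩
    exact h n
  have : v ∈ L.ker := hsub (by rw [span_fourier_closure_eq_top]; trivial)
  exact this

/-- Uniqueness of Fourier coefficients of integrable functions. -/
theorem ae_eq_zero_of_fourier {G : Circ → ℂ} (hG : Integrable G tm)
    (h : ∀ n : ℤ, ∫ t, G t * fourier n t ∂tm = 0) : G =ᵐ[tm] 0 := by
  refine hG.ae_eq_zero_of_forall_setIntegral_eq_zero fun S hS _ => ?_
  let u : Circ → ℝ := S.indicator fun _ => 1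
  have hu : AEStronglyMeasurable u tm := (measurable_const.indicator hS).aestronglyMeasurable
  have huB : ∀ᵐ t ∂tm, |u t| ≤ 1 := Filter.Eventually.of_forall fun t => by
    by_cases ht : t ∈ S <;> simp [u, ht]
  have hpos : ∀ n : ℕ, (0 : ℝ) < 1 / (n + 1) := fun n => by positivity
  choose v hv hv2 using fun n : ℕ => exists_continuous_approx hu huB (hpos n)
  have hlim : Filter.Tendsto (fun n => eLpNorm ((v n : Circ → ℝ) - u) 2 tm)
      Filter.atTop (nhds 0) := by
    refine tendsto_of_tendsto_of_tendsto_of_le_of_le tendsto_const_nhds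
      (h := fun n : ℕ => ENNReal.ofReal (1 / ((n : ℝ) + 1))) ?_ (fun _ => zero_le) fun n => ?_
    · simpa using ENNReal.tendsto_ofReal tendsto_one_div_add_atTop_nhds_zero_nat
    · change eLpNorm ((v n : Circ → ℝ) - u) 2 tm ≤ _
      rw [← eLpNorm_neg, neg_sub]; exact hv2 n
  obtain ⟨ns, -, hns⟩ := (tendstoInMeasure_of_tendsto_eLpNorm (by norm_num)
    (fun n => (map_continuous (v n)).aestronglyMeasurable) hu hlim).exists_seq_tendsto_ae
  have h1 : Filter.Tendsto (fun i => ∫ t, G t * (v (ns i) t : ℂ) ∂tm) Filter.atTop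
      (nhds (∫ t, G t * (u t : ℂ) ∂tm)) := by
    refine tendsto_integral_of_dominated_convergence (fun t => ‖G t‖) (fun i => ?_) hG.norm
      (fun i => Filter.Eventually.of_forall fun t => ?_) ?_
    · exact hG.1.mul (Continuous.aestronglyMeasurable (by fun_prop))
    · rw [norm_mul]
      refine mul_le_of_le_one_right (norm_nonneg _) ?_
      rw [Complex.norm_real]; exact hv _ t
    · filter_upwards [hns] with t ht
      exact ((Complex.continuous_ofReal.tendsto _).comp ht).const_mul _
  have h2 : ∀ i, ∫ t, G t * (v (ns i) t : ℂ) ∂tm = 0 := fun i =>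
    integral_mul_continuous_eq_zero hG h ⟨fun t => (v (ns i) t : ℂ), by fun_prop⟩
  simp only [h2] at h1
  have h3 := tendsto_nhds_unique tendsto_const_nhds h1
  rw [← integral_indicator hS, h3]
  congr 1; ext t
  by_cases ht : t ∈ S <;> simp [u, ht]

section InnerFactor

variable {L : Type*} [Fintype L]

/-- Square-integrable vector functions on the circle. -/
abbrev VecLp (L : Type*) [Fintype L] := Lp (EuclideanSpace ℂ L) 2 tm

theorem memLp_twist (k : ℤ) (f : VecLp L) : MemLp (fun t => fourier k t • f t) 2 tm := by
  refine (Lp.memLp f).of_le ?_ (Filter.Eventually.of_forall fun t => ?_)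
  · exact (map_continuous (fourier k)).aestronglyMeasurable.smul (Lp.memLp f).1
  · rw [norm_smul, norm_fourier, one_mul]

/-- Multiplication by a character. -/
def twist (k : ℤ) (f : VecLp L) : VecLp L := (memLp_twist k f).toLp

theorem inner_twist (j k : ℤ) (f g : VecLp L) :
    inner ℂ (twist j f) (twist k g) = ∫ t, fourier (k - j) t * inner ℂ (f t) (g t) ∂tm := by
  rw [MeasureTheory.L2.inner_def]
  refine integral_congr_ae ?_
  filter_upwards [(memLp_twist j f).coeFn_toLp, (memLp_twist k g).coeFn_toLp] with t h1 h2
  rw [twist, twist, h1, h2, inner_smul_left, inner_smul_right, ← mul_assoc]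
  congr 1
  rw [sub_eq_add_neg, fourier_add, fourier_neg, mul_comm]

theorem twist_zero (f : VecLp L) : twist 0 f = f := by
  refine Lp.ext ?_
  filter_upwards [(memLp_twist 0 f).coeFn_toLp] with t h1
  rw [twist, h1, fourier_zero, one_smul]

theorem inner_twist_eq (j k : ℤ) (f g : VecLp L) :
    inner ℂ (twist j f) (twist k g) = inner ℂ f (twist (k - j) g) := by
  conv_rhs => rw [← twist_zero f]
  rw [inner_twist, inner_twist, sub_zero]

theorem inner_eq_zero_of_mem_closure {H : Type*} [NormedAddCommGroup H] [InnerProductSpace ℂ H]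
    {S : Set H} {y f : H} (h : ∀ s ∈ S, inner ℂ y s = 0)
    (hf : f ∈ (Submodule.span ℂ S).topologicalClosure) : inner ℂ y f = 0 := by
  have h1 : (Submodule.span ℂ S).topologicalClosure ≤ (ℂ ∙ y)ᗮ :=
    Submodule.topologicalClosure_minimal _ (Submodule.span_le.2 fun s hs =>
      (Submodule.mem_orthogonal_singleton_iff_inner_right).2 (h s hs))
      (Submodule.isClosed_orthogonal _)
  exact Submodule.mem_orthogonal_singleton_iff_inner_right.1 (h1 hf)

variable {A B : Type*} [Fintype A]

/-- Generators of the invariant subspace. -/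
def invSet (X : A → VecLp L) (m : ℕ) : Set (VecLp L) :=
  Set.range fun p : ℕ × A => twist ((p.1 : ℤ) + m) (X p.2)

/-- The invariant subspace generated by `X`, shifted `m` times. -/
def invSub (X : A → VecLp L) (m : ℕ) : Submodule ℂ (VecLp L) :=
  (Submodule.span ℂ (invSet X m)).topologicalClosure

theorem exists_inner_factor_Lp (X : A → VecLp L) (Y : B → VecLp L)
    (hXY : ∀ a b, ∀ k : ℕ, inner ℂ (Y b) (twist ((k : ℤ) + 1) (X a)) = 0) :
    ∃ (J : Set L) (q : L → VecLp L),
      (∀ᵐ t ∂tm, ∀ i j, (i = j ∧ i ∈ J → inner ℂ (q i t) (q j t) = (1 : ℂ)) ∧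
        (¬ (i = j ∧ i ∈ J) → inner ℂ (q i t) (q j t) = (0 : ℂ))) ∧
      (∀ i a (k : ℕ), inner ℂ (q i) (twist ((k : ℤ) + 1) (X a)) = 0) ∧
      (∀ i b (k : ℕ), inner ℂ (Y b) (twist ((k : ℤ) + 1) (q i)) = 0) ∧
      ∀ a b, inner ℂ (Y b) (X a) = ∑ i, inner ℂ (q i) (X a) * inner ℂ (Y b) (q i) := by
  classical
  set M := invSub X 0
  set M0 := invSub X 1
  have hgen0 : ∀ (k : ℕ) a, twist ((k : ℤ) + 1) (X a) ∈ M0 := fun k a =>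
    Submodule.le_topologicalClosure _ (Submodule.subset_span ⟨(k, a), rfl⟩)
  have hXM : ∀ a, X a ∈ M := fun a =>
    Submodule.le_topologicalClosure _ (Submodule.subset_span ⟨(0, a), by simp [twist_zero]⟩)
  have hle : M0 ≤ M := by
    refine Submodule.topologicalClosure_mono (Submodule.span_mono ?_)
    rintro _ ⟨p, rfl⟩
    exact ⟨(p.1 + 1, p.2), by simp⟩
  have : CompleteSpace M0 := (Submodule.isClosed_topologicalClosure _).completeSpace_coe
  let r : A → VecLp L := fun a => X a - M0.starProjection (X a)
  have hrM : ∀ a, r a ∈ M := fun a => M.sub_mem (hXM a) (hle (M0.starProjection_apply_mem _))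
  have hrO : ∀ a, r a ∈ M0ᗮ := fun a => M0.sub_starProjection_mem_orthogonal _
  let D : Submodule ℂ (VecLp L) := Submodule.span ℂ (Set.range r)
  have : FiniteDimensional ℂ D := FiniteDimensional.span_of_finite ℂ (Set.finite_range r)
  have hDM : D ≤ M := Submodule.span_le.2 (by rintro _ ⟨a, rfl⟩; exact hrM a)
  have hDO : D ≤ M0ᗮ := Submodule.span_le.2 (by rintro _ ⟨a, rfl⟩; exact hrO a)
  let bs := stdOrthonormalBasis ℂ D
  let p : Fin (Module.finrank ℂ D) → VecLp L := fun j => bs j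
  have hpM : ∀ j, p j ∈ M := fun j => hDM (bs j).2
  have hpO : ∀ j, ∀ w ∈ M0, inner ℂ (p j) w = 0 := fun j w hw =>
    Submodule.inner_left_of_mem_orthogonal hw (hDO (bs j).2)
  have hMM : ∀ (k : ℕ) (f : VecLp L) (g : VecLp L), g ∈ M → (∀ w ∈ M0, inner ℂ f w = 0) →
      inner ℂ f (twist ((k : ℤ) + 1) g) = 0 := by
    intro k f g hg hf
    have : inner ℂ (twist (-((k : ℤ) + 1)) f) g = 0 := by
      refine inner_eq_zero_of_mem_closure ?_ hg
      rintro _ ⟨⟨m, a⟩, rfl⟩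
      change inner ℂ (twist _ _) (twist ((m : ℤ) + (0 : ℕ)) (X a)) = 0
      rw [inner_twist_eq]
      refine hf _ ?_
      have := hgen0 (m + k) a
      convert this using 2
      push_cast; ring
    rw [← twist_zero g, inner_twist_eq] at this
    simpa using this
  have hpp : ∀ i j, inner ℂ (p i) (p j) = if i = j then (1 : ℂ) else 0 := by
    intro i j
    have := orthonormal_iff_ite.1 bs.orthonormal i j
    simpa using this
  have hint : ∀ f g : VecLp L, Integrable (fun t => inner ℂ (f t) (g t)) tm :=
    fun f g => MeasureTheory.L2.integrable_inner f g
  have hpt : ∀ᵐ t ∂tm, ∀ i j, inner ℂ (p i t) (p j t) = if i = j then (1 : ℂ) else 0 := by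
    refine ae_all_iff.2 fun i => ae_all_iff.2 fun j => ?_
    have hco : ∀ i j (k : ℕ),
        ∫ t, fourier ((k : ℤ) + 1) t * inner ℂ (p i t) (p j t) ∂tm = 0 := by
      intro i j k
      have := hMM k (p i) (p j) (hpM j) (hpO i)
      rwa [← twist_zero (p i), inner_twist, sub_zero] at this
    have hG : Integrable (fun t => inner ℂ (p i t) (p j t) - if i = j then (1 : ℂ) else 0) tm :=
      (hint _ _).sub (integrable_const _)
    have := ae_eq_zero_of_fourier hG (fun n => by
      have e1 : ∀ t : Circ, (inner ℂ (p i t) (p j t) - if i = j then (1 : ℂ) else 0) * fourier n t =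
          inner ℂ (p i t) (p j t) * fourier n t - (if i = j then (1 : ℂ) else 0) * fourier n t :=
        fun t => sub_mul _ _ _
      simp only [e1]
      rw [integral_sub ((hint _ _).mul_fourier n) ((integrable_const _).mul_fourier n),
        integral_const_mul]
      rcases lt_trichotomy n 0 with h | h | h
      · obtain ⟨k, hk⟩ : ∃ k : ℕ, n = -((k : ℤ) + 1) := ⟨(-n - 1).toNat, by omega⟩
        have e2 : ∫ t, inner ℂ (p i t) (p j t) * fourier n t ∂tm =
            (starRingEnd ℂ) (∫ t, fourier ((k : ℤ) + 1) t * inner ℂ (p j t) (p i t) ∂tm) := by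
          rw [← integral_conj]
          congr 1; ext t
          rw [hk, map_mul, inner_conj_symm, ← fourier_neg, mul_comm]
        have e3 : ∫ t : Circ, fourier n t ∂tm =
            (starRingEnd ℂ) (∫ t : Circ, fourier ((k : ℤ) + 1) t ∂tm) := by
          rw [← integral_conj]
          congr 1; ext t
          rw [hk, fourier_neg]
        rw [e2, hco, e3, integral_fourier_succ]; simp
      · subst h
        have : ∫ t, inner ℂ (p i t) (p j t) ∂tm = if i = j then (1 : ℂ) else 0 := by
          rw [← hpp i j, MeasureTheory.L2.inner_def]
        simp [this]
      · obtain ⟨k, hk⟩ : ∃ k : ℕ, n = (k : ℤ) + 1 := ⟨(n - 1).toNat, by omega⟩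
        have := hco i j k
        simp only [mul_comm (fourier _ _)] at this
        rw [hk, this, integral_fourier_succ]; simp)
    filter_upwards [this] with t ht
    exact sub_eq_zero.1 ht
  have hcard : Fintype.card (Fin (Module.finrank ℂ D)) ≤ Fintype.card L := by
    obtain ⟨t, ht⟩ := hpt.exists
    have : Orthonormal ℂ fun i => p i t := orthonormal_iff_ite.2 ht
    have := this.linearIndependent.fintype_card_le_finrank
    rwa [finrank_euclideanSpace] at this
  obtain ⟨e⟩ := Function.Embedding.nonempty_of_card_le hcard
  let q : L → VecLp L := Function.extend e p (fun _ => 0)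
  have hq1 : ∀ j, q (e j) = p j := fun j => e.injective.extend_apply p _ j
  have hq2 : ∀ l, l ∉ Set.range e → q l = 0 := fun l hl => Function.extend_apply' p _ l hl
  have h0 : ∀ᵐ t ∂tm, (0 : VecLp L) t = 0 := Lp.coeFn_zero _ _ _
  refine ⟨Set.range e, q, ?_, ?_, ?_, ?_⟩
  · filter_upwards [hpt, h0] with t ht h0 i j
    by_cases hi : i ∈ Set.range e
    · obtain ⟨i, rfl⟩ := hi
      by_cases hj : j ∈ Set.range e
      · obtain ⟨j, rfl⟩ := hj
        rw [hq1, hq1, ht]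
        simp only [e.injective.eq_iff, Set.mem_range_self, and_true]
        constructor <;> intro h <;> simp [h]
      · rw [hq2 j hj, h0, inner_zero_right]
        refine ⟨fun h => (hj (h.1 ▸ h.2)).elim, fun _ => rfl⟩
    · rw [hq2 i hi, h0, inner_zero_left]
      exact ⟨fun h => (hi h.2).elim, fun _ => rfl⟩
  · intro i a k
    by_cases hi : i ∈ Set.range e
    · obtain ⟨i, rfl⟩ := hi
      rw [hq1]; exact hpO i _ (hgen0 k a)
    · rw [hq2 i hi, inner_zero_left]
  · intro i b k
    by_cases hi : i ∈ Set.range e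
    · obtain ⟨i, rfl⟩ := hi
      rw [hq1]
      refine hMM k _ _ (hpM i) fun w hw => inner_eq_zero_of_mem_closure ?_ hw
      rintro _ ⟨⟨m, a⟩, rfl⟩
      exact hXY a b m
    · rw [hq2 i hi, ← twist_zero (Y b), inner_twist]
      rw [integral_congr_ae (g := fun _ => (0 : ℂ)), integral_zero]
      filter_upwards [h0] with t h0
      rw [h0, inner_zero_right, mul_zero]
  · intro a b
    have e1 : r a = ∑ j, inner ℂ (p j) (X a) • p j := by
      have := congrArg (Subtype.val) (bs.sum_repr' ⟨r a, Submodule.subset_span ⟨a, rfl⟩⟩)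
      simp only [AddSubmonoidClass.coe_finsetSum, Submodule.coe_smul, Submodule.coe_inner] at this
      rw [← this]
      refine Finset.sum_congr rfl fun j _ => ?_
      change inner ℂ (p j) (r a) • p j = _
      rw [inner_sub_right, hpO j _ (M0.starProjection_apply_mem _), sub_zero]
    have e2 : X a = r a + M0.starProjection (X a) := by simp [r]
    have e3 : inner ℂ (Y b) (M0.starProjection (X a)) = 0 := by
      refine inner_eq_zero_of_mem_closure ?_ (M0.starProjection_apply_mem (X a))
      rintro _ ⟨⟨m, a⟩, rfl⟩
      exact hXY a b m
    conv_lhs => rw [e2, inner_add_right, e3, add_zero, e1, inner_sum]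
    simp only [inner_smul_right]
    refine Fintype.sum_of_injective e e.injective _ _ (fun i hi => ?_) fun j => ?_
    · rw [hq2 i hi]; simp
    · rw [hq1]

end InnerFactor

section InnerFactorCoord

variable {L : Type*} [Fintype L]

theorem memLp_toEuclidean {x : Circ → L → ℂ} (hx : ∀ c, AEStronglyMeasurable (fun t => x t c) tm)
    (bx : ∀ c, ∃ R : ℝ, ∀ᵐ t ∂tm, ‖x t c‖ ≤ R) :
    MemLp (fun t => (WithLp.toLp 2 (x t) : EuclideanSpace ℂ L)) 2 tm := by
  rw [memLp_piLp_iff]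
  intro c
  obtain ⟨R, hR⟩ := bx c
  exact MemLp.of_bound (hx c) R hR

theorem inner_twist_coe (k : ℤ) (f g : VecLp L) :
    inner ℂ f (twist k g) = ∫ t, (∑ c, g t c * (starRingEnd ℂ) (f t c)) * fourier k t ∂tm := by
  have h := inner_twist 0 k f g
  rw [twist_zero, sub_zero] at h
  rw [h]
  refine integral_congr_ae (Filter.Eventually.of_forall fun t => ?_)
  simp only [PiLp.inner_apply, RCLike.inner_apply]
  ring

theorem norm_le_one_of_orthonormalOrZero {J : Set L} {v : L → L → ℂ}
    (h : ∀ i j, (i = j ∧ i ∈ J → ∑ c, (starRingEnd ℂ) (v i c) * v j c = (1 : ℂ)) ∧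
        (¬ (i = j ∧ i ∈ J) → ∑ c, (starRingEnd ℂ) (v i c) * v j c = (0 : ℂ))) (i c : L) :
    ‖v i c‖ ≤ 1 := by
  have h1 : ∑ c, (starRingEnd ℂ) (v i c) * v i c = ((∑ c, ‖v i c‖ ^ 2 : ℝ) : ℂ) := by
    push_cast
    exact Finset.sum_congr rfl fun c _ => by rw [mul_comm, Complex.mul_conj']
  have h2 : ∑ c, ‖v i c‖ ^ 2 ≤ 1 := by
    by_cases hi : i ∈ J
    · have := (h i i).1 ⟨rfl, hi⟩
      rw [h1] at this
      have : ∑ c, ‖v i c‖ ^ 2 = 1 := by exact_mod_cast this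
      exact this.le
    · have := (h i i).2 fun h => hi h.2
      rw [h1] at this
      have : ∑ c, ‖v i c‖ ^ 2 = 0 := by exact_mod_cast this
      rw [this]; exact zero_le_one
  have h3 : ‖v i c‖ ^ 2 ≤ ∑ c, ‖v i c‖ ^ 2 :=
    Finset.single_le_sum (f := fun c => ‖v i c‖ ^ 2) (fun _ _ => sq_nonneg _) (Finset.mem_univ c)
  nlinarith [norm_nonneg (v i c)]

theorem exists_inner_factor {A B : Type*} [Fintype A] (x : A → Circ → L → ℂ) (y : B → Circ → L → ℂ)
    (hx : ∀ a c, AEStronglyMeasurable (fun t => x a t c) tm)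
    (bx : ∀ a c, ∃ R : ℝ, ∀ᵐ t ∂tm, ‖x a t c‖ ≤ R)
    (hy : ∀ b c, AEStronglyMeasurable (fun t => y b t c) tm)
    (hby : ∀ b c, ∃ R : ℝ, ∀ᵐ t ∂tm, ‖y b t c‖ ≤ R)
    (hxy : ∀ a b, HInf fun t => ∑ c, x a t c * y b t c) :
    ∃ (J : Set L) (q : Circ → L → L → ℂ),
      (∀ᵐ t ∂tm, ∀ i j,
        (i = j ∧ i ∈ J → ∑ c, (starRingEnd ℂ) (q t i c) * q t j c = (1 : ℂ)) ∧
        (¬ (i = j ∧ i ∈ J) → ∑ c, (starRingEnd ℂ) (q t i c) * q t j c = (0 : ℂ))) ∧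
      (∀ i a, HInf fun t => ∑ c, (starRingEnd ℂ) (q t i c) * x a t c) ∧
      (∀ i b, HInf fun t => ∑ c, q t i c * y b t c) ∧
      ∀ a b, ∑ j, (∫ t, ∑ c, (starRingEnd ℂ) (q t j c) * x a t c ∂tm) *
        (∫ t, ∑ c, q t j c * y b t c ∂tm) = ∫ t, ∑ c, x a t c * y b t c ∂tm := by
  have hX := fun a => memLp_toEuclidean (hx a) (bx a)
  have hY := fun b => memLp_toEuclidean (x := fun t c => (starRingEnd ℂ) (y b t c))
    (fun c => Complex.continuous_conj.comp_aestronglyMeasurable (hy b c))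
    (fun c => by simpa only [RCLike.norm_conj] using hby b c)
  let X : A → VecLp L := fun a => (hX a).toLp
  let Y : B → VecLp L := fun b => (hY b).toLp
  have eX : ∀ a, ∀ᵐ t ∂tm, ∀ c, X a t c = x a t c := fun a => by
    filter_upwards [(hX a).coeFn_toLp] with t ht c
    exact congrArg (fun v : EuclideanSpace ℂ L => v c) ht
  have eY : ∀ b, ∀ᵐ t ∂tm, ∀ c, Y b t c = (starRingEnd ℂ) (y b t c) := fun b => by
    filter_upwards [(hY b).coeFn_toLp] with t ht c
    exact congrArg (fun v : EuclideanSpace ℂ L => v c) ht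
  have iXY : ∀ a b k, inner ℂ (Y b) (twist k (X a)) =
      ∫ t, (∑ c, x a t c * y b t c) * fourier k t ∂tm := fun a b k => by
    rw [inner_twist_coe]
    refine integral_congr_ae ?_
    filter_upwards [eX a, eY b] with t h1 h2
    simp only [h1, h2, Complex.conj_conj]
  obtain ⟨J, q, h1, h2, h3, h4⟩ := exists_inner_factor_Lp X Y fun a b k => by
    rw [iXY]; exact (hxy a b).van k
  have iX : ∀ j a k, inner ℂ (q j) (twist k (X a)) =
      ∫ t, (∑ c, (starRingEnd ℂ) (q j t c) * x a t c) * fourier k t ∂tm := fun j a k => by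
    rw [inner_twist_coe]
    refine integral_congr_ae ?_
    filter_upwards [eX a] with t h1
    simp only [h1, mul_comm]
  have iY : ∀ j b k, inner ℂ (Y b) (twist k (q j)) =
      ∫ t, (∑ c, q j t c * y b t c) * fourier k t ∂tm := fun j b k => by
    rw [inner_twist_coe]
    refine integral_congr_ae ?_
    filter_upwards [eY b] with t h1
    simp only [h1, Complex.conj_conj]
  have hon : ∀ᵐ t ∂tm, ∀ i j,
        (i = j ∧ i ∈ J → ∑ c, (starRingEnd ℂ) (q i t c) * q j t c = (1 : ℂ)) ∧
        (¬ (i = j ∧ i ∈ J) → ∑ c, (starRingEnd ℂ) (q i t c) * q j t c = (0 : ℂ)) := by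
    filter_upwards [h1] with t ht i j
    have := ht i j
    simpa only [PiLp.inner_apply, RCLike.inner_apply, mul_comm] using this
  have hq : ∀ i c, AEStronglyMeasurable (fun t => q i t c) tm := fun i c =>
    ((memLp_piLp_iff.1 (Lp.memLp (q i))) c).1
  have bq : ∀ᵐ t ∂tm, ∀ i c, ‖q i t c‖ ≤ 1 := by
    filter_upwards [hon] with t ht i c
    exact norm_le_one_of_orthonormalOrZero (v := fun i c => q i t c) ht i c
  have bnd : ∀ (w : Circ → L → ℂ), (∀ c, ∃ R : ℝ, ∀ᵐ t ∂tm, ‖w t c‖ ≤ R) →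
      ∀ v : Circ → L → ℂ, (∀ᵐ t ∂tm, ∀ c, ‖v t c‖ ≤ 1) →
      ∃ R : ℝ, ∀ᵐ t ∂tm, ‖∑ c, v t c * w t c‖ ≤ R := by
    intro w hw v hv
    choose R hR using hw
    refine ⟨∑ c, R c, ?_⟩
    filter_upwards [hv, ae_all_iff.2 hR] with t h1 h2
    refine norm_sum_le_of_le _ fun c _ => ?_
    rw [norm_mul]
    calc _ ≤ 1 * ‖w t c‖ := mul_le_mul_of_nonneg_right (h1 c) (norm_nonneg _)
      _ ≤ R c := by rw [one_mul]; exact h2 c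
  refine ⟨J, fun t i c => q i t c, hon, fun i a => ⟨?_, ?_, fun k => ?_⟩,
    fun i b => ⟨?_, ?_, fun k => ?_⟩, fun a b => ?_⟩
  · exact Finset.aestronglyMeasurable_fun_sum _ fun c _ =>
      (Complex.continuous_conj.comp_aestronglyMeasurable (hq i c)).mul (hx a c)
  · refine bnd (x a) (bx a) (fun t c => (starRingEnd ℂ) (q i t c)) ?_
    filter_upwards [bq] with t ht c
    rw [RCLike.norm_conj]; exact ht i c
  · rw [← iX]; exact h2 i a k
  · exact Finset.aestronglyMeasurable_fun_sum _ fun c _ => (hq i c).mul (hy b c)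
  · refine bnd (y b) (hby b) (fun t c => q i t c) ?_
    filter_upwards [bq] with t ht c
    exact ht i c
  · rw [← iY]; exact h3 i b k
  · have e1 := iXY a b 0
    have e2 := fun j => iX j a 0
    have e3 := fun j => iY j b 0
    simp only [twist_zero, fourier_zero, mul_one] at e1 e2 e3
    have := h4 a b
    simp only [e1, e2, e3] at this
    exact this.symm

end InnerFactorCoord

section Rotation

variable {L : Type*} [Fintype L]

/-- A rotation invariant probability measure with bounded support and identity covariance. -/
structure IsRotMeasure (τ : Measure (EuclideanSpace ℂ L)) : Prop where
  prob : IsProbabilityMeasure τ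
  inv : ∀ U : EuclideanSpace ℂ L ≃+ EuclideanSpace ℂ L, (∀ w, ‖U w‖ = ‖w‖) → MeasurePreserving U τ τ
  bdd : ∃ R : ℝ, ∀ᵐ w ∂τ, ‖w‖ ≤ R
  cov : ∀ c, ∫ w, ‖w c‖ ^ 2 ∂τ = 1

theorem addEquiv_isometry {E : Type*} [SeminormedAddCommGroup E] {U : E ≃+ E}
    (h : ∀ w, ‖U w‖ = ‖w‖) : Isometry U :=
  AddMonoidHomClass.isometry_of_norm U h

theorem measurePreserving_addHaar {E : Type*} [NormedAddCommGroup E] [NormedSpace ℝ E]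
    [FiniteDimensional ℝ E] [MeasurableSpace E] [BorelSpace E] (m : Measure E) [m.IsAddHaarMeasure]
    (U : E ≃+ E) (h : ∀ w, ‖U w‖ = ‖w‖) : MeasurePreserving U m m := by
  have hs : ∀ w, ‖U.symm w‖ = ‖w‖ := fun w => by rw [← h, U.apply_symm_apply]
  have hc : Continuous U := (addEquiv_isometry h).continuous
  have hcs : Continuous U.symm := (addEquiv_isometry hs).continuous
  refine ⟨hc.measurable, ?_⟩
  have : (m.map U).IsAddHaarMeasure := U.isAddHaarMeasure_map m hc hcs
  have e := Measure.isAddLeftInvariant_eq_smul (m.map U) m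
  set c := Measure.addHaarScalarFactor (m.map U) m
  have e1 : m.map U (Metric.ball 0 1) = m (Metric.ball 0 1) := by
    rw [Measure.map_apply hc.measurable Metric.isOpen_ball.measurableSet]
    congr 1
    ext w; simp [h]
  rw [e, Measure.smul_apply, ENNReal.smul_def, smul_eq_mul] at e1
  have h1 : m (Metric.ball (0 : E) 1) ≠ 0 := (Metric.measure_ball_pos m 0 one_pos).ne'
  have h2 : m (Metric.ball (0 : E) 1) ≠ ⊤ := measure_ball_lt_top.ne
  have hc1 : (c : ENNReal) = 1 := by
    rw [← ENNReal.mul_left_inj h1 h2, e1, one_mul]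
  rw [e, ENNReal.coe_eq_one.1 hc1, one_smul]

theorem integrable_of_bdd_support {E : Type*} [NormedAddCommGroup E] [ProperSpace E]
    [MeasurableSpace E] [BorelSpace E] {τ : Measure E} [IsFiniteMeasure τ]
    (hb : ∃ R : ℝ, ∀ᵐ w ∂τ, ‖w‖ ≤ R) {G : Type*} [NormedAddCommGroup G] [SecondCountableTopology G]
    {f : E → G} (hf : Continuous f) : Integrable f τ := by
  obtain ⟨R, hR⟩ := hb
  obtain ⟨C, hC⟩ := (isCompact_closedBall (0 : E) R).exists_bound_of_continuousOn hf.continuousOn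
  refine Integrable.of_bound hf.aestronglyMeasurable C ?_
  filter_upwards [hR] with w hw
  exact hC w (by simpa using hw)

theorem IsRotMeasure.integrable {τ : Measure (EuclideanSpace ℂ L)} (h : IsRotMeasure τ)
    {G : Type*} [NormedAddCommGroup G] [SecondCountableTopology G]
    {f : EuclideanSpace ℂ L → G} (hf : Continuous f) : Integrable f τ := by
  have := h.prob
  exact integrable_of_bdd_support h.bdd hf

theorem exists_isRotMeasure (L : Type*) [Fintype L] :
    ∃ τ : Measure (EuclideanSpace ℂ L), IsRotMeasure τ := by
  classical
  have hfd : FiniteDimensional ℝ (EuclideanSpace ℂ L) := FiniteDimensional.trans ℝ ℂ (EuclideanSpace ℂ L)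
  let m : Measure (EuclideanSpace ℂ L) := Measure.addHaar
  let D : Set (EuclideanSpace ℂ L) := Metric.ball 0 1
  have h1 : m D ≠ 0 := (Metric.measure_ball_pos m 0 one_pos).ne'
  have h2 : m D ≠ ⊤ := measure_ball_lt_top.ne
  let τ₀ : Measure (EuclideanSpace ℂ L) := ProbabilityTheory.cond m D
  have hp : IsProbabilityMeasure τ₀ := ProbabilityTheory.cond_isProbabilityMeasure_of_finite h1 h2
  have hb : ∀ᵐ w ∂τ₀, ‖w‖ ≤ 1 := by
    have : ∀ᵐ w ∂τ₀, w ∈ D := ProbabilityTheory.ae_cond_mem Metric.isOpen_ball.measurableSet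
    filter_upwards [this] with w hw
    exact (mem_ball_zero_iff.1 hw).le
  have hinv : ∀ U : (EuclideanSpace ℂ L) ≃+ (EuclideanSpace ℂ L), (∀ w, ‖U w‖ = ‖w‖) → MeasurePreserving U τ₀ τ₀ := fun U hU => by
    have := (measurePreserving_addHaar m U hU)
    have := (this.restrict_preimage (s := D) Metric.isOpen_ball.measurableSet).smul_measure (m D)⁻¹
    have e : U ⁻¹' D = D := by ext w; simp [D, hU]
    rw [e] at this
    exact this
  have hcont : ∀ c, Continuous fun w : (EuclideanSpace ℂ L) => ‖w c‖ ^ 2 := fun c => by fun_prop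
  have hsame : ∀ c d, ∫ w, ‖w c‖ ^ 2 ∂τ₀ = ∫ w, ‖w d‖ ^ 2 ∂τ₀ := fun c d => by
    let U : (EuclideanSpace ℂ L) ≃ₗᵢ[ℂ] (EuclideanSpace ℂ L) := LinearIsometryEquiv.piLpCongrLeft 2 ℂ ℂ (Equiv.swap c d)
    have := hinv U.toLinearEquiv.toAddEquiv U.norm_map
    rw [← this.map_eq, integral_map this.measurable.aemeasurable
      (hcont c).aestronglyMeasurable, this.map_eq]
    congr 1; ext w
    have : (U w) c = w d := by
      rw [LinearIsometryEquiv.piLpCongrLeft_apply]; simp [Equiv.piCongrLeft']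
    exact congrArg (fun z : ℂ => ‖z‖ ^ 2) this
  obtain ⟨s, hs0, hs⟩ : ∃ s : ℝ, 0 < s ∧ ∀ c, s ^ 2 * ∫ w, ‖w c‖ ^ 2 ∂τ₀ = 1 := by
    rcases isEmpty_or_nonempty L with hL | ⟨⟨c₀⟩⟩
    · exact ⟨1, one_pos, fun c => hL.elim c⟩
    have hpos : 0 < ∫ w, ‖w c₀‖ ^ 2 ∂τ₀ := by
      refine lt_of_le_of_ne (integral_nonneg fun w => sq_nonneg _) fun h => ?_
      have h0 := (integral_eq_zero_iff_of_nonneg (fun w => sq_nonneg _)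
        (integrable_of_bdd_support ⟨1, hb⟩ (hcont c₀))).1 h.symm
      have hD : ∀ᵐ w ∂(m.restrict D), ‖w c₀‖ ^ 2 = 0 := by
        have : m.restrict D ≪ τ₀ := Measure.absolutelyContinuous_smul (ENNReal.inv_ne_zero.2 h2)
        exact this.ae_le h0
      rw [ae_restrict_iff' Metric.isOpen_ball.measurableSet] at hD
      have hO : IsOpen (D ∩ {w : (EuclideanSpace ℂ L) | ‖w c₀‖ ^ 2 ≠ 0}) :=
        Metric.isOpen_ball.inter (isOpen_ne_fun (hcont c₀) continuous_const)
      have hne : (D ∩ {w : (EuclideanSpace ℂ L) | ‖w c₀‖ ^ 2 ≠ 0}).Nonempty := by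
        refine ⟨EuclideanSpace.single c₀ (1 / 2 : ℂ), ?_, ?_⟩
        · simp only [D, mem_ball_zero_iff, PiLp.norm_single]; norm_num
        · simp
      refine (hO.measure_pos m hne).ne' ?_
      refine measure_mono_null (fun w hw => ?_) (ae_iff.1 hD)
      exact fun h => hw.2 (h hw.1)
    refine ⟨(Real.sqrt (∫ w, ‖w c₀‖ ^ 2 ∂τ₀))⁻¹, by positivity, fun c => ?_⟩
    rw [hsame c c₀, inv_pow, Real.sq_sqrt hpos.le, inv_mul_cancel₀ hpos.ne']
  have hsm : Measurable fun w : (EuclideanSpace ℂ L) => s • w := (continuous_const_smul s).measurable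
  refine ⟨τ₀.map fun w => s • w, Measure.isProbabilityMeasure_map hsm.aemeasurable,
    fun U hU => ?_, ⟨s, ?_⟩, fun c => ?_⟩
  · have hc : Continuous U := (addEquiv_isometry hU).continuous
    refine ⟨hc.measurable, ?_⟩
    rw [Measure.map_map hc.measurable hsm]
    have : (U ∘ fun w : (EuclideanSpace ℂ L) => s • w) = (fun w => s • w) ∘ U := by
      ext1 w; exact map_real_smul U hc s w
    rw [this, ← Measure.map_map hsm hc.measurable, (hinv U hU).map_eq]
  · rw [ae_map_iff hsm.aemeasurable (measurableSet_le measurable_norm measurable_const)]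
    filter_upwards [hb] with w hw
    rw [norm_smul, Real.norm_of_nonneg hs0.le]
    nlinarith
  · rw [integral_map hsm.aemeasurable (hcont c).aestronglyMeasurable, ← hs c,
      ← integral_const_mul]
    congr 1; ext w
    rw [PiLp.smul_apply, norm_smul, Real.norm_of_nonneg hs0.le, mul_pow]

end Rotation

section RotationAverages

variable {L : Type*} [Fintype L]

theorem IsRotMeasure.integral_comp {τ : Measure (EuclideanSpace ℂ L)} (h : IsRotMeasure τ)
    (U : EuclideanSpace ℂ L ≃+ EuclideanSpace ℂ L) (hU : ∀ w, ‖U w‖ = ‖w‖)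
    {G : Type*} [NormedAddCommGroup G] [NormedSpace ℝ G] [SecondCountableTopology G]
    {f : EuclideanSpace ℂ L → G} (hf : Continuous f) :
    ∫ w, f (U w) ∂τ = ∫ w, f w ∂τ := by
  have := h.inv U hU
  conv_rhs => rw [← this.map_eq]
  rw [integral_map this.measurable.aemeasurable hf.aestronglyMeasurable]

/-- Coordinatewise change of signs. -/
def flipEquiv (e : L → Bool) : EuclideanSpace ℂ L ≃ₗᵢ[ℂ] EuclideanSpace ℂ L :=
  LinearIsometryEquiv.piLpCongrRight 2 fun c =>
    if e c then LinearIsometryEquiv.refl ℂ ℂ else LinearIsometryEquiv.neg ℂ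

theorem flipEquiv_apply (e : L → Bool) (w : EuclideanSpace ℂ L) (c : L) :
    flipEquiv e w c = if e c then w c else -w c := by
  rw [flipEquiv, LinearIsometryEquiv.piLpCongrRight_apply]
  cases h : e c <;> simp [h]

/-- Coordinatewise complex conjugation. -/
def conjEquiv : EuclideanSpace ℂ L ≃+ EuclideanSpace ℂ L where
  toFun w := WithLp.toLp 2 fun c => (starRingEnd ℂ) (w c)
  invFun w := WithLp.toLp 2 fun c => (starRingEnd ℂ) (w c)
  left_inv w := by ext c; simp
  right_inv w := by ext c; simp
  map_add' v w := by ext c; simp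

theorem norm_conjEquiv (w : EuclideanSpace ℂ L) : ‖conjEquiv w‖ = ‖w‖ := by
  rw [EuclideanSpace.norm_eq, EuclideanSpace.norm_eq]
  simp [conjEquiv]

variable {τ : Measure (EuclideanSpace ℂ L)}

theorem IsRotMeasure.integral_flip (h : IsRotMeasure τ) (e : L → Bool)
    {G : Type*} [NormedAddCommGroup G] [NormedSpace ℝ G] [SecondCountableTopology G]
    {f : EuclideanSpace ℂ L → G} (hf : Continuous f) :
    ∫ w, f (flipEquiv e w) ∂τ = ∫ w, f w ∂τ :=
  h.integral_comp (flipEquiv e).toLinearEquiv.toAddEquiv (flipEquiv e).norm_map hf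

theorem IsRotMeasure.integral_mul_conj [DecidableEq L] (h : IsRotMeasure τ) (c d : L) :
    ∫ w, w c * (starRingEnd ℂ) (w d) ∂τ = if c = d then 1 else 0 := by
  split_ifs with hcd
  · subst hcd
    have : ∀ w : EuclideanSpace ℂ L, w c * (starRingEnd ℂ) (w c) = ((‖w c‖ ^ 2 : ℝ) : ℂ) :=
      fun w => by rw [Complex.mul_conj']; push_cast; rfl
    simp only [this]
    rw [integral_complex_ofReal, h.cov c, Complex.ofReal_one]
  · have hc : Continuous fun w : EuclideanSpace ℂ L => w c * (starRingEnd ℂ) (w d) := by fun_prop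
    have := h.integral_flip (fun i => decide (i = c)) hc
    have e : ∀ w : EuclideanSpace ℂ L, flipEquiv (fun i => decide (i = c)) w c *
        (starRingEnd ℂ) (flipEquiv (fun i => decide (i = c)) w d) =
        -(w c * (starRingEnd ℂ) (w d)) := fun w => by
      rw [flipEquiv_apply, flipEquiv_apply]
      simp [Ne.symm hcd]
    simp only [e] at this
    rw [integral_neg] at this
    have h2 : (2 : ℂ) * ∫ w, w c * (starRingEnd ℂ) (w d) ∂τ = 0 := by linear_combination -this
    simpa using h2

variable {I : Type*} [Fintype I]

theorem continuous_seminorm_comb (n : Seminorm ℂ (I → ℂ)) (x : L → I → ℂ) :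
    Continuous fun w : EuclideanSpace ℂ L => n (∑ c, w c • x c) ^ 2 := by
  refine ((seminorm_continuous_pi n).comp ?_).pow 2
  exact continuous_finsetSum _ fun c _ => by fun_prop

theorem IsRotMeasure.integral_sq_le (h : IsRotMeasure τ) {n : Seminorm ℂ (I → ℂ)} {T : ℝ}
    (hT : TypeTwo n T) (x : L → I → ℂ) :
    ∫ w, n (∑ c, w c • x c) ^ 2 ∂τ ≤ T ^ 2 * ∑ c, n (x c) ^ 2 := by
  classical
  have hcont := continuous_seminorm_comb n x
  have hint : ∀ e : L → Bool, Integrable (fun w => n (∑ c, flipEquiv e w c • x c) ^ 2) τ :=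
    fun e => h.integrable (hcont.comp (flipEquiv e).continuous)
  have e1 : ∑ e : L → Bool, ∫ w, n (∑ c, flipEquiv e w c • x c) ^ 2 ∂τ =
      2 ^ Fintype.card L * ∫ w, n (∑ c, w c • x c) ^ 2 ∂τ := by
    have : ∀ e : L → Bool, ∫ w, n (∑ c, flipEquiv e w c • x c) ^ 2 ∂τ =
        ∫ w, n (∑ c, w c • x c) ^ 2 ∂τ := fun e => h.integral_flip e hcont
    simp [this]
  have hi2 : ∀ c, Integrable (fun w : EuclideanSpace ℂ L => ‖w c‖ ^ 2 * n (x c) ^ 2) τ :=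
    fun c => h.integrable (by fun_prop)
  have e2 : ∫ w : EuclideanSpace ℂ L, 2 ^ Fintype.card L *
      (T ^ 2 * ∑ c, ‖w c‖ ^ 2 * n (x c) ^ 2) ∂τ =
      2 ^ Fintype.card L * (T ^ 2 * ∑ c, n (x c) ^ 2) := by
    rw [integral_const_mul, integral_const_mul, integral_finsetSum _ fun c _ => hi2 c]
    simp only [integral_mul_const, h.cov, one_mul]
  have key : ∑ e : L → Bool, ∫ w, n (∑ c, flipEquiv e w c • x c) ^ 2 ∂τ ≤
      ∫ w : EuclideanSpace ℂ L, 2 ^ Fintype.card L *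
      (T ^ 2 * ∑ c, ‖w c‖ ^ 2 * n (x c) ^ 2) ∂τ := by
    rw [← integral_finsetSum _ fun e _ => hint e]
    refine integral_mono (integrable_finsetSum _ fun e _ => hint e)
      (((integrable_finsetSum _ fun c _ => hi2 c).const_mul _).const_mul _) fun w => ?_
    have := hT.sum_le fun c => w c • x c
    simp only [map_smul_eq_mul, mul_pow] at this
    refine le_trans (le_of_eq (Finset.sum_congr rfl fun e _ => ?_)) this
    congr 2
    refine Finset.sum_congr rfl fun c _ => ?_
    rw [flipEquiv_apply]
    cases e c <;> simp
  rw [e1, e2] at key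
  exact le_of_mul_le_mul_left key (by positivity)

theorem seminorm_half_sq_le {I : Type*} (n : Seminorm ℂ (I → ℂ)) (x y : I → ℂ) :
    n ((1 / 2 : ℂ) • (x + y)) ^ 2 ≤ (1 / 2) * n x ^ 2 + (1 / 2) * n y ^ 2 := by
  have h1 : n ((1 / 2 : ℂ) • (x + y)) ≤ (1 / 2) * (n x + n y) := by
    rw [map_smul_eq_mul]
    norm_num
    exact map_add_le_add n x y
  have h0 := apply_nonneg n ((1 / 2 : ℂ) • (x + y))
  nlinarith [sq_nonneg (n x - n y), apply_nonneg n x, apply_nonneg n y]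

theorem IsRotMeasure.integral_proj_sq_le (h : IsRotMeasure τ) {n : Seminorm ℂ (I → ℂ)} {T : ℝ}
    (hT : TypeTwo n T) (x : L → I → ℂ) {J : Set L} {V : L → L → ℂ}
    (hV : ∀ i j, (i = j ∧ i ∈ J → ∑ c, (starRingEnd ℂ) (V i c) * V j c = (1 : ℂ)) ∧
        (¬ (i = j ∧ i ∈ J) → ∑ c, (starRingEnd ℂ) (V i c) * V j c = (0 : ℂ))) :
    ∫ w, n (∑ j, w j • ∑ c, V j c • x c) ^ 2 ∂τ ≤ T ^ 2 * ∑ c, n (x c) ^ 2 := by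
  classical
  let v : L → EuclideanSpace ℂ L := fun j => WithLp.toLp 2 (V j)
  have hin : ∀ i j, inner ℂ (v i) (v j) = ∑ c, (starRingEnd ℂ) (V i c) * V j c := fun i j => by
    simp only [PiLp.inner_apply, RCLike.inner_apply, v, mul_comm]
  have hon : Orthonormal ℂ (J.domRestrict v) := by
    rw [orthonormal_iff_ite]
    rintro ⟨i, hi⟩ ⟨j, hj⟩
    change inner ℂ (v i) (v j) = _
    rw [hin]
    by_cases hij : i = j
    · rw [(hV i j).1 ⟨hij, hi⟩]; simp [hij]
    · rw [(hV i j).2 fun h => hij h.1]; simp [hij]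
  obtain ⟨b, hb⟩ := hon.exists_orthonormalBasis_extension_of_card_eq
    (by rw [finrank_euclideanSpace])
  have hV0 : ∀ j, j ∉ J → V j = 0 := fun j hj => by
    have : inner ℂ (v j) (v j) = (0 : ℂ) := by rw [hin, (hV j j).2 fun h => hj h.2]
    rw [inner_self_eq_zero] at this
    exact congrArg WithLp.ofLp this
  let y : L → I → ℂ := fun j => ∑ c, b j c • x c
  have hy : ∀ w : EuclideanSpace ℂ L, ∑ c, (b.repr.symm w) c • x c = ∑ j, w j • y j := fun w => by
    have e : ∀ c, (b.repr.symm w) c = ∑ j, w j * b j c := fun c => by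
      rw [← b.sum_repr_symm, WithLp.ofLp_sum, Finset.sum_apply]
      rfl
    simp only [e, y, Finset.sum_smul, Finset.smul_sum, smul_smul]
    exact Finset.sum_comm
  have h1 : ∫ w, n (∑ j, w j • y j) ^ 2 ∂τ ≤ T ^ 2 * ∑ c, n (x c) ^ 2 := by
    simp only [← hy]
    have := h.integral_comp b.repr.symm.toLinearEquiv.toAddEquiv b.repr.symm.norm_map
      (continuous_seminorm_comb n x)
    exact le_trans (le_of_eq this) (h.integral_sq_le hT x)
  let e : L → Bool := fun j => decide (j ∈ J)
  have h2 : ∀ w : EuclideanSpace ℂ L, ∑ j, w j • ∑ c, V j c • x c =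
      (1 / 2 : ℂ) • (∑ j, w j • y j + ∑ j, flipEquiv e w j • y j) := fun w => by
    rw [← Finset.sum_add_distrib, Finset.smul_sum]
    refine Finset.sum_congr rfl fun j _ => ?_
    rw [flipEquiv_apply]
    by_cases hj : j ∈ J
    · have : y j = ∑ c, V j c • x c := by
        simp only [y, hb j hj]; rfl
      simp only [e, hj, decide_true, if_true, this]
      rw [← add_smul, smul_smul]; congr 1; ring
    · simp [e, hj, hV0 j hj]
  have hc := continuous_seminorm_comb n y
  have hi1 := h.integrable hc
  have hi2 : Integrable (fun w => n (∑ j, flipEquiv e w j • y j) ^ 2) τ :=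
    h.integrable (hc.comp (flipEquiv e).continuous)
  have e2 : ∫ w, n (∑ j, flipEquiv e w j • y j) ^ 2 ∂τ = ∫ w, n (∑ j, w j • y j) ^ 2 ∂τ :=
    h.integral_flip e hc
  calc ∫ w, n (∑ j, w j • ∑ c, V j c • x c) ^ 2 ∂τ
      ≤ ∫ w, ((1 / 2) * n (∑ j, w j • y j) ^ 2 +
          (1 / 2) * n (∑ j, flipEquiv e w j • y j) ^ 2) ∂τ := by
        refine integral_mono (h.integrable (continuous_seminorm_comb n fun j => ∑ c, V j c • x c))
          ((hi1.const_mul _).add (hi2.const_mul _)) fun w => ?_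
        simp only [h2]
        exact seminorm_half_sq_le n _ _
    _ = ∫ w, n (∑ j, w j • y j) ^ 2 ∂τ := by
        rw [integral_add (hi1.const_mul _) (hi2.const_mul _), integral_const_mul,
          integral_const_mul, e2]
        ring
    _ ≤ _ := h1

theorem IsRotMeasure.integral_conj_comb (h : IsRotMeasure τ) (n : Seminorm ℂ (I → ℂ))
    (x : L → I → ℂ) :
    ∫ w, n (∑ c, (starRingEnd ℂ) (w c) • x c) ^ 2 ∂τ = ∫ w, n (∑ c, w c • x c) ^ 2 ∂τ :=
  h.integral_comp conjEquiv norm_conjEquiv (continuous_seminorm_comb n x)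

end RotationAverages

section Signs

/-- Average over the discrete cube. -/
def cubeAvg {m : ℕ} (F : (Fin m → Bool) → ℝ) : ℝ := ((2 : ℝ) ^ m)⁻¹ * ∑ e, F e

theorem cubeAvg_succ {m : ℕ} (F : (Fin (m + 1) → Bool) → ℝ) :
    cubeAvg F = cubeAvg fun e : Fin m → Bool =>
      (F (Fin.cons true e : Fin (m + 1) → Bool) + F (Fin.cons false e : Fin (m + 1) → Bool)) / 2 := by
  have : ∑ e, F e = ∑ e : Fin m → Bool,
      (F (Fin.cons true e : Fin (m + 1) → Bool) + F (Fin.cons false e : Fin (m + 1) → Bool)) := by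
    rw [← Equiv.sum_comp (Fin.consEquiv fun _ : Fin (m + 1) => Bool), Fintype.sum_prod_type,
      Fintype.sum_bool, ← Finset.sum_add_distrib]
    rfl
  simp only [cubeAvg, this, ← Finset.sum_div]
  rw [pow_succ, mul_inv]
  ring

theorem cubeAvg_mono {m : ℕ} {F G : (Fin m → Bool) → ℝ} (h : ∀ e, F e ≤ G e) :
    cubeAvg F ≤ cubeAvg G :=
  mul_le_mul_of_nonneg_left (Finset.sum_le_sum fun e _ => h e) (by positivity)

theorem cubeAvg_add {m : ℕ} (F G : (Fin m → Bool) → ℝ) :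
    cubeAvg (fun e => F e + G e) = cubeAvg F + cubeAvg G := by
  simp only [cubeAvg, Finset.sum_add_distrib, mul_add]

theorem cubeAvg_mul_left {m : ℕ} (c : ℝ) (F : (Fin m → Bool) → ℝ) :
    cubeAvg (fun e => c * F e) = c * cubeAvg F := by
  simp only [cubeAvg, ← Finset.mul_sum]; ring

theorem cubeAvg_const {m : ℕ} (c : ℝ) : cubeAvg (fun _ : Fin m → Bool => c) = c := by
  simp [cubeAvg]

theorem cubeAvg_moments {m : ℕ} (f : (Fin m → Bool) → ℝ) (c : Fin m → ℝ)
    (hf : ∀ i e, |f e - f (Function.update e i (!e i))| ≤ 2 * c i) :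
    cubeAvg (fun e => (f e - cubeAvg f) ^ 2) ≤ ∑ i, c i ^ 2 ∧
    cubeAvg (fun e => (f e - cubeAvg f) ^ 4) ≤ 3 * (∑ i, c i ^ 2) ^ 2 := by
  induction m with
  | zero => simp [cubeAvg]
  | succ m ih =>
    let f1 : (Fin m → Bool) → ℝ := fun e => f (Fin.cons true e : Fin (m + 1) → Bool)
    let f0 : (Fin m → Bool) → ℝ := fun e => f (Fin.cons false e : Fin (m + 1) → Bool)
    let g : (Fin m → Bool) → ℝ := fun e => (f1 e + f0 e) / 2
    have hb : ∀ (b : Bool) i (e : Fin m → Bool),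
        |f (Fin.cons b e : Fin (m + 1) → Bool) -
          f (Fin.cons b (Function.update e i (!e i)) : Fin (m + 1) → Bool)| ≤ 2 * c i.succ :=
      fun b i e => by
        have := hf i.succ (Fin.cons b e : Fin (m + 1) → Bool)
        rwa [Fin.cons_succ, ← Fin.cons_update] at this
    have hg : ∀ i e, |g e - g (Function.update e i (!e i))| ≤ 2 * c i.succ := fun i e => by
      have h1 := abs_le.1 (hb true i e)
      have h0 := abs_le.1 (hb false i e)
      simp only [g, f1, f0]
      rw [abs_le]
      constructor <;> linarith [h1.1, h1.2, h0.1, h0.2]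
    have hh : ∀ e, |(f1 e - f0 e) / 2| ≤ c 0 := fun e => by
      have := hf 0 (Fin.cons true e : Fin (m + 1) → Bool)
      rw [Fin.cons_zero, Fin.update_cons_zero] at this
      rw [abs_div, abs_two]
      simp only [Bool.not_true] at this
      change |f1 e - f0 e| ≤ _ at this
      linarith
    obtain ⟨i2, i4⟩ := ih g (fun i => c i.succ) hg
    have hE : cubeAvg f = cubeAvg g := cubeAvg_succ f
    set E := cubeAvg g with hEdef
    set s := ∑ i : Fin m, c i.succ ^ 2 with hs
    have hs0 : 0 ≤ s := Finset.sum_nonneg fun i _ => sq_nonneg _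
    have hsq : ∀ e, ((f1 e - f0 e) / 2) ^ 2 ≤ c 0 ^ 2 := fun e => by
      rw [← sq_abs]; exact pow_le_pow_left₀ (abs_nonneg _) (hh e) 2
    rw [hE, Fin.sum_univ_succ]
    constructor
    · rw [cubeAvg_succ]
      calc _ ≤ cubeAvg fun e => (g e - E) ^ 2 + c 0 ^ 2 := cubeAvg_mono fun e => by
            have := hsq e
            simp only [g]
            change ((f1 e - E) ^ 2 + (f0 e - E) ^ 2) / 2 ≤ _
            nlinarith
        _ ≤ _ := by rw [cubeAvg_add, cubeAvg_const]; linarith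
    · rw [cubeAvg_succ]
      calc _ ≤ cubeAvg fun e => (g e - E) ^ 4 + (6 * c 0 ^ 2 * (g e - E) ^ 2 + c 0 ^ 4) :=
            cubeAvg_mono fun e => by
            have h1 := hsq e
            change ((f1 e - E) ^ 4 + (f0 e - E) ^ 4) / 2 ≤ _
            have e1 : f1 e - E = (g e - E) + (f1 e - f0 e) / 2 := by simp only [g]; ring
            have e0 : f0 e - E = (g e - E) - (f1 e - f0 e) / 2 := by simp only [g]; ring
            rw [e1, e0]
            set G := g e - E
            set H := (f1 e - f0 e) / 2
            have h2 : G ^ 2 * H ^ 2 ≤ G ^ 2 * c 0 ^ 2 :=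
              mul_le_mul_of_nonneg_left h1 (sq_nonneg _)
            have h3 : (H ^ 2) ^ 2 ≤ (c 0 ^ 2) ^ 2 := pow_le_pow_left₀ (sq_nonneg _) h1 2
            nlinarith
        _ ≤ _ := by
            rw [cubeAvg_add, cubeAvg_add, cubeAvg_const, cubeAvg_mul_left]
            have := mul_le_mul_of_nonneg_left i2 (by positivity : (0 : ℝ) ≤ 6 * c 0 ^ 2)
            nlinarith [sq_nonneg (c 0 ^ 2)]

variable {V : Type*} [AddCommGroup V]

theorem TypeTwo.cubeAvg_le {n : V → ℝ} {T : ℝ} (hT : TypeTwo n T) {m : ℕ} (x : Fin m → V) :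
    cubeAvg (fun e => n (radSum e x) ^ 2) ≤ T ^ 2 * ∑ i, n (x i) ^ 2 := by
  rw [cubeAvg, inv_mul_le_iff₀ (by positivity)]
  exact hT m x

variable [Module ℂ V]

theorem radSum_update {m : ℕ} (n : Seminorm ℂ V) (x : Fin m → V) (i : Fin m) (e : Fin m → Bool) :
    |n (radSum e x) - n (radSum (Function.update e i (!e i)) x)| ≤ 2 * n (x i) := by
  refine (abs_sub_map_le_sub n _ _).trans ?_
  have : radSum e x - radSum (Function.update e i (!e i)) x =
      (if e i then (2 : ℂ) else -2) • x i := by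
    rw [radSum, radSum, ← Finset.sum_sub_distrib, Finset.sum_eq_single i]
    · cases h : e i <;> simp [two_smul]
      abel
    · intro j _ hj
      rw [Function.update_of_ne hj, sub_self]
    · simp
  rw [this, map_smul_eq_mul]
  cases e i <;> simp

theorem cubeAvg_sq_le {m : ℕ} (F : (Fin m → Bool) → ℝ) : cubeAvg F ^ 2 ≤ cubeAvg fun e => F e ^ 2 := by
  have := cubeAvg_mono (F := fun _ => 0) (G := fun e => (F e - cubeAvg F) ^ 2) fun e => sq_nonneg _
  rw [cubeAvg_const] at this
  have e2 : (cubeAvg fun e => (F e - cubeAvg F) ^ 2) =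
      (cubeAvg fun e => F e ^ 2) + ((-2 * cubeAvg F) * cubeAvg F + cubeAvg F ^ 2) := by
    rw [← cubeAvg_mul_left, ← cubeAvg_const (m := m) (cubeAvg F ^ 2), ← cubeAvg_add, ← cubeAvg_add]
    congr 1; ext e; ring
  rw [e2] at this
  linarith

theorem cubeAvg_fourth_le {n : Seminorm ℂ V} {T : ℝ} (hT : TypeTwo n T) {m : ℕ} (x : Fin m → V)
    (hx : ∑ i, n (x i) ^ 2 ≤ 1) :
    cubeAvg (fun e => n (radSum e x) ^ 4) ≤ 8 * (3 + T ^ 4) := by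
  have h1 := (cubeAvg_moments _ (fun i => n (x i)) fun i e => radSum_update n x i e).2
  set E := cubeAvg fun e => n (radSum e x)
  have hE : E ^ 2 ≤ T ^ 2 := by
    refine (cubeAvg_sq_le _).trans ((hT.cubeAvg_le x).trans ?_)
    nlinarith [sq_nonneg T]
  have hE4 : E ^ 4 ≤ T ^ 4 := by
    have := pow_le_pow_left₀ (sq_nonneg E) hE 2
    nlinarith
  have hs0 : 0 ≤ ∑ i, n (x i) ^ 2 := Finset.sum_nonneg fun i _ => sq_nonneg _
  calc _ ≤ cubeAvg fun e => 8 * ((n (radSum e x) - E) ^ 4 + E ^ 4) := cubeAvg_mono fun e => by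
        set a := n (radSum e x) - E with ha
        have : n (radSum e x) = a + E := by rw [ha]; ring
        rw [this]
        have h1 : (a + E) ^ 2 ≤ 2 * (a ^ 2 + E ^ 2) := by nlinarith [sq_nonneg (a - E)]
        have h2 := pow_le_pow_left₀ (sq_nonneg (a + E)) h1 2
        nlinarith [sq_nonneg (a ^ 2 - E ^ 2)]
    _ = 8 * (cubeAvg (fun e => (n (radSum e x) - E) ^ 4) + E ^ 4) := by
        rw [cubeAvg_mul_left, cubeAvg_add, cubeAvg_const]
    _ ≤ _ := by nlinarith

/-- The sign as a complex number. -/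
def sgnC (b : Bool) : ℂ := if b then 1 else -1

theorem radSum_eq {ι : Type*} [Fintype ι] (e : ι → Bool) (x : ι → V) :
    radSum e x = ∑ i, sgnC (e i) • x i := by
  refine Finset.sum_congr rfl fun i _ => ?_
  cases e i <;> simp [sgnC]

theorem sum_sgnC_mul {m : ℕ} (c d : Fin m) :
    ∑ e : Fin m → Bool, sgnC (e c) * sgnC (e d) = if c = d then 2 ^ m else 0 := by
  split_ifs with h
  · subst h
    have : ∀ e : Fin m → Bool, sgnC (e c) * sgnC (e c) = 1 := fun e => by
      cases e c <;> simp [sgnC]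
    simp [this]
  · let F : (Fin m → Bool) → (Fin m → Bool) := fun e => Function.update e c (!e c)
    have hinv : Function.Involutive F := fun e => by
      ext j; by_cases hj : j = c
      · subst hj; simp [F]
      · simp [F, Function.update_of_ne hj]
    have := Equiv.sum_comp (hinv.toPerm F) fun e : Fin m → Bool => sgnC (e c) * sgnC (e d)
    have e1 : ∀ e : Fin m → Bool, sgnC (hinv.toPerm F e c) * sgnC (hinv.toPerm F e d) =
        -(sgnC (e c) * sgnC (e d)) := fun e => by
      change sgnC (F e c) * sgnC (F e d) = _
      simp only [F, Function.update_self, Function.update_of_ne (Ne.symm h)]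
      cases e c <;> cases e d <;> simp [sgnC]
    simp only [e1, Finset.sum_neg_distrib] at this
    linear_combination (-1 / 2) * this

theorem sum_bilin_radSum {W : Type*} [AddCommGroup W] [Module ℂ W] (v : V →ₗ[ℂ] W →ₗ[ℂ] ℂ)
    {m : ℕ} (x : Fin m → V) (y : Fin m → W) :
    ∑ e : Fin m → Bool, v (radSum e x) (radSum e y) = 2 ^ m * ∑ c, v (x c) (y c) := by
  simp only [radSum_eq, map_sum, map_smul, LinearMap.sum_apply, LinearMap.smul_apply, smul_eq_mul]
  rw [Finset.sum_comm, Finset.mul_sum]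
  refine Finset.sum_congr rfl fun c _ => ?_
  calc _ = ∑ d, (∑ e : Fin m → Bool, sgnC (e d) * sgnC (e c)) * v (x d) (y c) := by
        simp only [Finset.mul_sum, Finset.sum_mul]
        rw [Finset.sum_comm]
        refine Finset.sum_congr rfl fun d _ => Finset.sum_congr rfl fun e _ => by ring
    _ = _ := by
        simp only [sum_sgnC_mul]
        simp

end Signs

section BilinearTypeTwo

variable {V W P Q : Type*} [AddCommGroup V] [Module ℂ V] [AddCommGroup W] [Module ℂ W]
  {n : Seminorm ℂ V} {n' : Seminorm ℂ W} {v : (P → V) →ₗ[ℂ] (Q → W) →ₗ[ℂ] ℂ}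

/-- Square function bound for a bilinear form on columns. -/
def BilinGood (n : Seminorm ℂ V) (n' : Seminorm ℂ W) (v : (P → V) →ₗ[ℂ] (Q → W) →ₗ[ℂ] ℂ)
    (κ : ℝ) : Prop :=
  ∀ (m : ℕ) (x : Fin m → P → V) (y : Fin m → Q → W), (∀ k, ∑ c, n (x c k) ^ 2 ≤ 1) →
    (∀ k, ∑ c, n' (y c k) ^ 2 ≤ 1) → ‖∑ c, v (x c) (y c)‖ ≤ κ

theorem BilinGood.sum_le {κ : ℝ} (h : BilinGood n n' v κ) {ι : Type*} [Fintype ι] {x : ι → P → V}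
    {y : ι → Q → W} {a b : ℝ} (ha : 0 < a) (hb : 0 < b) (hx : ∀ k, ∑ c, n (x c k) ^ 2 ≤ a ^ 2)
    (hy : ∀ k, ∑ c, n' (y c k) ^ 2 ≤ b ^ 2) : ‖∑ c, v (x c) (y c)‖ ≤ a * b * κ := by
  let s := (Fintype.equivFin ι).symm
  have := h (Fintype.card ι) (fun i => (a : ℂ)⁻¹ • x (s i)) (fun i => (b : ℂ)⁻¹ • y (s i))
    (fun k => by
      have e := Equiv.sum_comp s fun c => n (x c k) ^ 2
      simp only [Pi.smul_apply, map_smul_eq_mul, mul_pow, ← Finset.mul_sum, e, norm_inv,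
        Complex.norm_real, Real.norm_of_nonneg ha.le, inv_pow]
      rw [inv_mul_le_iff₀ (by positivity), mul_one]; exact hx k)
    (fun k => by
      have e := Equiv.sum_comp s fun c => n' (y c k) ^ 2
      simp only [Pi.smul_apply, map_smul_eq_mul, mul_pow, ← Finset.mul_sum, e, norm_inv,
        Complex.norm_real, Real.norm_of_nonneg hb.le, inv_pow]
      rw [inv_mul_le_iff₀ (by positivity), mul_one]; exact hy k)
  have e := Equiv.sum_comp s fun c => v (x c) (y c)
  simp only [map_smul, LinearMap.smul_apply, smul_eq_mul, ← Finset.mul_sum, e, norm_mul, norm_inv,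
    Complex.norm_real, Real.norm_of_nonneg hb.le, Real.norm_of_nonneg ha.le] at this
  rw [inv_mul_le_iff₀ hb, inv_mul_le_iff₀ ha] at this
  linarith

theorem bilin_unit_scale {κ : ℝ} (hv : ∀ x y, (∀ k, n (x k) ≤ 1) → (∀ k, n' (y k) ≤ 1) → ‖v x y‖ ≤ κ)
    {x : P → V} {y : Q → W} {a b : ℝ} (ha : 0 < a) (hb : 0 < b) (hx : ∀ k, n (x k) ≤ a)
    (hy : ∀ k, n' (y k) ≤ b) : ‖v x y‖ ≤ a * b * κ := by
  have := hv ((a : ℂ)⁻¹ • x) ((b : ℂ)⁻¹ • y)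
    (fun k => by
      simp only [Pi.smul_apply, map_smul_eq_mul, norm_inv, Complex.norm_real,
        Real.norm_of_nonneg ha.le]
      rw [inv_mul_le_iff₀ ha, mul_one]; exact hx k)
    (fun k => by
      simp only [Pi.smul_apply, map_smul_eq_mul, norm_inv, Complex.norm_real,
        Real.norm_of_nonneg hb.le]
      rw [inv_mul_le_iff₀ hb, mul_one]; exact hy k)
  simp only [map_smul, LinearMap.smul_apply, smul_eq_mul, norm_mul, norm_inv,
    Complex.norm_real, Real.norm_of_nonneg hb.le, Real.norm_of_nonneg ha.le] at this
  rw [inv_mul_le_iff₀ hb, inv_mul_le_iff₀ ha] at this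
  linarith

theorem bilin_unit_scale_nonneg {κ : ℝ}
    (hv : ∀ x y, (∀ k, n (x k) ≤ 1) → (∀ k, n' (y k) ≤ 1) → ‖v x y‖ ≤ κ)
    {x : P → V} {y : Q → W} {a b : ℝ} (ha : 0 ≤ a) (hb : 0 ≤ b) (hx : ∀ k, n (x k) ≤ a)
    (hy : ∀ k, n' (y k) ≤ b) : ‖v x y‖ ≤ a * b * κ := by
  have h : ∀ e : ℝ, 0 < e → ‖v x y‖ ≤ (a + e) * (b + e) * κ := fun e he =>
    bilin_unit_scale hv (by linarith) (by linarith) (fun k => by linarith [hx k])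
      fun k => by linarith [hy k]
  have ht : Filter.Tendsto (fun e : ℝ => (a + e) * (b + e) * κ) (nhdsWithin 0 (Set.Ioi 0))
      (nhds ((a + 0) * (b + 0) * κ)) :=
    ((by fun_prop : Continuous fun e : ℝ => (a + e) * (b + e) * κ).tendsto 0).mono_left
      nhdsWithin_le_nhds
  rw [add_zero, add_zero] at ht
  exact ge_of_tendsto ht (Filter.eventually_of_mem self_mem_nhdsWithin fun e he => h e he)

theorem exists_bilinGood [Fintype P] [Fintype Q] {κ : ℝ}
    (hv : ∀ x y, (∀ k, n (x k) ≤ 1) → (∀ k, n' (y k) ≤ 1) → ‖v x y‖ ≤ κ) :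
    ∃ κ', BilinGood n n' v κ' := by
  have hκ : 0 ≤ κ := (norm_nonneg _).trans (hv 0 0 (by simp) (by simp))
  refine ⟨κ * ((Fintype.card P + Fintype.card Q) / 2), fun m x y hx hy => ?_⟩
  have h1 : ∀ c, ‖v (x c) (y c)‖ ≤ κ * ((∑ k, n (x c k) ^ 2 + ∑ k, n' (y c k) ^ 2) / 2) := fun c => by
    set s := ∑ k, n (x c k) ^ 2
    set s' := ∑ k, n' (y c k) ^ 2
    have hs : 0 ≤ s := Finset.sum_nonneg fun _ _ => sq_nonneg _
    have hs' : 0 ≤ s' := Finset.sum_nonneg fun _ _ => sq_nonneg _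
    have := bilin_unit_scale_nonneg (a := √s) (b := √s') hv (Real.sqrt_nonneg _)
      (Real.sqrt_nonneg _)
      (fun k => Real.le_sqrt_of_sq_le
        (Finset.single_le_sum (f := fun k => n (x c k) ^ 2) (fun _ _ => sq_nonneg _) (mem_univ k)))
      (fun k => Real.le_sqrt_of_sq_le
        (Finset.single_le_sum (f := fun k => n' (y c k) ^ 2) (fun _ _ => sq_nonneg _) (mem_univ k)))
    refine this.trans ?_
    have h2 : √s * √s' ≤ (s + s') / 2 := by
      nlinarith [sq_nonneg (√s - √s'), Real.sq_sqrt hs, Real.sq_sqrt hs']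
    nlinarith
  calc _ ≤ ∑ c, κ * ((∑ k, n (x c k) ^ 2 + ∑ k, n' (y c k) ^ 2) / 2) := norm_sum_le_of_le _ fun c _ => h1 c
    _ = κ * ((∑ k, ∑ c, n (x c k) ^ 2 + ∑ k, ∑ c, n' (y c k) ^ 2) / 2) := by
        rw [← Finset.mul_sum, ← Finset.sum_div, Finset.sum_add_distrib, Finset.sum_comm,
          Finset.sum_comm (f := fun c k => n' (y c k) ^ 2)]
    _ ≤ _ := by
        have e1 : ∑ k, ∑ c, n (x c k) ^ 2 ≤ Fintype.card P := by
          refine (Finset.sum_le_sum fun k _ => hx k).trans (by simp)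
        have e2 : ∑ k, ∑ c, n' (y c k) ^ 2 ≤ Fintype.card Q := by
          refine (Finset.sum_le_sum fun k _ => hy k).trans (by simp)
        gcongr

/-- The part of `x` above the level `l`. -/
def cutAbove (n : Seminorm ℂ V) (l : ℝ) (x : V) : V := open Classical in if n x ≤ l then 0 else x

theorem cutAbove_sq_le {n : Seminorm ℂ V} {l : ℝ} (hl : 0 < l) (x : V) :
    l ^ 2 * n (cutAbove n l x) ^ 2 ≤ n x ^ 4 := by
  unfold cutAbove
  split_ifs with h
  · simp
  · push Not at h
    have := pow_le_pow_left₀ hl.le h.le 2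
    nlinarith [sq_nonneg (n x)]

theorem sub_cutAbove_le {n : Seminorm ℂ V} {l : ℝ} (hl : 0 ≤ l) (x : V) :
    n (x - cutAbove n l x) ≤ l := by
  unfold cutAbove
  split_ifs with h
  · simpa using h
  · simpa using hl

theorem sub_cutAbove_le_self {n : Seminorm ℂ V} {l : ℝ} (x : V) :
    n (x - cutAbove n l x) ≤ n x := by
  unfold cutAbove
  split_ifs with h
  · simp
  · simp

theorem TypeTwo.sum_radSum_sq_le {T : ℝ} (hN : TypeTwo n T) {m : ℕ} {u : Fin m → V}
    (hu : ∑ i, n (u i) ^ 2 ≤ 1) : ∑ e, n (radSum e u) ^ 2 ≤ (√(2 ^ m) * T) ^ 2 := by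
  refine (hN m u).trans ?_
  rw [mul_pow, Real.sq_sqrt (by positivity)]
  have := mul_le_mul_of_nonneg_left hu (sq_nonneg T)
  rw [mul_one] at this
  gcongr

theorem TypeTwo.sum_cutAbove_sq_le {T l : ℝ} (h1 : 0 < T) (hl : 0 < l)
    (hl2 : l ^ 2 = 128 * T ^ 2 * (3 + T ^ 4)) (hN : TypeTwo n T) {m : ℕ} {u : Fin m → V}
    (hu : ∑ i, n (u i) ^ 2 ≤ 1) :
    ∑ e, n (cutAbove n l (radSum e u)) ^ 2 ≤ (√(2 ^ m) / (4 * T)) ^ 2 := by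
  have := cubeAvg_fourth_le hN u hu
  rw [cubeAvg, inv_mul_le_iff₀ (by positivity)] at this
  have h2 : l ^ 2 * ∑ e, n (cutAbove n l (radSum e u)) ^ 2 ≤ 2 ^ m * (8 * (3 + T ^ 4)) := by
    rw [Finset.mul_sum]
    exact (Finset.sum_le_sum fun e _ => cutAbove_sq_le hl _).trans this
  rw [← le_div_iff₀' (by positivity)] at h2
  refine h2.trans (le_of_eq ?_)
  rw [hl2, div_pow, Real.sq_sqrt (by positivity)]
  field_simp
  norm_num

theorem BilinGood.improve {T κ κ' : ℝ} (h1 : 0 < T) (hT : TypeTwo n T) (hT' : TypeTwo n' T)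
    (hv : ∀ x y, (∀ k, n (x k) ≤ 1) → (∀ k, n' (y k) ≤ 1) → ‖v x y‖ ≤ κ)
    (h : BilinGood n n' v κ') :
    BilinGood n n' v (128 * T ^ 2 * (3 + T ^ 4) * κ + κ' / 2) := by
  intro m x y hx hy
  set l : ℝ := √(128 * T ^ 2 * (3 + T ^ 4))
  have hl2 : l ^ 2 = 128 * T ^ 2 * (3 + T ^ 4) := Real.sq_sqrt (by positivity)
  have hl : 0 < l := Real.sqrt_pos.2 (by positivity)
  set R : ℝ := √(2 ^ m)
  have hR2 : R ^ 2 = 2 ^ m := Real.sq_sqrt (by positivity)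
  have hR : 0 < R := Real.sqrt_pos.2 (by positivity)
  have hxk : ∀ (e : Fin m → Bool) k, radSum e x k = radSum e fun c => x c k := fun e k =>
    radSum_map (Pi.evalAddMonoidHom (fun _ : P => V) k) e x
  have hyk : ∀ (e : Fin m → Bool) k, radSum e y k = radSum e fun c => y c k := fun e k =>
    radSum_map (Pi.evalAddMonoidHom (fun _ : Q => W) k) e y
  let X2 : (Fin m → Bool) → P → V := fun e k => cutAbove n l (radSum e x k)
  let Y2 : (Fin m → Bool) → Q → W := fun e k => cutAbove n' l (radSum e y k)
  have s1 : ‖∑ e, v (radSum e x - X2 e) (radSum e y - Y2 e)‖ ≤ 2 ^ m * (l ^ 2 * κ) := by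
    refine (norm_sum_le_of_le _ fun e _ => bilin_unit_scale hv hl hl
      (fun k => sub_cutAbove_le hl.le _) fun k => sub_cutAbove_le hl.le _).trans (le_of_eq ?_)
    simp [pow_two, Fintype.card_pi, mul_assoc]
  have s2 : ‖∑ e, v (X2 e) (radSum e y - Y2 e)‖ ≤ R / (4 * T) * (R * T) * κ' := by
    refine h.sum_le (by positivity) (by positivity) (fun k => ?_) fun k => ?_
    · simp only [X2, hxk]
      exact hT.sum_cutAbove_sq_le h1 hl hl2 (hx k)
    · refine le_trans (Finset.sum_le_sum fun e _ => ?_) (hT'.sum_radSum_sq_le (hy k))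
      rw [← hyk]
      exact pow_le_pow_left₀ (apply_nonneg _ _) (sub_cutAbove_le_self _) 2
  have s3 : ‖∑ e, v (radSum e x) (Y2 e)‖ ≤ R * T * (R / (4 * T)) * κ' := by
    refine h.sum_le (by positivity) (by positivity) (fun k => ?_) fun k => ?_
    · simp only [hxk]
      exact hT.sum_radSum_sq_le (hx k)
    · simp only [Y2, hyk]
      exact hT'.sum_cutAbove_sq_le h1 hl hl2 (hy k)
  have split : (2 : ℂ) ^ m * ∑ c, v (x c) (y c) =
      ∑ e, v (radSum e x - X2 e) (radSum e y - Y2 e) + ∑ e, v (X2 e) (radSum e y - Y2 e) +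
        ∑ e, v (radSum e x) (Y2 e) := by
    rw [← sum_bilin_radSum, ← Finset.sum_add_distrib, ← Finset.sum_add_distrib]
    refine Finset.sum_congr rfl fun e _ => ?_
    simp only [map_sub, LinearMap.sub_apply]
    ring
  have := norm_add₃_le.trans (add_le_add_three s1 s2 s3)
  rw [← split, norm_mul, norm_pow, Complex.norm_ofNat] at this
  have e3 : R / (4 * T) * (R * T) * κ' = 2 ^ m * (κ' / 4) := by
    rw [← hR2]; field_simp
  have e4 : R * T * (R / (4 * T)) * κ' = 2 ^ m * (κ' / 4) := by
    rw [← hR2]; field_simp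
  rw [e3, e4] at this
  rw [← hl2]
  refine le_of_mul_le_mul_left (this.trans (le_of_eq ?_)) (by positivity : (0 : ℝ) < 2 ^ m)
  ring

theorem bilinGood_of_unit [Fintype P] [Fintype Q] {T κ : ℝ} (h1 : 0 < T) (hT : TypeTwo n T)
    (hT' : TypeTwo n' T)
    (hv : ∀ x y, (∀ k, n (x k) ≤ 1) → (∀ k, n' (y k) ≤ 1) → ‖v x y‖ ≤ κ) :
    BilinGood n n' v (256 * T ^ 2 * (3 + T ^ 4) * κ) := by
  obtain ⟨κ', h⟩ := exists_bilinGood hv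
  have hn : ∀ j : ℕ, BilinGood n n' v (256 * T ^ 2 * (3 + T ^ 4) * κ + κ' * (1 / 2) ^ j) := by
    have hκ : 0 ≤ κ := (norm_nonneg _).trans (hv 0 0 (by simp) (by simp))
    intro j
    induction j with
    | zero =>
      intro m x y hx hy
      refine (h m x y hx hy).trans ?_
      rw [pow_zero, mul_one]
      have : 0 ≤ 256 * T ^ 2 * (3 + T ^ 4) * κ := by positivity
      linarith
    | succ j ih =>
      have := ih.improve h1 hT hT' hv
      convert this using 1
      ring
  intro m x y hx hy
  have ht : Filter.Tendsto (fun j : ℕ => 256 * T ^ 2 * (3 + T ^ 4) * κ + κ' * (1 / 2) ^ j)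
      Filter.atTop (nhds (256 * T ^ 2 * (3 + T ^ 4) * κ + κ' * 0)) :=
    ((tendsto_pow_atTop_nhds_zero_of_lt_one (by norm_num) (by norm_num)).const_mul _).const_add _
  rw [mul_zero, add_zero] at ht
  exact ge_of_tendsto' ht fun j => hn j m x y hx hy

end BilinearTypeTwo

section BilinearIntegral

variable {V W P Q : Type*} [AddCommGroup V] [Module ℂ V] [AddCommGroup W] [Module ℂ W]
  {n : Seminorm ℂ V} {n' : Seminorm ℂ W} {v : (P → V) →ₗ[ℂ] (Q → W) →ₗ[ℂ] ℂ}

theorem BilinGood.nonneg {G : ℝ} (h : BilinGood n n' v G) : 0 ≤ G :=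
  (norm_nonneg _).trans (h 0 (fun _ => 0) (fun _ => 0) (by simp) (by simp))

theorem BilinGood.norm_integral_le [Fintype P] [Fintype Q] {G : ℝ} (h : BilinGood n n' v G)
    {Z : Type*} [MeasurableSpace Z] {τ : Measure Z} [IsProbabilityMeasure τ] {X : Z → P → V}
    {Y : Z → Q → W} {a b : ℝ} (ha : 0 < a) (hb : 0 < b)
    (iX : ∀ k, Integrable (fun w => n (X w k) ^ 2) τ)
    (iY : ∀ k, Integrable (fun w => n' (Y w k) ^ 2) τ)
    (iv : Integrable (fun w => v (X w) (Y w)) τ)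
    (hX : ∀ k, ∫ w, n (X w k) ^ 2 ∂τ ≤ a ^ 2) (hY : ∀ k, ∫ w, n' (Y w k) ^ 2 ∂τ ≤ b ^ 2) :
    ‖∫ w, v (X w) (Y w) ∂τ‖ ≤ a * b * G := by
  have hG := h.nonneg
  let g : Z → (P → ℝ) × (Q → ℝ) × ℂ := fun w =>
    (fun k => n (X w k) ^ 2, fun k => n' (Y w k) ^ 2, v (X w) (Y w))
  have ig1 : Integrable (fun w => (g w).1) τ := Integrable.of_eval iX
  have ig2 : Integrable (fun w => (g w).2.1) τ := Integrable.of_eval iY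
  have ig : Integrable g τ := ig1.prodMk (ig2.prodMk iv)
  let S : Set ((P → ℝ) × (Q → ℝ) × ℂ) :=
    {p | ‖p.2.2‖ ≤ √(max ‖p.1‖ (a ^ 2)) * √(max ‖p.2.1‖ (b ^ 2)) * G}
  have hS : IsClosed S := isClosed_le (by fun_prop) (by fun_prop)
  have hsub : convexHull ℝ (Set.range g) ⊆ S := by
    intro p hp
    obtain ⟨ι, _, l, z, hl, -, hz, rfl⟩ := mem_convexHull_iff_exists_fintype.1 hp
    choose w hw using hz
    obtain rfl : (fun i => g (w i)) = z := funext hw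
    have e1 : ∀ k, (∑ i, l i • g (w i)).1 k = ∑ i, n (((√(l i) : ℝ) : ℂ) • X (w i) k) ^ 2 := by
      intro k
      simp only [Prod.fst_sum, Finset.sum_apply, Prod.smul_fst, Pi.smul_apply, smul_eq_mul, g]
      refine Finset.sum_congr rfl fun i _ => ?_
      rw [map_smul_eq_mul, mul_pow, Complex.norm_real, Real.norm_eq_abs, sq_abs, Real.sq_sqrt (hl i)]
    have e2 : ∀ k, (∑ i, l i • g (w i)).2.1 k = ∑ i, n' (((√(l i) : ℝ) : ℂ) • Y (w i) k) ^ 2 := by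
      intro k
      simp only [Prod.fst_sum, Prod.snd_sum, Finset.sum_apply, Prod.smul_fst, Prod.smul_snd,
        Pi.smul_apply, smul_eq_mul, g]
      refine Finset.sum_congr rfl fun i _ => ?_
      rw [map_smul_eq_mul, mul_pow, Complex.norm_real, Real.norm_eq_abs, sq_abs, Real.sq_sqrt (hl i)]
    have e3 : (∑ i, l i • g (w i)).2.2 =
        ∑ i, v (((√(l i) : ℝ) : ℂ) • X (w i)) (((√(l i) : ℝ) : ℂ) • Y (w i)) := by
      simp only [Prod.snd_sum, Prod.smul_snd, g]
      refine Finset.sum_congr rfl fun i _ => ?_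
      rw [map_smul, map_smul, LinearMap.smul_apply, smul_smul, ← Complex.ofReal_mul,
        Real.mul_self_sqrt (hl i), Complex.real_smul, smul_eq_mul]
    change ‖(∑ i, l i • g (w i)).2.2‖ ≤ √(max ‖(∑ i, l i • g (w i)).1‖ (a ^ 2)) *
      √(max ‖(∑ i, l i • g (w i)).2.1‖ (b ^ 2)) * G
    rw [e3]
    refine h.sum_le (Real.sqrt_pos.2 (lt_max_of_lt_right (by positivity)))
      (Real.sqrt_pos.2 (lt_max_of_lt_right (by positivity))) (fun k => ?_) fun k => ?_
    · rw [Real.sq_sqrt (le_max_of_le_right (by positivity))]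
      refine le_max_of_le_left (le_trans (le_of_eq (e1 k).symm) ?_)
      exact (le_abs_self _).trans (norm_le_pi_norm (∑ i, l i • g (w i)).1 k)
    · rw [Real.sq_sqrt (le_max_of_le_right (by positivity))]
      refine le_max_of_le_left (le_trans (le_of_eq (e2 k).symm) ?_)
      exact (le_abs_self _).trans (norm_le_pi_norm (∑ i, l i • g (w i)).2.1 k)
  have hmem : ∫ w, g w ∂τ ∈ S := by
    refine (closure_minimal hsub hS) ?_
    refine (convex_convexHull ℝ (Set.range g)).closure.integral_mem isClosed_closure ?_ ig
    exact Filter.Eventually.of_forall fun w =>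
      subset_closure (subset_convexHull ℝ _ (Set.mem_range_self w))
  have h1 : ∫ w, g w ∂τ = (∫ w, (g w).1 ∂τ, ∫ w, (g w).2 ∂τ) :=
    integral_pair ig1 (ig2.prodMk iv)
  have h2 : ∫ w, (g w).2 ∂τ = (∫ w, (g w).2.1 ∂τ, ∫ w, (g w).2.2 ∂τ) := integral_pair ig2 iv
  rw [h1, h2] at hmem
  change ‖∫ w, v (X w) (Y w) ∂τ‖ ≤ √(max ‖∫ w, (g w).1 ∂τ‖ (a ^ 2)) *
      √(max ‖∫ w, (g w).2.1 ∂τ‖ (b ^ 2)) * G at hmem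
  have b1 : ‖∫ w, (g w).1 ∂τ‖ ≤ a ^ 2 := by
    rw [pi_norm_le_iff_of_nonneg (by positivity)]
    intro k
    rw [eval_integral (f := fun w => (g w).1) iX, Real.norm_of_nonneg (integral_nonneg fun w => sq_nonneg _)]
    exact hX k
  have b2 : ‖∫ w, (g w).2.1 ∂τ‖ ≤ b ^ 2 := by
    rw [pi_norm_le_iff_of_nonneg (by positivity)]
    intro k
    rw [eval_integral (f := fun w => (g w).2.1) iY, Real.norm_of_nonneg (integral_nonneg fun w => sq_nonneg _)]
    exact hY k
  rwa [max_eq_right b1, max_eq_right b2, Real.sqrt_sq ha.le, Real.sqrt_sq hb.le] at hmem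

end BilinearIntegral

section RotationBilinear

variable {L I I' P Q : Type*} [Fintype L] [Fintype I] [Fintype I'] [Fintype P] [Fintype Q]

/-- A bilinear form summed over columns is controlled by rotation averages of the columns. -/
theorem IsRotMeasure.norm_sum_le {τ : Measure (EuclideanSpace ℂ L)} (hτ : IsRotMeasure τ)
    {n : Seminorm ℂ (I → ℂ)} {n' : Seminorm ℂ (I' → ℂ)} {T κ : ℝ} (h1 : 0 < T)
    (hT : TypeTwo n T) (hT' : TypeTwo n' T) (v : (P → I → ℂ) →ₗ[ℂ] (Q → I' → ℂ) →ₗ[ℂ] ℂ)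
    (hv : ∀ x y, (∀ k, n (x k) ≤ 1) → (∀ k, n' (y k) ≤ 1) → ‖v x y‖ ≤ κ)
    {A : L → P → I → ℂ} {B : L → Q → I' → ℂ} {a b : ℝ} (ha : 0 < a) (hb : 0 < b)
    (hA : ∀ k, ∫ w, n (∑ j, w j • A j k) ^ 2 ∂τ ≤ a ^ 2)
    (hB : ∀ k, ∫ w, n' (∑ j, w j • B j k) ^ 2 ∂τ ≤ b ^ 2) :
    ‖∑ j, v (A j) (B j)‖ ≤ a * b * (256 * T ^ 2 * (3 + T ^ 4) * κ) := by
  classical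
  have := hτ.prob
  let X : EuclideanSpace ℂ L → P → I → ℂ := fun w => ∑ j, w j • A j
  let Y : EuclideanSpace ℂ L → Q → I' → ℂ := fun w => ∑ j, (starRingEnd ℂ) (w j) • B j
  have eX : ∀ w k, X w k = ∑ j, w j • A j k := fun w k => by simp [X, Finset.sum_apply]
  have eY : ∀ w k, Y w k = ∑ j, (starRingEnd ℂ) (w j) • B j k := fun w k => by
    simp [Y, Finset.sum_apply]
  have ev : ∀ w, v (X w) (Y w) = ∑ j, ∑ i, (w j * (starRingEnd ℂ) (w i)) * v (A j) (B i) := by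
    intro w
    simp only [X, Y, map_sum, map_smul, LinearMap.sum_apply, LinearMap.smul_apply, smul_eq_mul,
      Finset.mul_sum]
    rw [Finset.sum_comm]
    refine Finset.sum_congr rfl fun j _ => Finset.sum_congr rfl fun i _ => by ring
  have ci : ∀ j i, Continuous fun w : EuclideanSpace ℂ L =>
      (w j * (starRingEnd ℂ) (w i)) * v (A j) (B i) := fun j i =>
    Continuous.mul (Continuous.mul (by fun_prop) (Complex.continuous_conj.comp (by fun_prop)))
      continuous_const
  have hI : ∫ w, v (X w) (Y w) ∂τ = ∑ j, v (A j) (B j) := by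
    simp only [ev]
    rw [integral_finsetSum _ fun j _ => hτ.integrable (continuous_finsetSum _ fun i _ => ci j i)]
    refine Finset.sum_congr rfl fun j _ => ?_
    rw [integral_finsetSum _ fun i _ => hτ.integrable (ci j i)]
    simp only [integral_mul_const, hτ.integral_mul_conj]
    simp
  rw [← hI]
  refine (bilinGood_of_unit h1 hT hT' hv).norm_integral_le ha hb (fun k => ?_) (fun k => ?_) ?_
    (fun k => ?_) fun k => ?_
  · simp only [eX]
    exact hτ.integrable (continuous_seminorm_comb n fun j => A j k)
  · simp only [eY]
    refine hτ.integrable (((seminorm_continuous_pi n').comp ?_).pow 2)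
    exact continuous_finsetSum _ fun c _ =>
      (Complex.continuous_conj.comp (by fun_prop)).smul continuous_const
  · simp only [ev]
    exact hτ.integrable (continuous_finsetSum _ fun j _ => continuous_finsetSum _ fun i _ => ci j i)
  · simpa only [eX] using hA k
  · simp only [eY]
    rw [hτ.integral_conj_comb n' fun j => B j k]
    exact hB k

end RotationBilinear

section FactorBound

variable {L I I' P Q : Type*} [Fintype L] [Fintype I] [Fintype I'] [Fintype P] [Fintype Q]

theorem IsRotMeasure.integral_thetaNorm_le {τ : Measure (EuclideanSpace ℂ L)}
    (hτ : IsRotMeasure τ) (n : Bool → Seminorm ℂ (I → ℂ)) {b : Circ → Bool} (hb : Measurable b)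
    {A : L → Circ → I → ℂ} (hA : ∀ j i, HInf fun t => A j t i) {R : ℝ}
    (hR : ∀ᵐ t ∂tm, ∫ w, n (b t) (∑ j, w j • A j t) ^ 2 ∂τ ≤ R) :
    ∫ w, thetaNorm n b (∑ j, w j • fun i => ∫ t, A j t i ∂tm) ^ 2 ∂τ ≤ R := by
  have := hτ.prob
  have hmeas : AEStronglyMeasurable
      (fun p : EuclideanSpace ℂ L × Circ => n (b p.2) (∑ j, p.1 j • A j p.2) ^ 2) (τ.prod tm) := by
    have h1 : AEStronglyMeasurable
        (fun p : EuclideanSpace ℂ L × Circ => ∑ j, p.1 j • A j p.2) (τ.prod tm) := by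
      refine (aemeasurable_pi_iff.2 fun i => ?_).aestronglyMeasurable
      simp only [Finset.sum_apply, Pi.smul_apply, smul_eq_mul]
      refine Finset.aemeasurable_fun_sum _ fun j _ => AEMeasurable.mul ?_ ?_
      · exact (by fun_prop : Continuous fun p : EuclideanSpace ℂ L × Circ => p.1 j).aemeasurable
      · exact (hA j i).meas.aemeasurable.comp_quasiMeasurePreserving
          Measure.quasiMeasurePreserving_snd
    have h2 : Continuous (fun x : Bool × (I → ℂ) => n x.1 x.2) :=
      continuous_prod_of_discrete_left.2 fun c => seminorm_continuous_pi (n c)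
    exact (h2.comp_aestronglyMeasurable
      ((hb.comp measurable_snd).aestronglyMeasurable.prodMk h1)).pow 2
  have hint : Integrable
      (fun p : EuclideanSpace ℂ L × Circ => n (b p.2) (∑ j, p.1 j • A j p.2) ^ 2) (τ.prod tm) := by
    obtain ⟨C, hC, hn⟩ := exists_bound_side n
    obtain ⟨D, hD⟩ := hτ.bdd
    choose S hS using fun j i => (hA j i).bdd
    have hS' : ∀ᵐ t ∂tm, ∀ j i, ‖A j t i‖ ≤ S j i := by
      simpa only [ae_all_iff] using hS
    refine Integrable.of_bound hmeas ((C * ∑ j, |D| * ∑ i, |S j i|) ^ 2) ?_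
    filter_upwards [Measure.quasiMeasurePreserving_fst.ae hD,
      Measure.quasiMeasurePreserving_snd.ae hS'] with p h1 h2
    rw [Real.norm_of_nonneg (sq_nonneg _)]
    refine pow_le_pow_left₀ (apply_nonneg _ _) ((hn _ _).trans ?_) 2
    refine mul_le_mul_of_nonneg_left (norm_sum_le_of_le _ fun j _ => ?_) hC
    rw [norm_smul]
    refine mul_le_mul ((PiLp.norm_apply_le p.1 j).trans (h1.trans (le_abs_self _))) ?_
      (norm_nonneg _) (abs_nonneg _)
    rw [pi_norm_le_iff_of_nonneg (Finset.sum_nonneg fun _ _ => abs_nonneg _)]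
    exact fun i => ((h2 j i).trans (le_abs_self _)).trans
      (Finset.single_le_sum (f := fun i => |S j i|) (fun _ _ => abs_nonneg _) (mem_univ i))
  have hpt : ∀ w : EuclideanSpace ℂ L, thetaNorm n b (∑ j, w j • fun i => ∫ t, A j t i ∂tm) ^ 2 ≤
      ∫ t, n (b t) (∑ j, w j • A j t) ^ 2 ∂tm := by
    intro w
    have hH : ∀ i, HInf fun t => (∑ j, w j • A j t) i := by
      intro i
      simp only [Finset.sum_apply, Pi.smul_apply, smul_eq_mul]
      exact HInf.sum _ fun j _ => HInf.const_mul _ (hA j i)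
    convert thetaNorm_integral_sq_le n hb hH using 3
    ext i
    simp only [Finset.sum_apply, Pi.smul_apply, smul_eq_mul]
    rw [integral_finsetSum _ fun j _ => ((hA j i).integrable).const_mul _]
    simp only [integral_const_mul]
  calc _ ≤ ∫ w, ∫ t, n (b t) (∑ j, w j • A j t) ^ 2 ∂tm ∂τ :=
        integral_mono (hτ.integrable (continuous_seminorm_comb _ _)) hint.integral_prod_left hpt
    _ = ∫ t, ∫ w, n (b t) (∑ j, w j • A j t) ^ 2 ∂τ ∂tm := integral_integral_swap hint
    _ ≤ ∫ _t, R ∂tm := integral_mono_ae hint.integral_prod_right (integrable_const _) hR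
    _ = R := by simp

theorem factor_bound (n : Bool → Seminorm ℂ (I → ℂ)) (n' : Bool → Seminorm ℂ (I' → ℂ))
    {b : Circ → Bool} (hb : Measurable b) {T κ : ℝ} (h1 : 0 < T) (hT : ∀ c, TypeTwo (n c) T)
    (hT' : ∀ c, TypeTwo (n' c) T) (v : (P → I → ℂ) →ₗ[ℂ] (Q → I' → ℂ) →ₗ[ℂ] ℂ)
    (hv : ∀ φ ψ, (∀ k, thetaNorm n b (φ k) ≤ 1) → (∀ k, thetaNorm n' b (ψ k) ≤ 1) →
      ‖v φ ψ‖ ≤ κ)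
    (x : P × I → Circ → L → ℂ) (y : Q × I' → Circ → L → ℂ)
    (hx : ∀ a c, AEStronglyMeasurable (fun t => x a t c) tm)
    (bx : ∀ a c, ∃ R : ℝ, ∀ᵐ t ∂tm, ‖x a t c‖ ≤ R)
    (hy : ∀ a c, AEStronglyMeasurable (fun t => y a t c) tm)
    (hby : ∀ a c, ∃ R : ℝ, ∀ᵐ t ∂tm, ‖y a t c‖ ≤ R)
    (hxy : ∀ a a', HInf fun t => ∑ c, x a t c * y a' t c)
    (nx : ∀ᵐ t ∂tm, ∀ k, ∑ c, n (b t) (fun i => x (k, i) t c) ^ 2 ≤ 1)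
    (ny : ∀ᵐ t ∂tm, ∀ k, ∑ c, n' (b t) (fun i => y (k, i) t c) ^ 2 ≤ 1) {z : P × I → Q × I' → ℂ}
    (hz : ∀ φ ψ, v φ ψ = ∑ a, ∑ a', z a a' * (φ a.1 a.2 * ψ a'.1 a'.2)) :
    ‖∑ a, ∑ a', z a a' * ∫ t, ∑ c, x a t c * y a' t c ∂tm‖ ≤
      256 * T ^ 4 * (3 + T ^ 4) * κ := by
  obtain ⟨J, q, hq, hA, hB, hAB⟩ := exists_inner_factor x y hx bx hy hby hxy
  obtain ⟨τ, hτ⟩ := exists_isRotMeasure L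
  let A : L → P → I → ℂ := fun j k i => ∫ t, ∑ c, (starRingEnd ℂ) (q t j c) * x (k, i) t c ∂tm
  let B : L → Q → I' → ℂ := fun j k i => ∫ t, ∑ c, q t j c * y (k, i) t c ∂tm
  have e : ∑ a, ∑ a', z a a' * ∫ t, ∑ c, x a t c * y a' t c ∂tm = ∑ j, v (A j) (B j) := by
    simp only [hz, ← hAB, Finset.mul_sum]
    rw [Finset.sum_comm (γ := L)]
    refine Finset.sum_congr rfl fun a _ => ?_
    rw [Finset.sum_comm]
  have hAk : ∀ k, ∫ w, thetaNorm n b (∑ j, w j • A j k) ^ 2 ∂τ ≤ T ^ 2 := by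
    intro k
    refine hτ.integral_thetaNorm_le n hb
      (A := fun j t i => ∑ c, (starRingEnd ℂ) (q t j c) * x (k, i) t c) (fun j i => hA j (k, i)) ?_
    filter_upwards [hq, nx] with t h2 h3
    have := hτ.integral_proj_sq_le (hT (b t)) (fun c i => x (k, i) t c) (J := J)
      (V := fun j c => (starRingEnd ℂ) (q t j c)) fun i j => by
        have h4 := h2 i j
        have e : ∑ c, (starRingEnd ℂ) ((starRingEnd ℂ) (q t i c)) * (starRingEnd ℂ) (q t j c) =
            (starRingEnd ℂ) (∑ c, (starRingEnd ℂ) (q t i c) * q t j c) := by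
          simp [map_sum]
        rw [e]
        exact ⟨fun h => by rw [h4.1 h, map_one], fun h => by rw [h4.2 h, map_zero]⟩
    have e2 : ∀ j, (∑ c, (starRingEnd ℂ) (q t j c) • fun i => x (k, i) t c) =
        fun i => ∑ c, (starRingEnd ℂ) (q t j c) * x (k, i) t c := fun j => by
      ext i; simp [Finset.sum_apply]
    simp only [e2] at this
    refine this.trans ?_
    nlinarith [h3 k, sq_nonneg T]
  have hBk : ∀ k, ∫ w, thetaNorm n' b (∑ j, w j • B j k) ^ 2 ∂τ ≤ T ^ 2 := by
    intro k
    refine hτ.integral_thetaNorm_le n' hb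
      (A := fun j t i => ∑ c, q t j c * y (k, i) t c) (fun j i => hB j (k, i)) ?_
    filter_upwards [hq, ny] with t h2 h3
    have := hτ.integral_proj_sq_le (hT' (b t)) (fun c i => y (k, i) t c) (J := J)
      (V := fun j c => q t j c) h2
    have e2 : ∀ j, (∑ c, q t j c • fun i => y (k, i) t c) =
        fun i => ∑ c, q t j c * y (k, i) t c := fun j => by
      ext i; simp [Finset.sum_apply]
    simp only [e2] at this
    refine this.trans ?_
    nlinarith [h3 k, sq_nonneg T]
  rw [e]
  refine (hτ.norm_sum_le h1 (typeTwo_thetaNorm hb hT) (typeTwo_thetaNorm hb hT') v hv h1 h1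
    hAk hBk).trans (le_of_eq ?_)
  ring

end FactorBound

section LatticeWeights

variable {I I' P Q : Type*} [Fintype P] [Fintype Q]

/-- `c` is bounded by `R` in the dual of the lattice norm `ρ`. -/
def WBound (ρ : (P → ℝ) → ℝ) (R : ℝ) (c : P → ℝ) : Prop :=
  ∀ r, (∀ k, 0 ≤ r k) → ∑ k, c k * r k ≤ R * ρ r

/-- A finite-dimensional lattice norm which is 2-concave with constant `M`. -/
structure LatData (ρ : (P → ℝ) → ℝ) (M : ℝ) : Prop where
  nonneg : ∀ r, 0 ≤ ρ r
  mono : ∀ r r', (∀ k, 0 ≤ r k) → (∀ k, r k ≤ r' k) → ρ r ≤ ρ r'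
  conc : ∀ (m : ℕ) (g : Fin m → P → ℝ), (∀ l k, 0 ≤ g l k) →
    ∑ l, ρ (g l) ^ 2 ≤ M ^ 2 * ρ (fun k => √(∑ l, g l k ^ 2)) ^ 2
  low : ∃ η : ℝ, 0 < η ∧ ∀ r, (∀ k, 0 ≤ r k) → η * ∑ k, r k ≤ ρ r
  const_nonneg : 0 ≤ M

theorem WBound.add {ρ : (P → ℝ) → ℝ} {R R' : ℝ} {c c' : P → ℝ} (h : WBound ρ R c)
    (h' : WBound ρ R' c') : WBound ρ (R + R') (c + c') := fun r hr => by
  simp only [Pi.add_apply, add_mul, Finset.sum_add_distrib]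
  exact add_le_add (h r hr) (h' r hr)

theorem WBound.mono {ρ : (P → ℝ) → ℝ} {R : ℝ} {c c' : P → ℝ} (h : WBound ρ R c)
    (hc : ∀ k, c' k ≤ c k) : WBound ρ R c' := fun r hr =>
  (Finset.sum_le_sum fun k _ => mul_le_mul_of_nonneg_right (hc k) (hr k)).trans (h r hr)

theorem LatData.conc_fintype {ρ : (P → ℝ) → ℝ} {M : ℝ} (h : LatData ρ M) {ι : Type*} [Fintype ι]
    (g : ι → P → ℝ) (hg : ∀ l k, 0 ≤ g l k) :
    ∑ l, ρ (g l) ^ 2 ≤ M ^ 2 * ρ (fun k => √(∑ l, g l k ^ 2)) ^ 2 := by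
  let s := (Fintype.equivFin ι).symm
  have := h.conc _ (fun l => g (s l)) fun l k => hg _ k
  rw [Equiv.sum_comp s fun l => ρ (g l) ^ 2] at this
  simpa only [fun k => Equiv.sum_comp s fun l => g l k ^ 2] using this

theorem LatData.wBound_sqrt {ρ : (P → ℝ) → ℝ} {M : ℝ} (h : LatData ρ M) {ι : Type*} [Fintype ι]
    {l : ι → ℝ} (hl : ∀ i, 0 ≤ l i) (hl1 : ∑ i, l i ≤ 1) {c : ι → P → ℝ} (hc0 : ∀ i k, 0 ≤ c i k)
    (hc : ∀ i, WBound ρ 1 (c i)) : WBound ρ M fun k => √(∑ i, l i * c i k ^ 2) := by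
  intro r hr
  set s : P → ℝ := fun k => √(∑ i, l i * c i k ^ 2)
  have hs0 : ∀ k, 0 ≤ s k := fun k => Real.sqrt_nonneg _
  have hs2 : ∀ k, s k ^ 2 = ∑ i, l i * c i k ^ 2 := fun k =>
    Real.sq_sqrt (Finset.sum_nonneg fun i _ => mul_nonneg (hl i) (sq_nonneg _))
  let g : ι → P → ℝ := fun i k => √(l i) * c i k * (r k / s k)
  have hg : ∀ i k, 0 ≤ g i k := fun i k =>
    mul_nonneg (mul_nonneg (Real.sqrt_nonneg _) (hc0 i k)) (div_nonneg (hr k) (hs0 k))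
  have e1 : ∑ k, s k * r k = ∑ i, √(l i) * ∑ k, c i k * g i k := by
    simp only [Finset.mul_sum]
    rw [Finset.sum_comm]
    refine Finset.sum_congr rfl fun k _ => ?_
    have : ∀ i, √(l i) * (c i k * g i k) = l i * c i k ^ 2 * (r k / s k) := fun i => by
      rw [show √(l i) * (c i k * g i k) = (√(l i) * √(l i)) * c i k ^ 2 * (r k / s k) by
        simp only [g]; ring, Real.mul_self_sqrt (hl i)]
    simp only [this, ← Finset.sum_mul, ← hs2]
    rcases eq_or_ne (s k) 0 with h0 | h0
    · simp [h0]
    · field_simp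
  have hcs := Real.sum_mul_le_sqrt_mul_sqrt univ (fun i => √(l i)) fun i => ρ (g i)
  have h1 : √(∑ i, √(l i) ^ 2) ≤ 1 := by
    refine Real.sqrt_le_one.2 ?_
    simpa only [fun i => Real.sq_sqrt (hl i)] using hl1
  have h2 : √(∑ i, ρ (g i) ^ 2) ≤ M * ρ r := by
    rw [Real.sqrt_le_iff]
    refine ⟨mul_nonneg h.const_nonneg (h.nonneg _), (h.conc_fintype g hg).trans ?_⟩
    rw [mul_pow]
    refine mul_le_mul_of_nonneg_left (pow_le_pow_left₀ (h.nonneg _) ?_ 2) (sq_nonneg _)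
    refine h.mono _ _ (fun k => Real.sqrt_nonneg _) fun k => ?_
    rw [Real.sqrt_le_iff]
    refine ⟨hr k, ?_⟩
    have : ∑ i, g i k ^ 2 = s k ^ 2 * (r k / s k) ^ 2 := by
      rw [hs2, Finset.sum_mul]
      refine Finset.sum_congr rfl fun i _ => ?_
      simp only [g, mul_pow, Real.sq_sqrt (hl i)]
    rw [this]
    rcases eq_or_ne (s k) 0 with h0 | h0
    · rw [h0]; simp [sq_nonneg]
    · apply le_of_eq; field_simp
  rw [e1]
  calc _ ≤ ∑ i, √(l i) * ρ (g i) := Finset.sum_le_sum fun i _ =>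
        mul_le_mul_of_nonneg_left ((hc i _ (hg i)).trans_eq (one_mul _)) (Real.sqrt_nonneg _)
    _ ≤ _ := hcs
    _ ≤ 1 * (M * ρ r) := mul_le_mul h1 h2 (Real.sqrt_nonneg _) zero_le_one
    _ = M * ρ r := one_mul _

/-- The products of elements of the two dual balls. -/
def prodSet (n : Seminorm ℂ (I → ℂ)) (n' : Seminorm ℂ (I' → ℂ)) (ρ : (P → ℝ) → ℝ)
    (ρ' : (Q → ℝ) → ℝ) : Set ((P × I) × (Q × I') → ℂ) :=
  {u | ∃ (φ : P → I → ℂ) (ψ : Q → I' → ℂ), (WBound ρ 1 fun k => n (φ k)) ∧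
    (WBound ρ' 1 fun k => n' (ψ k)) ∧ u = fun p => φ p.1.1 p.1.2 * ψ p.2.1 p.2.2}

variable {n : Seminorm ℂ (I → ℂ)} {n' : Seminorm ℂ (I' → ℂ)} {ρ : (P → ℝ) → ℝ}
    {ρ' : (Q → ℝ) → ℝ} {M M' : ℝ}

theorem zero_mem_prodSet (h : LatData ρ M) (h' : LatData ρ' M') : 0 ∈ prodSet n n' ρ ρ' :=
  ⟨0, 0, fun r _ => by simpa using h.nonneg r, fun r _ => by simpa using h'.nonneg r, by
    ext; simp⟩

theorem exists_factor_of_mem_convexHull (h : LatData ρ M) (h' : LatData ρ' M')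
    {u : (P × I) × (Q × I') → ℂ} (hu : u ∈ convexHull ℝ (prodSet n n' ρ ρ')) :
    ∃ (ι : Type) (_ : Fintype ι) (f : ι → P × I → ℂ) (g : ι → Q × I' → ℂ),
      (∀ a a', u (a, a') = ∑ i, f i a * g i a') ∧
      (WBound ρ M fun k => √(∑ i, n (fun j => f i (k, j)) ^ 2)) ∧
      WBound ρ' M' fun k => √(∑ i, n' (fun j => g i (k, j)) ^ 2) := by
  obtain ⟨ι, hι, l, z, hl, hl1, hz, rfl⟩ := mem_convexHull_iff_exists_fintype.1 hu
  choose φ ψ hφ hψ hz using hz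
  refine ⟨ι, hι, fun i a => ((√(l i) : ℝ) : ℂ) * φ i a.1 a.2,
    fun i a => ((√(l i) : ℝ) : ℂ) * ψ i a.1 a.2, fun a a' => ?_, ?_, ?_⟩
  · simp only [hz, Finset.sum_apply, Pi.smul_apply, Complex.real_smul]
    refine Finset.sum_congr rfl fun i _ => ?_
    rw [mul_mul_mul_comm, ← Complex.ofReal_mul, Real.mul_self_sqrt (hl i)]
  · refine (h.wBound_sqrt hl hl1.le (fun i k => apply_nonneg _ _) hφ).mono fun k => le_of_eq ?_
    congr 1
    refine Finset.sum_congr rfl fun i _ => ?_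
    change n (((√(l i) : ℝ) : ℂ) • φ i k) ^ 2 = _
    rw [map_smul_eq_mul, mul_pow, Complex.norm_real, Real.norm_eq_abs, sq_abs, Real.sq_sqrt (hl i)]
  · refine (h'.wBound_sqrt hl hl1.le (fun i k => apply_nonneg _ _) hψ).mono fun k => le_of_eq ?_
    congr 1
    refine Finset.sum_congr rfl fun i _ => ?_
    change n' (((√(l i) : ℝ) : ℂ) • ψ i k) ^ 2 = _
    rw [map_smul_eq_mul, mul_pow, Complex.norm_real, Real.norm_eq_abs, sq_abs, Real.sq_sqrt (hl i)]

theorem mem_closure_convexHull_prodSet [Fintype I] [Fintype I'] {u : (P × I) × (Q × I') → ℂ}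
    (hu : ∀ (v : (P × I) × (Q × I') → ℂ) (r : ℝ),
      (∀ w ∈ prodSet n n' ρ ρ', ‖∑ p, v p * w p‖ ≤ r) → ‖∑ p, v p * u p‖ ≤ r) :
    u ∈ closure (convexHull ℝ (prodSet n n' ρ ρ')) := by
  classical
  by_contra hnot
  obtain ⟨F, r, h1, h2⟩ := RCLike.geometric_hahn_banach_closed_point (𝕜 := ℂ)
    ((convex_convexHull ℝ (prodSet n n' ρ ρ')).closure) isClosed_closure hnot
  have hF : ∀ w, ∑ p, F (Pi.single p 1) * w p = F w := by
    intro w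
    have hw : ∑ p, w p • (Pi.single p 1 : (P × I) × (Q × I') → ℂ) = w := by
      ext q
      simp [Finset.sum_apply, Pi.single_apply]
    conv_rhs => rw [← hw, map_sum]
    refine Finset.sum_congr rfl fun p _ => ?_
    rw [map_smul, smul_eq_mul, mul_comm]
  have := hu (fun p => F (Pi.single p 1)) r fun w hw => by
    rw [hF]
    obtain ⟨c, hc1, hc⟩ : ∃ c : ℂ, ‖c‖ = 1 ∧ c * F w = ‖F w‖ := by
      rcases eq_or_ne (F w) 0 with h0 | h0
      · exact ⟨1, by simp, by simp [h0]⟩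
      · refine ⟨‖F w‖ / F w, ?_, by field_simp⟩
        rw [norm_div, Complex.norm_real, norm_norm, div_self (norm_ne_zero_iff.2 h0)]
    have hcw : c • w ∈ prodSet n n' ρ ρ' := by
      obtain ⟨φ, ψ, hφ, hψ, rfl⟩ := hw
      refine ⟨c • φ, ψ, ?_, hψ, ?_⟩
      · simpa only [Pi.smul_apply, map_smul_eq_mul, hc1, one_mul] using hφ
      · ext p
        simp [mul_assoc]
    have := (h1 _ (subset_closure (subset_convexHull ℝ _ hcw))).le
    rw [map_smul, smul_eq_mul, hc] at this
    simpa using this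
  rw [hF] at this
  exact absurd (h2.trans_le (RCLike.re_le_norm _)) (not_lt.2 this)

end LatticeWeights

section MeasurableFactor

theorem exists_measurable_net {E : Type*} [NormedAddCommGroup E] [SecondCountableTopology E]
    [MeasurableSpace E] [OpensMeasurableSpace E] {S K : Set E} (hS : S.Nonempty)
    (hK : IsCompact K) (hKS : K ⊆ closure S) {δ : ℝ} (hδ : 0 < δ) :
    ∃ (p : ℕ → E) (N : ℕ) (j : E → ℕ), (∀ k, p k ∈ S) ∧ Measurable j ∧ (∀ u, j u ≤ N) ∧
      ∀ u ∈ K, ‖u - p (j u)‖ ≤ δ := by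
  have : Nonempty S := hS.to_subtype
  let p : ℕ → E := fun k => TopologicalSpace.denseSeq S k
  have hp : ∀ u ∈ K, ∃ k, u ∈ Metric.ball (p k) δ := by
    intro u hu
    obtain ⟨s, hs, hus⟩ := Metric.mem_closure_iff.1 (hKS hu) (δ / 2) (by positivity)
    obtain ⟨k, hk⟩ := Metric.denseRange_iff.1 (TopologicalSpace.denseRange_denseSeq S) ⟨s, hs⟩
      (δ / 2) (by positivity)
    refine ⟨k, ?_⟩
    have hk' : dist s (p k) < δ / 2 := hk
    have := dist_triangle u s (p k)
    rw [Metric.mem_ball]; linarith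
  obtain ⟨t, ht⟩ := hK.elim_finite_subcover (fun k => Metric.ball (p k) δ)
    (fun _ => Metric.isOpen_ball) fun u hu => by simpa using hp u hu
  refine ⟨p, t.sup id, SimpleFunc.nearestPtInd p (t.sup id), fun k => Subtype.coe_prop _,
    SimpleFunc.measurable _, fun u => SimpleFunc.nearestPtInd_le _ _ _, fun u hu => ?_⟩
  obtain ⟨k, hk, huk⟩ : ∃ k ∈ t, u ∈ Metric.ball (p k) δ := by simpa using ht hu
  have := SimpleFunc.edist_nearestPt_le p u (Finset.le_sup (f := id) hk)
  rw [SimpleFunc.nearestPt, SimpleFunc.map_apply, edist_dist, edist_dist,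
    ENNReal.ofReal_le_ofReal_iff dist_nonneg, dist_comm, dist_eq_norm] at this
  rw [Metric.mem_ball, dist_comm] at huk
  simp only [id] at this huk
  exact this.trans huk.le

variable {I I' P Q : Type} [Fintype I] [Fintype I'] [Fintype P] [Fintype Q]

theorem exists_measurable_factor {n : Bool → Seminorm ℂ (I → ℂ)} {n' : Bool → Seminorm ℂ (I' → ℂ)}
    {ρ : Bool → (P → ℝ) → ℝ} {ρ' : Bool → (Q → ℝ) → ℝ} {M M' : ℝ} (h : ∀ c, LatData (ρ c) M)
    (h' : ∀ c, LatData (ρ' c) M') {b : Circ → Bool} (hb : Measurable b)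
    {W : Circ → (P × I) × (Q × I') → ℂ} (mW : ∀ p, AEStronglyMeasurable (fun t => W t p) tm)
    (bW : ∀ p, ∃ B : ℝ, ∀ᵐ t ∂tm, ‖W t p‖ ≤ B)
    (hW : ∀ᵐ t ∂tm, W t ∈ closure
      (convexHull ℝ (prodSet (n (b t)) (n' (b t)) (ρ (b t)) (ρ' (b t))))) {η : ℝ} (hη : 0 < η) :
    ∃ (L : Type) (_ : Fintype L) (x : P × I → Circ → L → ℂ) (y : Q × I' → Circ → L → ℂ)
      (s : Circ → P → ℝ) (s' : Circ → Q → ℝ),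
      (∀ a c, AEStronglyMeasurable (fun t => x a t c) tm) ∧
      (∀ a c, ∃ R : ℝ, ∀ᵐ t ∂tm, ‖x a t c‖ ≤ R) ∧
      (∀ a c, AEStronglyMeasurable (fun t => y a t c) tm) ∧
      (∀ a c, ∃ R : ℝ, ∀ᵐ t ∂tm, ‖y a t c‖ ≤ R) ∧
      (∀ t a a', ∑ c, x a t c * y a' t c = W t (a, a')) ∧
      (∀ t, WBound (ρ (b t)) M (s t)) ∧ (∀ t, WBound (ρ' (b t)) M' (s' t)) ∧
      (∀ t k, 0 ≤ s t k) ∧ (∀ t k, 0 ≤ s' t k) ∧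
      (∀ᵐ t ∂tm, ∀ k, ∑ c, n (b t) (fun i => x (k, i) t c) ^ 2 ≤ s t k ^ 2 + η) ∧
      ∀ᵐ t ∂tm, ∀ k, ∑ c, n' (b t) (fun i => y (k, i) t c) ^ 2 ≤ s' t k ^ 2 + η := by
  classical
  obtain ⟨C, hC, hn⟩ := exists_bound_side n
  obtain ⟨C', hC', hn'⟩ := exists_bound_side n'
  choose B hB using bW
  have hB' : ∀ᵐ t ∂tm, ∀ p, ‖W t p‖ ≤ B p := by simpa only [ae_all_iff] using hB
  set D : ℝ := Fintype.card ((P × I) × (Q × I')) * (C ^ 2 + C' ^ 2) + 1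
  have hD : 0 < D := by positivity
  set e : ℝ := √(η / D)
  have he : 0 < e := Real.sqrt_pos.2 (by positivity)
  have he2 : D * e ^ 2 = η := by
    rw [Real.sq_sqrt (by positivity)]; field_simp
  let K : Set ((P × I) × (Q × I') → ℂ) := Metric.closedBall 0 (∑ p, |B p|)
  let S : Bool → Set ((P × I) × (Q × I') → ℂ) := fun c =>
    convexHull ℝ (prodSet (n c) (n' c) (ρ c) (ρ' c))
  have hnet := fun c => exists_measurable_net (S := S c) (K := K ∩ closure (S c))
    ⟨0, subset_convexHull ℝ _ (zero_mem_prodSet (h c) (h' c))⟩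
    ((isCompact_closedBall _ _).inter_right isClosed_closure) Set.inter_subset_right
    (δ := e ^ 2) (by positivity)
  choose p N j hpS mj hjN hj using hnet
  have mWv : AEMeasurable W tm := aemeasurable_pi_iff.2 fun p => (mW p).aemeasurable
  let Δ := Bool × Fin (N true + N false + 1)
  have hjN' : ∀ c u, j c u < N true + N false + 1 := fun c u => by
    have := hjN c u
    cases c <;> omega
  let sel : Circ → Δ := fun t => (b t, ⟨j (b t) (mWv.mk W t), hjN' _ _⟩)
  have msel : Measurable sel := by
    refine hb.prodMk ?_
    have h1 : Measurable fun q : Bool × ((P × I) × (Q × I') → ℂ) =>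
        (⟨j q.1 q.2, hjN' _ _⟩ : Fin (N true + N false + 1)) := by
      refine measurable_from_prod_countable_right fun c => ?_
      refine measurable_to_countable' fun i => ?_
      have : (fun u => (⟨j c u, hjN' _ _⟩ : Fin (N true + N false + 1))) ⁻¹' {i} =
          j c ⁻¹' {(i : ℕ)} := by
        ext u; simp [Fin.ext_iff]
      rw [this]
      exact mj c (measurableSet_singleton _)
    exact h1.comp (hb.prodMk mWv.measurable_mk)
  let u : Δ → (P × I) × (Q × I') → ℂ := fun d => p d.1 d.2
  have hfac := fun d : Δ => exists_factor_of_mem_convexHull (h d.1) (h' d.1) (hpS d.1 d.2)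
  choose ι hι f g hfg hs hs' using hfac
  have hclose : ∀ᵐ t ∂tm, ∀ q, ‖W t q - u (sel t) q‖ ≤ e ^ 2 := by
    filter_upwards [hB', hW, mWv.ae_eq_mk] with t h1 h2 h3 q
    have hmem : W t ∈ K ∩ closure (S (b t)) := by
      refine ⟨?_, h2⟩
      rw [mem_closedBall_zero_iff, pi_norm_le_iff_of_nonneg (Finset.sum_nonneg fun _ _ => abs_nonneg _)]
      exact fun q => ((h1 q).trans (le_abs_self _)).trans
        (Finset.single_le_sum (f := fun q => |B q|) (fun _ _ => abs_nonneg _) (mem_univ q))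
    have h4 := hj (b t) (W t) hmem
    have h5 : u (sel t) = p (b t) (j (b t) (W t)) := by
      simp only [u, sel, ← h3]
    rw [h5]
    exact (norm_le_pi_norm (W t - p (b t) (j (b t) (W t))) q).trans h4
  let x : P × I → Circ → ((d : Δ) × ι d) ⊕ ((P × I) × (Q × I')) → ℂ := fun a t =>
    Sum.elim (fun c => if sel t = c.1 then f c.1 c.2 a else 0) fun c => if c.1 = a then (e : ℂ) else 0
  let y : Q × I' → Circ → ((d : Δ) × ι d) ⊕ ((P × I) × (Q × I')) → ℂ := fun a t =>
    Sum.elim (fun c => if sel t = c.1 then g c.1 c.2 a else 0)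
      fun c => if c.2 = a then (e : ℂ)⁻¹ * (W t c - u (sel t) c) else 0
  have msel' : ∀ d : Δ, MeasurableSet {t | sel t = d} := fun d =>
    msel (measurableSet_singleton d)
  have hsig : ∀ (t : Circ) (F : (d : Δ) → ι d → ℝ),
      ∑ c : (d : Δ) × ι d, (if sel t = c.1 then F c.1 c.2 else 0) = ∑ i, F (sel t) i := by
    intro t F
    rw [Fintype.sum_sigma, Finset.sum_eq_single (sel t)]
    · simp
    · intro d _ hd
      simp [hd.symm]
    · simp
  have hsigC : ∀ (t : Circ) (F : (d : Δ) → ι d → ℂ),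
      ∑ c : (d : Δ) × ι d, (if sel t = c.1 then F c.1 c.2 else 0) = ∑ i, F (sel t) i := by
    intro t F
    rw [Fintype.sum_sigma, Finset.sum_eq_single (sel t)]
    · simp
    · intro d _ hd
      simp [hd.symm]
    · simp
  have hcount : ∀ (X : ℝ) (_ : 0 ≤ X) (_ : X ^ 2 ≤ C ^ 2 + C' ^ 2)
      (v : (P × I) × (Q × I') → ℝ) (_ : ∀ c, 0 ≤ v c) (_ : ∀ c, v c ≤ X * e),
      ∑ c, v c ^ 2 ≤ η := by
    intro X hX hX2 v hv0 hv
    calc ∑ c, v c ^ 2 ≤ ∑ _c : (P × I) × (Q × I'), (C ^ 2 + C' ^ 2) * e ^ 2 := by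
          refine Finset.sum_le_sum fun c _ => (pow_le_pow_left₀ (hv0 c) (hv c) 2).trans ?_
          rw [mul_pow]
          exact mul_le_mul_of_nonneg_right hX2 (sq_nonneg _)
      _ = (D - 1) * e ^ 2 := by
          rw [Finset.sum_const, Finset.card_univ, nsmul_eq_mul]; simp only [D]; ring
      _ ≤ η := by rw [← he2]; nlinarith [sq_nonneg e]
  refine ⟨_, inferInstance, x, y,
    fun t k => √(∑ i, n (b t) (fun l => f (sel t) i (k, l)) ^ 2),
    fun t k => √(∑ i, n' (b t) (fun l => g (sel t) i (k, l)) ^ 2), ?_, ?_, ?_, ?_, ?_,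
    fun t => hs (sel t), fun t => hs' (sel t), fun t k => Real.sqrt_nonneg _,
    fun t k => Real.sqrt_nonneg _, ?_, ?_⟩
  · rintro a (c | c)
    · exact (Measurable.ite (msel' _) measurable_const measurable_const).aestronglyMeasurable
    · exact aestronglyMeasurable_const
  · rintro a (c | c)
    · refine ⟨‖f c.1 c.2 a‖, Filter.Eventually.of_forall fun t => ?_⟩
      simp only [x, Sum.elim_inl]
      split_ifs <;> simp
    · exact ⟨‖if c.1 = a then (e : ℂ) else 0‖, Filter.Eventually.of_forall fun t => le_rfl⟩
  · rintro a (c | c)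
    · exact (Measurable.ite (msel' _) measurable_const measurable_const).aestronglyMeasurable
    · by_cases hca : c.2 = a
      · simp only [y, Sum.elim_inr, hca, if_true]
        refine ((mW c).sub ?_).const_mul _
        exact ((measurable_of_finite fun d => u d c).comp msel).aestronglyMeasurable
      · simp only [y, Sum.elim_inr, hca, if_false]
        exact aestronglyMeasurable_const
  · rintro a (c | c)
    · refine ⟨‖g c.1 c.2 a‖, Filter.Eventually.of_forall fun t => ?_⟩
      simp only [y, Sum.elim_inl]
      split_ifs <;> simp
    · refine ⟨‖(e : ℂ)⁻¹‖ * e ^ 2, ?_⟩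
      filter_upwards [hclose] with t ht
      simp only [y, Sum.elim_inr]
      split_ifs
      · rw [norm_mul]
        exact mul_le_mul_of_nonneg_left (ht c) (norm_nonneg _)
      · rw [norm_zero]; positivity
  · intro t a a'
    rw [Fintype.sum_sum_type]
    have e1 : ∑ c : (d : Δ) × ι d, x a t (Sum.inl c) * y a' t (Sum.inl c) = u (sel t) (a, a') := by
      simp only [x, y, Sum.elim_inl, ite_mul, zero_mul, mul_ite, mul_zero]
      rw [show u (sel t) (a, a') = _ from hfg (sel t) a a', ← hsigC t fun d i => f d i a * g d i a']
      refine Finset.sum_congr rfl fun c _ => ?_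
      split_ifs <;> rfl
    have e2 : ∑ c : (P × I) × (Q × I'), x a t (Sum.inr c) * y a' t (Sum.inr c) =
        W t (a, a') - u (sel t) (a, a') := by
      rw [Finset.sum_eq_single (a, a')]
      · simp only [x, y, Sum.elim_inr, if_true]
        rw [mul_inv_cancel_left₀ (by exact_mod_cast he.ne')]
      · intro c _ hc
        simp only [x, y, Sum.elim_inr]
        by_cases h1 : c.1 = a
        · have h2 : c.2 ≠ a' := fun h2 => hc (Prod.ext h1 h2)
          simp [h2]
        · simp [h1]
      · simp
    rw [e1, e2]; ring
  · refine Filter.Eventually.of_forall fun t k => ?_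
    rw [Fintype.sum_sum_type, Real.sq_sqrt (Finset.sum_nonneg fun _ _ => sq_nonneg _)]
    refine add_le_add (le_of_eq ?_) (hcount C hC (by nlinarith [sq_nonneg C']) _ (fun c => apply_nonneg _ _) fun c => ?_)
    · rw [← hsig t fun d i => n (b t) (fun l => f d i (k, l)) ^ 2]
      refine Finset.sum_congr rfl fun c _ => ?_
      simp only [x, Sum.elim_inl]
      split_ifs
      · rfl
      · change n (b t) 0 ^ 2 = 0
        simp
    · refine (hn _ _).trans (mul_le_mul_of_nonneg_left ?_ hC)
      rw [pi_norm_le_iff_of_nonneg he.le]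
      intro i
      simp only [x, Sum.elim_inr]
      split_ifs
      · rw [Complex.norm_real, Real.norm_of_nonneg he.le]
      · rw [norm_zero]; exact he.le
  · filter_upwards [hclose] with t ht k
    rw [Fintype.sum_sum_type, Real.sq_sqrt (Finset.sum_nonneg fun _ _ => sq_nonneg _)]
    refine add_le_add (le_of_eq ?_) (hcount C' hC' (by nlinarith [sq_nonneg C]) _ (fun c => apply_nonneg _ _) fun c => ?_)
    · rw [← hsig t fun d i => n' (b t) (fun l => g d i (k, l)) ^ 2]
      refine Finset.sum_congr rfl fun c _ => ?_
      simp only [y, Sum.elim_inl]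
      split_ifs
      · rfl
      · change n' (b t) 0 ^ 2 = 0
        simp
    · refine (hn' _ _).trans (mul_le_mul_of_nonneg_left ?_ hC')
      rw [pi_norm_le_iff_of_nonneg he.le]
      intro i
      simp only [y, Sum.elim_inr]
      split_ifs
      · rw [norm_mul, norm_inv, Complex.norm_real, Real.norm_of_nonneg he.le,
          inv_mul_le_iff₀ he, ← pow_two]
        exact ht c
      · rw [norm_zero]; exact he.le

end MeasurableFactor

section FiniteDimensional

theorem exists_outer_normalizer {I L : Type*} [Fintype I] [Fintype L]
    (n : Bool → Seminorm ℂ (I → ℂ)) {b : Circ → Bool} (hb : Measurable b) {x : I → Circ → L → ℂ}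
    (hx : ∀ a c, AEStronglyMeasurable (fun t => x a t c) tm)
    (bx : ∀ a c, ∃ R : ℝ, ∀ᵐ t ∂tm, ‖x a t c‖ ≤ R) {η : ℝ} (hη : 0 < η) :
    ∃ a : Circ → ℂ, HInf a ∧ HInf (fun t => (a t)⁻¹) ∧
      ∀ᵐ t ∂tm, ‖a t‖ = √(∑ c, n (b t) (fun i => x i t c) ^ 2 + η) := by
  choose R hR using bx
  obtain ⟨C, hC, hn⟩ := exists_bound_side n
  let S : Circ → ℝ := fun t => ∑ c, n (b t) (fun i => x i t c) ^ 2
  have hS0 : ∀ t, 0 ≤ S t := fun t => Finset.sum_nonneg fun _ _ => sq_nonneg _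
  have hSm : AEStronglyMeasurable S tm :=
    Finset.aestronglyMeasurable_fun_sum _ fun c _ =>
      (aestronglyMeasurable_sideNorm n hb (f := fun t i => x i t c) fun a => hx a c).pow 2
  set D : ℝ := ∑ c, (C * ∑ i, |R i c|) ^ 2
  have hD : ∀ᵐ t ∂tm, S t ≤ D := by
    have hR' : ∀ᵐ t ∂tm, ∀ i c, ‖x i t c‖ ≤ R i c := by simpa only [ae_all_iff] using hR
    filter_upwards [hR'] with t ht
    refine Finset.sum_le_sum fun c _ => pow_le_pow_left₀ (apply_nonneg _ _) ((hn _ _).trans ?_) 2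
    refine mul_le_mul_of_nonneg_left ?_ hC
    rw [pi_norm_le_iff_of_nonneg (Finset.sum_nonneg fun _ _ => abs_nonneg _)]
    exact fun i => ((ht i c).trans (le_abs_self _)).trans
      (Finset.single_le_sum (f := fun i => |R i c|) (fun _ _ => abs_nonneg _) (mem_univ i))
  have hpos : ∀ t, 0 < S t + η := fun t => by linarith [hS0 t]
  have hum : AEStronglyMeasurable (fun t => Real.log (S t + η) / 2) tm :=
    ((Real.measurable_log.comp_aemeasurable
      ((hSm.aemeasurable.add_const η))).div_const 2).aestronglyMeasurable
  obtain ⟨a, h1, h2, h3, -⟩ := exists_outer hum (B := (|Real.log η| + |Real.log (D + η)|) / 2) (by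
    filter_upwards [hD] with t ht
    rw [abs_div, abs_two]
    refine div_le_div_of_nonneg_right ?_ two_pos.le
    have l1 := Real.log_le_log hη (by linarith [hS0 t] : η ≤ S t + η)
    have l2 := Real.log_le_log (hpos t) (by linarith : S t + η ≤ D + η)
    rw [abs_le]
    constructor
    · linarith [neg_abs_le (Real.log η), abs_nonneg (Real.log (D + η))]
    · linarith [le_abs_self (Real.log (D + η)), abs_nonneg (Real.log η)])
  refine ⟨a, h1, h2, ?_⟩
  filter_upwards [h3] with t ht
  rw [ht, ← Real.log_sqrt (hpos t).le, Real.exp_log (Real.sqrt_pos.2 (hpos t))]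

theorem sum_normalized_le {I L : Type*} [Fintype L] (n : Seminorm ℂ (I → ℂ)) {x : I → L → ℂ}
    {a : ℂ} {η : ℝ}
    (hη : 0 < η) (ha : ‖a‖ = √(∑ c, n (fun i => x i c) ^ 2 + η)) :
    ∑ c, n (fun i => a⁻¹ * x i c) ^ 2 ≤ 1 := by
  have h0 : 0 ≤ ∑ c, n (fun i => x i c) ^ 2 := Finset.sum_nonneg fun _ _ => sq_nonneg _
  have h1 : ∀ c, n (fun i => a⁻¹ * x i c) ^ 2 = (‖a‖ ^ 2)⁻¹ * n (fun i => x i c) ^ 2 := fun c => by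
    change n (a⁻¹ • fun i => x i c) ^ 2 = _
    rw [map_smul_eq_mul, mul_pow, norm_inv, inv_pow]
  simp only [h1, ← Finset.mul_sum]
  rw [ha, Real.sq_sqrt (by positivity), inv_mul_le_iff₀ (by positivity)]
  linarith

variable {I I' P Q : Type} [Fintype I] [Fintype I'] [Fintype P] [Fintype Q]

theorem wBound_weights {ρ : (P → ℝ) → ℝ} {M η : ℝ} (hη : 0 < η) {s S : P → ℝ} (hs : WBound ρ M s)
    (hs0 : ∀ k, 0 ≤ s k) (hlow : ∀ r, (∀ k, 0 ≤ r k) → η * ∑ k, r k ≤ ρ r)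
    (hS : ∀ k, S k ≤ s k ^ 2 + η ^ 2 / 2) : WBound ρ (M + 1) fun k => √(S k + η ^ 2 / 2) := by
  have h1 : WBound ρ 1 fun _ => η := fun r hr => by
    rw [← Finset.mul_sum, one_mul]
    exact hlow r hr
  refine (hs.add h1).mono fun k => ?_
  rw [Pi.add_apply, Real.sqrt_le_iff]
  refine ⟨add_nonneg (hs0 k) hη.le, ?_⟩
  nlinarith [hS k, mul_nonneg (hs0 k) hη.le]

theorem LatData.exists_low {ρ : Bool → (P → ℝ) → ℝ} {M : ℝ} (h : ∀ c, LatData (ρ c) M) :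
    ∃ η : ℝ, 0 < η ∧ ∀ c r, (∀ k, 0 ≤ r k) → η * ∑ k, r k ≤ ρ c r := by
  choose η h1 h2 using fun c => (h c).low
  refine ⟨min (η true) (η false), lt_min (h1 _) (h1 _), fun c r hr => le_trans ?_ (h2 c r hr)⟩
  refine mul_le_mul_of_nonneg_right ?_ (Finset.sum_nonneg fun k _ => hr k)
  cases c
  · exact min_le_right _ _
  · exact min_le_left _ _

theorem exists_scaled_family (n : Bool → Seminorm ℂ (I → ℂ)) {b : Circ → Bool}
    {ρ : Bool → (P → ℝ) → ℝ} {M : ℝ} (hM : 0 ≤ M) {a : P → Circ → ℂ} (ha : ∀ k, HInf (a k))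
    (haw : ∀ᵐ t ∂tm, WBound (ρ (b t)) M fun k => ‖a k t‖) {φ : P → I → ℂ}
    (hρ : ∀ c r, 0 ≤ ρ c r) (hφ : ∀ k, thetaNorm n b (φ k) ≤ 1) :
    ∃ f : Circ → P → I → ℂ, (∀ k i, HInf fun t => f t k i) ∧
      (∀ᵐ t ∂tm, WBound (ρ (b t)) 1 fun k => n (b t) (f t k)) ∧
      ∀ k i, 2 * (M + 1) * ∫ t, f t k i ∂tm = (∫ t, a k t ∂tm) * φ k i := by
  have h2 : ∀ k, thetaNorm n b (φ k) < 2 := fun k => (hφ k).trans_lt one_lt_two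
  choose g hg hgi hgn using fun k => exists_of_thetaNorm_lt (h2 k)
  have hM2 : (0 : ℝ) < 2 * (M + 1) := by positivity
  refine ⟨fun t k i => ((2 * (M + 1) : ℝ) : ℂ)⁻¹ * (a k t * g k t i), fun k i => 
    HInf.const_mul _ ((ha k).mul (hg k i)), ?_, fun k i => ?_⟩
  · filter_upwards [haw, ae_all_iff.2 hgn] with t h3 h4
    intro r hr
    have h5 := h3 r hr
    have h6 : ∀ k, n (b t) (fun i => ((2 * (M + 1) : ℝ) : ℂ)⁻¹ * (a k t * g k t i)) * r k ≤
        (M + 1)⁻¹ * (‖a k t‖ * r k) := by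
      intro k
      rw [show (fun i => ((2 * (M + 1) : ℝ) : ℂ)⁻¹ * (a k t * g k t i)) =
        ((2 * (M + 1) : ℝ) : ℂ)⁻¹ • a k t • g k t from rfl, map_smul_eq_mul, map_smul_eq_mul,
        norm_inv, Complex.norm_real, Real.norm_of_nonneg hM2.le, mul_inv,
        show (M + 1)⁻¹ * (‖a k t‖ * r k) = ((M + 1)⁻¹ * ‖a k t‖) * r k from (mul_assoc _ _ _).symm]
      refine mul_le_mul_of_nonneg_right ?_ (hr k)
      calc 2⁻¹ * (M + 1)⁻¹ * (‖a k t‖ * n (b t) (g k t)) ≤ 2⁻¹ * (M + 1)⁻¹ * (‖a k t‖ * 2) := by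
            have := h4 k
            gcongr
        _ = _ := by ring
    refine (Finset.sum_le_sum fun k _ => h6 k).trans ?_
    rw [← Finset.mul_sum, inv_mul_le_iff₀ (by positivity)]
    nlinarith [hρ (b t) r]
  · rw [integral_const_mul, (ha k).integral_mul (hg k i), hgi]
    push_cast
    have : (2 * ((M : ℂ) + 1)) ≠ 0 := by exact_mod_cast hM2.ne'
    rw [mul_inv_cancel_left₀ this]

set_option maxHeartbeats 1000000 in
theorem fd_bound {θ : ℝ} (h0 : 0 < θ) (hθ1 : θ < 1) {n : Bool → Seminorm ℂ (I → ℂ)}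
    {n' : Bool → Seminorm ℂ (I' → ℂ)} {ρ : Bool → (P → ℝ) → ℝ} {ρ' : Bool → (Q → ℝ) → ℝ}
    {T M κ : ℝ} (h1 : 0 < T) (hT : ∀ c, TypeTwo (n c) T) (hT' : ∀ c, TypeTwo (n' c) T)
    (h : ∀ c, LatData (ρ c) M) (h' : ∀ c, LatData (ρ' c) M)
    (N : Bool → Seminorm ℂ ((P × I) × (Q × I') → ℂ))
    (hN : ∀ c v r, (∀ w ∈ prodSet (n c) (n' c) (ρ c) (ρ' c), ‖∑ p, v p * w p‖ ≤ r) → N c v ≤ r)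
    (L : ((P × I) × (Q × I') → ℂ) →ₗ[ℂ] ℂ) (hL : ∀ v, ‖L v‖ ≤ interpN θ (N true) (N false) v)
    (z : (P × I) × (Q × I') → ℂ)
    (hz : ∀ (φ : Circ → P → I → ℂ) (ψ : Circ → Q → I' → ℂ), (∀ k i, HInf fun t => φ t k i) →
      (∀ k i, HInf fun t => ψ t k i) →
      (∀ᵐ t ∂tm, WBound (ρ (side θ t)) 1 fun k => n (side θ t) (φ t k)) →
      (∀ᵐ t ∂tm, WBound (ρ' (side θ t)) 1 fun k => n' (side θ t) (ψ t k)) →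
      ‖∑ p, z p * ((∫ t, φ t p.1.1 p.1.2 ∂tm) * ∫ t, ψ t p.2.1 p.2.2 ∂tm)‖ ≤ κ) :
    ‖L z‖ ≤ 1024 * T ^ 4 * (3 + T ^ 4) * (M + 2) ^ 2 * κ := by
  classical
  have hb := measurable_side θ
  have hM : 0 ≤ M := (h true).const_nonneg
  obtain ⟨W, hW, hWL, hWN⟩ := exists_analytic_dual h0 hθ1 N L hL
  obtain ⟨η₁, hη₁, hlow₁⟩ := LatData.exists_low h
  obtain ⟨η₂, hη₂, hlow₂⟩ := LatData.exists_low h'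
  set η := min η₁ η₂
  have hη : 0 < η := lt_min hη₁ hη₂
  have hlow : ∀ c r, (∀ k, 0 ≤ r k) → η * ∑ k, r k ≤ ρ c r := fun c r hr =>
    (mul_le_mul_of_nonneg_right (min_le_left _ _) (Finset.sum_nonneg fun k _ => hr k)).trans
      (hlow₁ c r hr)
  have hlow' : ∀ c r, (∀ k, 0 ≤ r k) → η * ∑ k, r k ≤ ρ' c r := fun c r hr =>
    (mul_le_mul_of_nonneg_right (min_le_right _ _) (Finset.sum_nonneg fun k _ => hr k)).trans
      (hlow₂ c r hr)
  obtain ⟨Λ, _, x, y, s, s', hx, bx, hy, hby, hxy, hs, hs', hs0, hs0', hnx, hny⟩ :=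
    exists_measurable_factor (n := n) (n' := n') h h' hb (fun p => (hW p).meas)
      (fun p => (hW p).bdd) (by
        filter_upwards [hWN] with t ht
        refine mem_closure_convexHull_prodSet fun v r hr => ?_
        have := (ht v).trans (hN _ v r hr)
        simpa only [mul_comm] using this) (η := η ^ 2 / 2) (by positivity)
  choose a ha hai han using fun k => exists_outer_normalizer n hb (x := fun i => x (k, i))
    (fun i c => hx (k, i) c) (fun i c => bx (k, i) c) (η := η ^ 2 / 2) (by positivity)
  choose a' ha' hai' han' using fun k => exists_outer_normalizer n' hb (x := fun i => y (k, i))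
    (fun i c => hy (k, i) c) (fun i c => hby (k, i) c) (η := η ^ 2 / 2) (by positivity)
  have han := ae_all_iff.2 han
  have han' := ae_all_iff.2 han'
  have haw : ∀ᵐ t ∂tm, WBound (ρ (side θ t)) (M + 1) fun k => ‖a k t‖ := by
    filter_upwards [han, hnx] with t h3 h4
    simp only [h3]
    exact wBound_weights hη (hs t) (hs0 t) (hlow _) h4
  have haw' : ∀ᵐ t ∂tm, WBound (ρ' (side θ t)) (M + 1) fun k => ‖a' k t‖ := by
    filter_upwards [han', hny] with t h3 h4
    simp only [h3]
    exact wBound_weights hη (hs' t) (hs0' t) (hlow' _) h4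
  have hane : ∀ᵐ t ∂tm, ∀ k, a k t ≠ 0 := by
    filter_upwards [han] with t h3 k
    rw [← norm_ne_zero_iff, h3]
    exact (Real.sqrt_pos.2 (add_pos_of_nonneg_of_pos
      (Finset.sum_nonneg fun _ _ => sq_nonneg _) (by positivity))).ne'
  have hane' : ∀ᵐ t ∂tm, ∀ k, a' k t ≠ 0 := by
    filter_upwards [han'] with t h3 k
    rw [← norm_ne_zero_iff, h3]
    exact (Real.sqrt_pos.2 (add_pos_of_nonneg_of_pos
      (Finset.sum_nonneg fun _ _ => sq_nonneg _) (by positivity))).ne'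
  let X : P × I → Circ → Λ → ℂ := fun p t c => (a p.1 t)⁻¹ * x p t c
  let Y : Q × I' → Circ → Λ → ℂ := fun p t c => (a' p.1 t)⁻¹ * y p t c
  have eXY : ∀ p p' t, ∑ c, X p t c * Y p' t c = (a p.1 t)⁻¹ * (a' p'.1 t)⁻¹ * W t (p, p') := by
    intro p p' t
    rw [← hxy, Finset.mul_sum]
    exact Finset.sum_congr rfl fun c _ => by simp only [X, Y]; ring
  have hXY : ∀ p p', HInf fun t => ∑ c, X p t c * Y p' t c := by
    intro p p'
    simp only [eXY]
    exact ((hai _).mul (hai' _)).mul (hW _)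
  have iXY : ∀ p p', (∫ t, a p.1 t ∂tm) * (∫ t, a' p'.1 t ∂tm) *
      ∫ t, ∑ c, X p t c * Y p' t c ∂tm = L (Pi.single (p, p') 1) := by
    intro p p'
    rw [← hWL, ← (ha _).integral_mul (ha' _), ← ((ha _).mul (ha' _)).integral_mul (hXY p p')]
    refine integral_congr_ae ?_
    filter_upwards [hane, hane'] with t h3 h4
    rw [eXY]
    have := h3 p.1
    have := h4 p'.1
    field_simp
  let z' : P × I → Q × I' → ℂ := fun p p' =>
    z (p, p') * ((∫ t, a p.1 t ∂tm) * ∫ t, a' p'.1 t ∂tm)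
  let v : (P → I → ℂ) →ₗ[ℂ] (Q → I' → ℂ) →ₗ[ℂ] ℂ :=
    LinearMap.mk₂ ℂ (fun φ ψ => ∑ p, ∑ p', z' p p' * (φ p.1 p.2 * ψ p'.1 p'.2))
      (fun _ _ _ => by simp only [Pi.add_apply, add_mul, mul_add, Finset.sum_add_distrib])
      (fun c _ _ => by
        simp only [Pi.smul_apply, smul_eq_mul, Finset.mul_sum]
        exact Finset.sum_congr rfl fun _ _ => Finset.sum_congr rfl fun _ _ => by ring)
      (fun _ _ _ => by simp only [Pi.add_apply, mul_add, Finset.sum_add_distrib])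
      (fun c _ _ => by
        simp only [Pi.smul_apply, smul_eq_mul, Finset.mul_sum]
        exact Finset.sum_congr rfl fun _ _ => Finset.sum_congr rfl fun _ _ => by ring)
  have hv : ∀ φ ψ, (∀ k, thetaNorm n (side θ) (φ k) ≤ 1) →
      (∀ k, thetaNorm n' (side θ) (ψ k) ≤ 1) → ‖v φ ψ‖ ≤ 4 * (M + 2) ^ 2 * κ := by
    intro φ ψ hφ hψ
    obtain ⟨f, hf, hfw, hfi⟩ := exists_scaled_family n (by positivity) ha haw
      (fun c => (h c).nonneg) hφ
    obtain ⟨g, hg, hgw, hgi⟩ := exists_scaled_family n' (by positivity) ha' haw'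
      (fun c => (h' c).nonneg) hψ
    have e : v φ ψ = ((4 * (M + 2) ^ 2 : ℝ) : ℂ) *
        ∑ p, z p * ((∫ t, f t p.1.1 p.1.2 ∂tm) * ∫ t, g t p.2.1 p.2.2 ∂tm) := by
      rw [Fintype.sum_prod_type, Finset.mul_sum]
      refine Finset.sum_congr rfl fun p _ => ?_
      rw [Finset.mul_sum]
      refine Finset.sum_congr rfl fun p' _ => ?_
      have e1 := hfi p.1 p.2
      have e2 := hgi p'.1 p'.2
      calc z' p p' * (φ p.1 p.2 * ψ p'.1 p'.2) = z (p, p') * (((∫ t, a p.1 t ∂tm) * φ p.1 p.2) *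
            ((∫ t, a' p'.1 t ∂tm) * ψ p'.1 p'.2)) := by simp only [z']; ring
        _ = _ := by rw [← e1, ← e2]; push_cast; ring
    rw [e, norm_mul, Complex.norm_real, Real.norm_of_nonneg (by positivity)]
    exact mul_le_mul_of_nonneg_left (hz f g hf hg hfw hgw) (by positivity)
  have hvz : ∀ φ ψ, v φ ψ = ∑ p, ∑ p', z' p p' * (φ p.1 p.2 * ψ p'.1 p'.2) := fun φ ψ => rfl
  have mX : ∀ p c, AEStronglyMeasurable (fun t => X p t c) tm :=
    fun p c => (hai p.1).meas.mul (hx p c)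
  have mY : ∀ p c, AEStronglyMeasurable (fun t => Y p t c) tm :=
    fun p c => (hai' p.1).meas.mul (hy p c)
  have bX : ∀ p c, ∃ R : ℝ, ∀ᵐ t ∂tm, ‖X p t c‖ ≤ R := fun p c => by
    obtain ⟨R, hR⟩ := (hai p.1).bdd
    obtain ⟨R', hR'⟩ := bx p c
    refine ⟨R * R', ?_⟩
    filter_upwards [hR, hR'] with t h3 h4
    simp only [X, norm_mul]
    exact mul_le_mul h3 h4 (norm_nonneg _) ((norm_nonneg _).trans h3)
  have bY : ∀ p c, ∃ R : ℝ, ∀ᵐ t ∂tm, ‖Y p t c‖ ≤ R := fun p c => by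
    obtain ⟨R, hR⟩ := (hai' p.1).bdd
    obtain ⟨R', hR'⟩ := hby p c
    refine ⟨R * R', ?_⟩
    filter_upwards [hR, hR'] with t h3 h4
    simp only [Y, norm_mul]
    exact mul_le_mul h3 h4 (norm_nonneg _) ((norm_nonneg _).trans h3)
  have nX : ∀ᵐ t ∂tm, ∀ k, ∑ c, n (side θ t) (fun i => X (k, i) t c) ^ 2 ≤ 1 := by
    filter_upwards [han] with t h3 k
    exact sum_normalized_le (n (side θ t)) (x := fun i c => x (k, i) t c) (a := a k t)
      (η := η ^ 2 / 2) (by positivity) (h3 k)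
  have nY : ∀ᵐ t ∂tm, ∀ k, ∑ c, n' (side θ t) (fun i => Y (k, i) t c) ^ 2 ≤ 1 := by
    filter_upwards [han'] with t h3 k
    exact sum_normalized_le (n' (side θ t)) (x := fun i c => y (k, i) t c) (a := a' k t)
      (η := η ^ 2 / 2) (by positivity) (h3 k)
  have main := factor_bound n n' hb h1 hT hT' v hv X Y mX bX mY bY hXY nX nY hvz
  have e : L z = ∑ p, ∑ p', z' p p' * ∫ t, ∑ c, X p t c * Y p' t c ∂tm := by
    have hzs : z = ∑ p, z p • (Pi.single p 1 : (P × I) × (Q × I') → ℂ) := by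
      ext q
      simp [Finset.sum_apply, Pi.single_apply]
    conv_lhs => rw [hzs, map_sum, Fintype.sum_prod_type]
    refine Finset.sum_congr rfl fun p _ => Finset.sum_congr rfl fun p' _ => ?_
    rw [map_smul, ← iXY p p', smul_eq_mul]
    simp only [z']
    ring
  rw [e]
  refine main.trans (le_of_eq ?_)
  ring

end FiniteDimensional

section InterpolationSeminorm

variable {D : Type*} [AddCommGroup D] [Module ℂ D]

theorem exists_of_interpN_lt {θ : ℝ} {N₀ N₁ : D → ℝ} {x : D} {c : ℝ}
    (h : interpN θ N₀ N₁ x < c) : ∃ (m : ℕ) (φ : Fin m → ℂ → ℂ) (v : Fin m → D),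
    (∀ i, ContinuousOn (φ i) Strip) ∧ (∀ i, DifferentiableOn ℂ (φ i) OStrip) ∧
    (∀ i, ∃ B : ℝ, ∀ z ∈ Strip, ‖φ i z‖ ≤ B) ∧ (∑ i, φ i (θ : ℂ) • v i) = x ∧
    (∀ t : ℝ, N₀ (∑ i, φ i (Complex.I * t) • v i) ≤ c) ∧
    (∀ t : ℝ, N₁ (∑ i, φ i (1 + Complex.I * t) • v i) ≤ c) := by
  have hne : {c : ℝ | ∃ (m : ℕ) (φ : Fin m → ℂ → ℂ) (v : Fin m → D),
    (∀ i, ContinuousOn (φ i) Strip) ∧ (∀ i, DifferentiableOn ℂ (φ i) OStrip) ∧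
    (∀ i, ∃ B : ℝ, ∀ z ∈ Strip, ‖φ i z‖ ≤ B) ∧ (∑ i, φ i (θ : ℂ) • v i) = x ∧
    (∀ t : ℝ, N₀ (∑ i, φ i (Complex.I * t) • v i) ≤ c) ∧
    (∀ t : ℝ, N₁ (∑ i, φ i (1 + Complex.I * t) • v i) ≤ c)}.Nonempty :=
    ⟨max (N₀ x) (N₁ x), 1, fun _ _ => 1, fun _ => x, fun _ => continuousOn_const,
      fun _ => differentiableOn_const _, fun _ => ⟨1, fun _ _ => by simp⟩, by simp, by simp,
      by simp⟩
  obtain ⟨d, ⟨m, φ, v, h1, h2, h3, h4, h5, h6⟩, hd⟩ := exists_lt_of_csInf_lt hne h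
  exact ⟨m, φ, v, h1, h2, h3, h4, fun t => (h5 t).trans hd.le, fun t => (h6 t).trans hd.le⟩

theorem interpN_nonneg {θ : ℝ} {N₀ N₁ : D → ℝ} (hN : ∀ x, 0 ≤ N₀ x) (x : D) :
    0 ≤ interpN θ N₀ N₁ x := by
  refine Real.sInf_nonneg ?_
  rintro c ⟨m, φ, v, -, -, -, -, h, -⟩
  exact (hN _).trans (h 0)

theorem interpN_le_max {θ : ℝ} {N₀ N₁ : D → ℝ} (hN : ∀ x, 0 ≤ N₀ x) (x : D) :
    interpN θ N₀ N₁ x ≤ max (N₀ x) (N₁ x) :=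
  interpN_le hN (ι := Unit) (fun _ _ => 1) (fun _ => x) (fun _ => continuousOn_const)
    (fun _ => differentiableOn_const _) (fun _ => ⟨1, fun _ _ => by simp⟩) (by simp) (by simp)
    (by simp)

theorem interpN_map_le {D' : Type*} [AddCommGroup D'] [Module ℂ D'] {θ : ℝ} {N₀ N₁ : D → ℝ}
    (hN : ∀ x, 0 ≤ N₀ x) (J : D' →ₗ[ℂ] D) (x : D') :
    interpN θ N₀ N₁ (J x) ≤ interpN θ (fun y => N₀ (J y)) (fun y => N₁ (J y)) x := by
  refine le_of_forall_gt_imp_ge_of_dense fun c hc => ?_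
  obtain ⟨m, φ, v, h1, h2, h3, h4, h5, h6⟩ := exists_of_interpN_lt hc
  exact interpN_le hN φ (fun i => J (v i)) h1 h2 h3 (by simp [← h4])
    (fun t => by simpa using h5 t) (fun t => by simpa using h6 t)

/-- The interpolation functional of two seminorms, as a seminorm. -/
def interpSeminorm (θ : ℝ) (N₀ N₁ : Seminorm ℂ D) : Seminorm ℂ D :=
  Seminorm.ofSMulLE (interpN θ N₀ N₁)
    (le_antisymm ((interpN_le_max (fun _ => apply_nonneg _ _) 0).trans (by simp))
      (interpN_nonneg (fun _ => apply_nonneg _ _) 0))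
    (fun x y => by
      refine le_of_forall_pos_le_add fun ε hε => ?_
      obtain ⟨m, φ, v, h1, h2, h3, h4, h5, h6⟩ := exists_of_interpN_lt
        (lt_add_of_pos_right (interpN θ N₀ N₁ x) (half_pos hε))
      obtain ⟨m', φ', v', h1', h2', h3', h4', h5', h6'⟩ := exists_of_interpN_lt
        (lt_add_of_pos_right (interpN θ N₀ N₁ y) (half_pos hε))
      refine interpN_le (fun _ => apply_nonneg _ _) (ι := Fin m ⊕ Fin m') (Sum.elim φ φ')
        (Sum.elim v v') (by rintro (i | i); exacts [h1 i, h1' i])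
        (by rintro (i | i); exacts [h2 i, h2' i]) (by rintro (i | i); exacts [h3 i, h3' i])
        (by simp [h4, h4']) (fun t => ?_) (fun t => ?_)
      · simp only [Fintype.sum_sum_type, Sum.elim_inl, Sum.elim_inr]
        have := h5 t
        have := h5' t
        exact (map_add_le_add _ _ _).trans (by linarith)
      · simp only [Fintype.sum_sum_type, Sum.elim_inl, Sum.elim_inr]
        have := h6 t
        have := h6' t
        exact (map_add_le_add _ _ _).trans (by linarith))
    (fun a x => by
      refine le_of_forall_pos_le_add fun ε hε => ?_
      have ha : (0 : ℝ) < ‖a‖ + 1 := by positivity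
      obtain ⟨m, φ, v, h1, h2, h3, h4, h5, h6⟩ := exists_of_interpN_lt
        (lt_add_of_pos_right (interpN θ N₀ N₁ x) (div_pos hε ha))
      have key : ‖a‖ * (interpN θ N₀ N₁ x + ε / (‖a‖ + 1)) ≤ ‖a‖ * interpN θ N₀ N₁ x + ε := by
        rw [mul_add]
        gcongr
        rw [mul_div_assoc', div_le_iff₀ ha]
        nlinarith
      have e : ∀ z, ∑ i, φ i z • a • v i = a • ∑ i, φ i z • v i := fun z => by
        rw [Finset.smul_sum]
        exact Finset.sum_congr rfl fun i _ => smul_comm _ _ _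
      refine interpN_le (fun _ => apply_nonneg _ _) φ (fun i => a • v i) h1 h2 h3
        (by rw [e, h4]) (fun t => ?_) (fun t => ?_)
      · rw [e, map_smul_eq_mul]
        exact (mul_le_mul_of_nonneg_left (h5 t) (norm_nonneg a)).trans key
      · rw [e, map_smul_eq_mul]
        exact (mul_le_mul_of_nonneg_left (h6 t) (norm_nonneg a)).trans key)

end InterpolationSeminorm

section InjectiveSeminorm

variable {V W : Type*} [AddCommGroup V] [Module ℂ V] [AddCommGroup W] [Module ℂ W]

/-- The functional on the tensor product induced by two functionals. -/
def tensorFun (φ : V →ₗ[ℂ] ℂ) (ψ : W →ₗ[ℂ] ℂ) : TensorProduct ℂ V W →ₗ[ℂ] ℂ :=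
  TensorProduct.lift (((LinearMap.mul ℂ ℂ).comp φ).compl₂ ψ)

@[simp] theorem tensorFun_tmul (φ : V →ₗ[ℂ] ℂ) (ψ : W →ₗ[ℂ] ℂ) (x : V) (y : W) :
    tensorFun φ ψ (x ⊗ₜ[ℂ] y) = φ x * ψ y := by simp [tensorFun]

variable {NV : V → ℝ} {NW : W → ℝ}

theorem injN_exists_bound (NV : V → ℝ) (NW : W → ℝ) (z : TensorProduct ℂ V W) : ∃ B : ℝ,
    ∀ (φ : V →ₗ[ℂ] ℂ) (ψ : W →ₗ[ℂ] ℂ), (∀ x, ‖φ x‖ ≤ NV x) → (∀ y, ‖ψ y‖ ≤ NW y) →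
      ‖tensorFun φ ψ z‖ ≤ B := by
  induction z with
  | zero => exact ⟨0, fun φ ψ _ _ => by simp⟩
  | tmul x y =>
    refine ⟨NV x * NW y, fun φ ψ h h' => ?_⟩
    rw [tensorFun_tmul, norm_mul]
    exact mul_le_mul (h x) (h' y) (norm_nonneg _) ((norm_nonneg _).trans (h x))
  | add a b ha hb =>
    obtain ⟨A, hA⟩ := ha
    obtain ⟨B, hB⟩ := hb
    refine ⟨A + B, fun φ ψ h h' => ?_⟩
    rw [map_add]
    exact (norm_add_le _ _).trans (add_le_add (hA φ ψ h h') (hB φ ψ h h'))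

theorem le_injN (z : TensorProduct ℂ V W) {φ : V →ₗ[ℂ] ℂ} {ψ : W →ₗ[ℂ] ℂ}
    (h : ∀ x, ‖φ x‖ ≤ NV x) (h' : ∀ y, ‖ψ y‖ ≤ NW y) : ‖tensorFun φ ψ z‖ ≤ injN NV NW z := by
  obtain ⟨B, hB⟩ := injN_exists_bound NV NW z
  refine le_csSup ⟨B, ?_⟩ ⟨φ, ψ, h, h', rfl⟩
  rintro _ ⟨φ, ψ, h, h', rfl⟩
  exact hB φ ψ h h'

theorem injN_le {z : TensorProduct ℂ V W} {c : ℝ} (hc : 0 ≤ c)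
    (h : ∀ (φ : V →ₗ[ℂ] ℂ) (ψ : W →ₗ[ℂ] ℂ), (∀ x, ‖φ x‖ ≤ NV x) → (∀ y, ‖ψ y‖ ≤ NW y) →
      ‖tensorFun φ ψ z‖ ≤ c) : injN NV NW z ≤ c := by
  refine Real.sSup_le ?_ hc
  rintro _ ⟨φ, ψ, h1, h2, rfl⟩
  exact h φ ψ h1 h2

theorem injN_nonneg (z : TensorProduct ℂ V W) : 0 ≤ injN NV NW z := by
  refine Real.sSup_nonneg ?_
  rintro _ ⟨φ, ψ, h1, h2, rfl⟩
  exact norm_nonneg _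

/-- The injective tensor norm as a seminorm. -/
def injSeminorm (NV : V → ℝ) (NW : W → ℝ) : Seminorm ℂ (TensorProduct ℂ V W) :=
  Seminorm.ofSMulLE (injN NV NW)
    (le_antisymm (injN_le le_rfl fun φ ψ _ _ => by simp) (injN_nonneg 0))
    (fun x y => injN_le (add_nonneg (injN_nonneg _) (injN_nonneg _)) fun φ ψ h h' => by
      rw [map_add]
      exact (norm_add_le _ _).trans (add_le_add (le_injN _ h h') (le_injN _ h h')))
    (fun a x => injN_le (mul_nonneg (norm_nonneg _) (injN_nonneg _)) fun φ ψ h h' => by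
      rw [map_smul, norm_smul]
      exact mul_le_mul_of_nonneg_left (le_injN _ h h') (norm_nonneg _))

theorem coe_injSeminorm (NV : V → ℝ) (NW : W → ℝ) : ⇑(injSeminorm NV NW) = injN NV NW := rfl

theorem injSeminorm_tmul_le (NV : Seminorm ℂ V) (NW : Seminorm ℂ W) (x : V) (y : W) :
    injSeminorm NV NW (x ⊗ₜ[ℂ] y) ≤ NV x * NW y := by
  rw [coe_injSeminorm]
  refine injN_le (mul_nonneg (apply_nonneg _ _) (apply_nonneg _ _)) fun φ ψ h h' => ?_
  rw [tensorFun_tmul, norm_mul]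
  exact mul_le_mul (h x) (h' y) (norm_nonneg _) (apply_nonneg _ _)

end InjectiveSeminorm

section TensorLower

variable {V W : Type*} [AddCommGroup V] [Module ℂ V] [AddCommGroup W] [Module ℂ W]

theorem exists_tensor_sum (z : TensorProduct ℂ V W) : ∃ (r : ℕ) (s : Fin r → V) (t : Fin r → W),
    z = ∑ j, s j ⊗ₜ[ℂ] t j := by
  induction z with
  | zero => exact ⟨0, Fin.elim0, Fin.elim0, by simp⟩
  | tmul x y => exact ⟨1, fun _ => x, fun _ => y, by simp⟩
  | add a b ha hb =>
    obtain ⟨r, s, t, rfl⟩ := ha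
    obtain ⟨r', s', t', rfl⟩ := hb
    refine ⟨r + r', Fin.append s s', Fin.append t t', ?_⟩
    rw [Fin.sum_univ_add]
    simp

theorem exists_analytic_functional {θ : ℝ} (h0 : 0 < θ) (h1 : θ < 1) (N : Bool → Seminorm ℂ V)
    {f : V →ₗ[ℂ] ℂ} (hf : ∀ x, ‖f x‖ ≤ interpN θ (N true) (N false) x) {A : Type*} [Fintype A]
    (s : A → V) : ∃ φ : Circ → A → ℂ, (∀ a, HInf fun t => φ t a) ∧
      (∀ a, ∫ t, φ t a ∂tm = f (s a)) ∧ ∀ᵐ t ∂tm, ∃ l : V →ₗ[ℂ] ℂ, (∀ a, l (s a) = φ t a) ∧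
        ∀ x, ‖l x‖ ≤ N (side θ t) x := by
  classical
  let J : (A → ℂ) →ₗ[ℂ] V := Fintype.linearCombination ℂ s
  have hJ : ∀ a, J (Pi.single a 1) = s a := fun a => by
    simp [J, Fintype.linearCombination_apply_single]
  obtain ⟨φ, h2, h3, h4⟩ := exists_analytic_dual h0 h1 (fun c => (N c).comp J) (f.comp J)
    fun x => (hf (J x)).trans (interpN_map_le (fun _ => apply_nonneg _ _) J x)
  refine ⟨φ, h2, fun a => by rw [h3, LinearMap.comp_apply, hJ], ?_⟩
  filter_upwards [h4] with t ht
  obtain ⟨l, h5, h6⟩ := exists_dominated_extension J (Fintype.linearCombination ℂ (φ t)) (N (side θ t))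
    fun x => by
      refine le_of_eq_of_le ?_ (ht x)
      simp only [Fintype.linearCombination_apply, smul_eq_mul, mul_comm]
  refine ⟨l, fun a => ?_, h6⟩
  rw [← hJ, h5, Fintype.linearCombination_apply_single, one_smul]

theorem injN_interpN_le {θ : ℝ} (h0 : 0 < θ) (h1 : θ < 1) (N : Bool → Seminorm ℂ V)
    (N' : Bool → Seminorm ℂ W) (z : TensorProduct ℂ V W) :
    injN (interpN θ (N true) (N false)) (interpN θ (N' true) (N' false)) z ≤
      interpN θ (injN (N true) (N' true)) (injN (N false) (N' false)) z := by
  refine injN_le (interpN_nonneg (fun _ => injN_nonneg _) _) fun f g hf hg => ?_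
  refine le_of_forall_gt_imp_ge_of_dense fun c hc => ?_
  obtain ⟨m, φ, v, c1, c2, c3, c4, c5, c6⟩ := exists_of_interpN_lt hc
  choose r s t hv using fun i => exists_tensor_sum (v i)
  obtain ⟨α, hα, iα, nα⟩ := exists_analytic_functional h0 h1 N hf
    (A := Σ i, Fin (r i)) fun a => s a.1 a.2
  obtain ⟨β, hβ, iβ, nβ⟩ := exists_analytic_functional h0 h1 N' hg
    (A := Σ i, Fin (r i)) fun a => t a.1 a.2
  obtain ⟨Z, hZ, iZ⟩ := exists_bdryMap h0 h1
  let H : Circ → ℂ := fun τ => ∑ i, φ i (Z τ) * ∑ j, α τ ⟨i, j⟩ * β τ ⟨i, j⟩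
  have hs : ∀ i, HInf fun τ => ∑ j, α τ ⟨i, j⟩ * β τ ⟨i, j⟩ := fun i =>
    HInf.sum _ fun j _ => (hα _).mul (hβ _)
  have hi : ∀ i, HInf fun τ => φ i (Z τ) * ∑ j, α τ ⟨i, j⟩ * β τ ⟨i, j⟩ := fun i =>
    (iZ _ (c1 i) (c2 i) (c3 i)).1.mul (hs i)
  have iH : ∫ τ, H τ ∂tm = tensorFun f g z := by
    simp only [H]
    rw [integral_finsetSum _ fun i _ => (hi i).integrable, ← c4, map_sum]
    refine Finset.sum_congr rfl fun i _ => ?_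
    have h := iZ _ (c1 i) (c2 i) (c3 i)
    rw [h.1.integral_mul (hs i), h.2, integral_finsetSum _ fun j _ => ((hα _).mul (hβ _)).integrable,
      map_smul, smul_eq_mul]
    conv_rhs => rw [hv i, map_sum]
    congr 1
    refine Finset.sum_congr rfl fun j _ => ?_
    rw [(hα _).integral_mul (hβ _), iα, iβ, tensorFun_tmul]
  have nH : ∀ᵐ τ ∂tm, ‖H τ‖ ≤ c := by
    filter_upwards [hZ, nα, nβ] with τ h2 ⟨l, h3, h4⟩ ⟨l', h3', h4'⟩
    have e : H τ = tensorFun l l' (∑ i, φ i (Z τ) • v i) := by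
      rw [map_sum]
      refine Finset.sum_congr rfl fun i _ => ?_
      rw [map_smul, smul_eq_mul]
      conv_rhs => rw [hv i, map_sum]
      congr 1
      refine Finset.sum_congr rfl fun j _ => ?_
      rw [tensorFun_tmul, ← h3, ← h3']
    rw [e]
    refine (le_injN _ h4 h4').trans ?_
    cases hside : side θ τ with
    | true =>
      obtain ⟨u, hu⟩ := h2.1 hside
      rw [hu]
      exact c5 u
    | false =>
      obtain ⟨u, hu⟩ := h2.2 hside
      rw [hu]
      exact c6 u
  rw [← iH]
  simpa using norm_integral_le_of_norm_le_const nH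

end TensorLower

section TensorUpper

variable {V W : Type*} [AddCommGroup V] [Module ℂ V] [AddCommGroup W] [Module ℂ W]

/-- Finitely many vectors of the couple `N` are, up to null vectors, described by coordinates for
which dual balls are weighted sums of type 2 norms over a 2-concave lattice. -/
def HasCoord (N : Bool → Seminorm ℂ V) (T M : ℝ) (S : Finset V) : Prop :=
  ∃ (P I : Type) (_ : Fintype P) (_ : Fintype I) (J : (P × I → ℂ) →ₗ[ℂ] V)
    (n : Bool → Seminorm ℂ (I → ℂ)) (ρ : Bool → (P → ℝ) → ℝ),
    (∀ c, TypeTwo (n c) T) ∧ (∀ c, LatData (ρ c) M) ∧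
    (∀ c (φ : P → I → ℂ), (∀ v, ‖∑ p, φ p.1 p.2 * v p‖ ≤ N c (J v)) ↔
      WBound (ρ c) 1 fun k => n c (φ k)) ∧
    ∀ s ∈ S, ∃ v, ∀ c, N c (s - J v) = 0

/-- Functionals controlled on the analytic functions with coefficients in `S`. -/
def ControlledOn (θ : ℝ) (N : Bool → Seminorm ℂ V) (S : Set V) (l : V →ₗ[ℂ] ℂ) : Prop :=
  (∀ x, ‖l x‖ ≤ (N true ⊔ N false) x) ∧
  ∀ (m : ℕ) (φ : Fin m → ℂ → ℂ) (v : Fin m → V) (c : ℝ),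
    (∀ i, ContinuousOn (φ i) Strip) → (∀ i, DifferentiableOn ℂ (φ i) OStrip) →
    (∀ i, ∃ B : ℝ, ∀ z ∈ Strip, ‖φ i z‖ ≤ B) → (∀ i, v i ∈ S) →
    (∀ t : ℝ, N true (∑ i, φ i (Complex.I * t) • v i) ≤ c) →
    (∀ t : ℝ, N false (∑ i, φ i (1 + Complex.I * t) • v i) ≤ c) →
    ‖l (∑ i, φ i (θ : ℂ) • v i)‖ ≤ c

theorem ControlledOn.mono {θ : ℝ} {N : Bool → Seminorm ℂ V} {S S' : Set V} {l : V →ₗ[ℂ] ℂ}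
    (h : ControlledOn θ N S l) (hS : S' ⊆ S) : ControlledOn θ N S' l :=
  ⟨h.1, fun m φ v c h1 h2 h3 h4 => h.2 m φ v c h1 h2 h3 fun i => hS (h4 i)⟩

theorem exists_limit_functional {ι : Type*} (U : Ultrafilter ι) (l : ι → V →ₗ[ℂ] ℂ) (p : V → ℝ)
    (h : ∀ i x, ‖l i x‖ ≤ p x) :
    ∃ f : V →ₗ[ℂ] ℂ, ∀ x, Filter.Tendsto (fun i => l i x) U (nhds (f x)) := by
  have h1 : ∀ x, ∃ a, Filter.Tendsto (fun i => l i x) U (nhds a) := fun x => by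
    obtain ⟨a, -, ha⟩ := (isCompact_closedBall (0 : ℂ) (p x)).ultrafilter_le_nhds
      (U.map fun i => l i x) (by
        rw [Ultrafilter.coe_map, Filter.le_principal_iff, Filter.mem_map]
        exact Filter.Eventually.of_forall fun i => by simpa using h i x)
    exact ⟨a, ha⟩
  choose f hf using h1
  refine ⟨⟨⟨f, fun x y => ?_⟩, fun a x => ?_⟩, hf⟩
  · refine tendsto_nhds_unique (hf (x + y)) ?_
    simpa only [map_add] using (hf x).add (hf y)
  · refine tendsto_nhds_unique (hf (a • x)) ?_
    simpa only [map_smul, RingHom.id_apply] using (hf x).const_smul a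

theorem controlled_limit {ι : Type*} (U : Ultrafilter ι) {θ : ℝ} {N : Bool → Seminorm ℂ V}
    {l : ι → V →ₗ[ℂ] ℂ} {S : ι → Finset V} (hl : ∀ i, ControlledOn θ N (S i) (l i))
    (hS : ∀ x, ∀ᶠ i in (U : Filter ι), x ∈ S i) {f : V →ₗ[ℂ] ℂ}
    (hf : ∀ x, Filter.Tendsto (fun i => l i x) U (nhds (f x))) (x : V) :
    ‖f x‖ ≤ interpN θ (N true) (N false) x := by
  refine le_of_forall_gt_imp_ge_of_dense fun c hc => ?_
  obtain ⟨m, φ, v, h1, h2, h3, rfl, h5, h6⟩ := exists_of_interpN_lt hc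
  refine le_of_tendsto (hf _).norm ?_
  filter_upwards [Filter.eventually_all.2 fun i => hS (v i)] with i hi
  exact (hl i).2 m φ v c h1 h2 h3 hi h5 h6

theorem seminorm_sum_smul_congr (N : Seminorm ℂ V) {ι : Type*} (s : Finset ι) (a : ι → ℂ)
    {v w : ι → V} (h : ∀ i, N (v i - w i) = 0) : N (∑ i ∈ s, a i • w i) ≤ N (∑ i ∈ s, a i • v i) := by
  have h1 : N (∑ i ∈ s, a i • (v i - w i)) = 0 := by
    refine Finset.sum_induction _ (fun x => N x = 0) (fun x y hx hy => ?_) (map_zero N) fun i _ => ?_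
    · exact le_antisymm ((map_add_le_add N x y).trans (by rw [hx, hy, add_zero])) (apply_nonneg _ _)
    · rw [map_smul_eq_mul, h, mul_zero]
  have h2 : ∑ i ∈ s, a i • w i = ∑ i ∈ s, a i • v i - ∑ i ∈ s, a i • (v i - w i) := by
    simp [smul_sub]
  rw [h2]
  exact (map_sub_le_add N _ _).trans (by rw [h1, add_zero])

theorem exists_controlled {θ : ℝ} (h0 : 0 < θ) (h1 : θ < 1) {N : Bool → Seminorm ℂ V} {S : Set V}
    {A : Type*} [Fintype A] (J : (A → ℂ) →ₗ[ℂ] V) (hS : ∀ s ∈ S, ∃ v, ∀ c, N c (s - J v) = 0)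
    {φ : Circ → A → ℂ} (hφ : ∀ a, HInf fun t => φ t a)
    (hn : ∀ᵐ t ∂tm, ∀ v, ‖∑ a, φ t a * v a‖ ≤ N (side θ t) (J v)) :
    ∃ l : V →ₗ[ℂ] ℂ, ControlledOn θ N S l ∧ ∀ v, l (J v) = ∑ a, (∫ t, φ t a ∂tm) * v a := by
  obtain ⟨Z, hZ, iZ⟩ := exists_bdryMap h0 h1
  have key : ∀ (m : ℕ) (g : Fin m → ℂ → ℂ) (v : Fin m → A → ℂ) (c : ℝ),
    (∀ i, ContinuousOn (g i) Strip) → (∀ i, DifferentiableOn ℂ (g i) OStrip) →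
    (∀ i, ∃ B : ℝ, ∀ z ∈ Strip, ‖g i z‖ ≤ B) →
    (∀ t : ℝ, N true (∑ i, g i (Complex.I * t) • J (v i)) ≤ c) →
    (∀ t : ℝ, N false (∑ i, g i (1 + Complex.I * t) • J (v i)) ≤ c) →
    ‖∑ i, g i θ * ∑ a, (∫ t, φ t a ∂tm) * v i a‖ ≤ c := by
    intro m g v c c1 c2 c3 c5 c6
    have hs : ∀ i, HInf fun t => ∑ a, φ t a * v i a := fun i =>
      HInf.sum _ fun a _ => (hφ a).mul (HInf.const _)
    have hi : ∀ i, HInf fun t => g i (Z t) * ∑ a, φ t a * v i a := fun i =>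
      (iZ _ (c1 i) (c2 i) (c3 i)).1.mul (hs i)
    have e : ∑ i, g i θ * ∑ a, (∫ t, φ t a ∂tm) * v i a =
        ∫ t, ∑ i, g i (Z t) * ∑ a, φ t a * v i a ∂tm := by
      rw [integral_finsetSum _ fun i _ => (hi i).integrable]
      refine Finset.sum_congr rfl fun i _ => ?_
      have h := iZ _ (c1 i) (c2 i) (c3 i)
      rw [h.1.integral_mul (hs i), h.2, integral_finsetSum _ fun a _ =>
        ((hφ a).mul (HInf.const _)).integrable]
      simp only [integral_mul_const]
    have nH : ∀ᵐ t ∂tm, ‖∑ i, g i (Z t) * ∑ a, φ t a * v i a‖ ≤ c := by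
      filter_upwards [hZ, hn] with t h2 h3
      have e : ∑ i, g i (Z t) * ∑ a, φ t a * v i a =
          ∑ a, φ t a * (∑ i, g i (Z t) • v i) a := by
        simp only [Finset.sum_apply, Pi.smul_apply, smul_eq_mul, Finset.mul_sum]
        rw [Finset.sum_comm]
        exact Finset.sum_congr rfl fun _ _ => Finset.sum_congr rfl fun _ _ => by ring
      rw [e]
      refine (h3 _).trans ?_
      rw [map_sum]
      simp only [map_smul]
      cases hside : side θ t with
      | true =>
        obtain ⟨u, hu⟩ := h2.1 hside
        rw [hu]
        exact c5 u
      | false =>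
        obtain ⟨u, hu⟩ := h2.2 hside
        rw [hu]
        exact c6 u
    rw [e]
    simpa using norm_integral_le_of_norm_le_const nH
  obtain ⟨l, h2, h3⟩ := exists_dominated_extension J
    (Fintype.linearCombination ℂ fun a => ∫ t, φ t a ∂tm) (N true ⊔ N false) fun x => by
      have h := key 1 (fun _ _ => 1) (fun _ => x) ((N true ⊔ N false) (J x))
        (fun _ => continuousOn_const) (fun _ => differentiableOn_const _)
        (fun _ => ⟨1, fun _ _ => by simp⟩) (by simp) (by simp)
      simpa [Fintype.linearCombination_apply, mul_comm] using h
  have hJ : ∀ v, l (J v) = ∑ a, (∫ t, φ t a ∂tm) * v a := fun v => by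
    rw [h2, Fintype.linearCombination_apply]
    simp only [smul_eq_mul, mul_comm]
  refine ⟨l, ⟨h3, fun m g v c c1 c2 c3 c4 c5 c6 => ?_⟩, hJ⟩
  choose w hw using fun i => hS (v i) (c4 i)
  have e : ∀ i, l (v i) = l (J (w i)) := fun i => by
    rw [← sub_eq_zero, ← map_sub, ← norm_le_zero_iff]
    refine (h3 _).trans ?_
    simp [hw]
  have h := key m g w c c1 c2 c3
    (fun t => (seminorm_sum_smul_congr _ _ _ fun i => hw i true).trans (c5 t))
    (fun t => (seminorm_sum_smul_congr _ _ _ fun i => hw i false).trans (c6 t))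
  simpa only [map_sum, map_smul, e, smul_eq_mul, hJ] using h

end TensorUpper

section TensorUpperMain

variable {V W : Type*} [AddCommGroup V] [Module ℂ V] [AddCommGroup W] [Module ℂ W]

theorem injSeminorm_tmul_sub_eq_zero {N : Seminorm ℂ V} {N' : Seminorm ℂ W} {x x' : V} {y y' : W}
    (h : N (x - x') = 0) (h' : N' (y - y') = 0) :
    injSeminorm N N' (x ⊗ₜ[ℂ] y - x' ⊗ₜ[ℂ] y') = 0 := by
  have e : x ⊗ₜ[ℂ] y - x' ⊗ₜ[ℂ] y' = (x - x') ⊗ₜ[ℂ] y + x' ⊗ₜ[ℂ] (y - y') := by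
    rw [TensorProduct.sub_tmul, TensorProduct.tmul_sub]
    abel
  refine le_antisymm ?_ (apply_nonneg _ _)
  rw [e]
  refine (map_add_le_add _ _ _).trans ?_
  refine (add_le_add (injSeminorm_tmul_le _ _ _ _) (injSeminorm_tmul_le _ _ _ _)).trans ?_
  rw [h, h', zero_mul, mul_zero, add_zero]

section Coordinates

variable {A B : Type*} [Fintype A] [Fintype B] [DecidableEq A] [DecidableEq B]

/-- The tensor product of two coordinate maps. -/
def coordTensor (J : (A → ℂ) →ₗ[ℂ] V) (J' : (B → ℂ) →ₗ[ℂ] W) :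
    (A × B → ℂ) →ₗ[ℂ] TensorProduct ℂ V W :=
  Fintype.linearCombination ℂ fun p => J (Pi.single p.1 1) ⊗ₜ[ℂ] J' (Pi.single p.2 1)

theorem coord_eq_sum (J : (A → ℂ) →ₗ[ℂ] V) (c : A → ℂ) : J c = ∑ a, c a • J (Pi.single a 1) := by
  have : c = ∑ a, c a • (Pi.single a 1 : A → ℂ) := by
    ext b
    simp [Finset.sum_apply, Pi.single_apply]
  conv_lhs => rw [this]
  simp only [map_sum, map_smul]

theorem coordTensor_mul (J : (A → ℂ) →ₗ[ℂ] V) (J' : (B → ℂ) →ₗ[ℂ] W) (c : A → ℂ) (d : B → ℂ) :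
    coordTensor J J' (fun p => c p.1 * d p.2) = J c ⊗ₜ[ℂ] J' d := by
  rw [coord_eq_sum J c, coord_eq_sum J' d, TensorProduct.sum_tmul, coordTensor,
    Fintype.linearCombination_apply, Fintype.sum_prod_type]
  refine Finset.sum_congr rfl fun a _ => ?_
  rw [TensorProduct.tmul_sum]
  refine Finset.sum_congr rfl fun b _ => ?_
  rw [TensorProduct.smul_tmul_smul]

theorem tensorFun_coordTensor (J : (A → ℂ) →ₗ[ℂ] V) (J' : (B → ℂ) →ₗ[ℂ] W) (f : V →ₗ[ℂ] ℂ)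
    (g : W →ₗ[ℂ] ℂ) (v : A × B → ℂ) : tensorFun f g (coordTensor J J' v) =
      ∑ p, v p * (f (J (Pi.single p.1 1)) * g (J' (Pi.single p.2 1))) := by
  simp [coordTensor, Fintype.linearCombination_apply, map_sum]

end Coordinates

theorem exists_controlled_pair {θ : ℝ} (h0 : 0 < θ) (hθ1 : θ < 1) {N : Bool → Seminorm ℂ V}
    {N' : Bool → Seminorm ℂ W} {T M κ : ℝ} (h1 : 0 < T) {S : Finset V} {S' : Finset W}
    (hS : HasCoord N T M S) (hS' : HasCoord N' T M S')
    {Λ : TensorProduct ℂ V W →ₗ[ℂ] ℂ} (hΛ : ∀ y, ‖Λ y‖ ≤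
      interpN θ (injSeminorm (N true) (N' true)) (injSeminorm (N false) (N' false)) y)
    {r : ℕ} {s : Fin r → V} {t : Fin r → W} (hs : ∀ j, s j ∈ S) (ht : ∀ j, t j ∈ S')
    (hκ : 1024 * T ^ 4 * (3 + T ^ 4) * (M + 2) ^ 2 * κ < ‖Λ (∑ j, s j ⊗ₜ[ℂ] t j)‖) :
    ∃ l l', ControlledOn θ N S l ∧ ControlledOn θ N' S' l' ∧ κ ≤ ‖∑ j, l (s j) * l' (t j)‖ := by
  classical
  obtain ⟨P, I, _, _, J, n, ρ, hT, hρ, hJ, hSJ⟩ := hS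
  obtain ⟨Q, I', _, _, J', n', ρ', hT', hρ', hJ', hSJ'⟩ := hS'
  let K := coordTensor J J'
  choose c hc using fun j => hSJ (s j) (hs j)
  choose d hd using fun j => hSJ' (t j) (ht j)
  let z : (P × I) × (Q × I') → ℂ := fun p => ∑ j, c j p.1 * d j p.2
  have hz : K z = ∑ j, J (c j) ⊗ₜ[ℂ] J' (d j) := by
    have : z = ∑ j, fun p => c j p.1 * d j p.2 := by
      ext p
      simp [z]
    rw [this, map_sum]
    exact Finset.sum_congr rfl fun j _ => coordTensor_mul _ _ _ _
  have hdiff : Λ (∑ j, s j ⊗ₜ[ℂ] t j) = Λ (K z) := by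
    rw [hz, ← sub_eq_zero, ← map_sub, ← Finset.sum_sub_distrib, map_sum]
    refine Finset.sum_eq_zero fun j _ => ?_
    rw [← norm_le_zero_iff]
    refine (hΛ _).trans ((interpN_le_max (fun _ => apply_nonneg _ _) _).trans ?_)
    rw [injSeminorm_tmul_sub_eq_zero (hc j true) (hd j true),
      injSeminorm_tmul_sub_eq_zero (hc j false) (hd j false), max_self]
  by_contra! hcon
  refine absurd hκ (not_lt.2 ?_)
  rw [hdiff]
  refine fd_bound h0 hθ1 h1 hT hT' hρ hρ' (fun b => (injSeminorm (N b) (N' b)).comp K)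
    (fun b v R hR => ?_) (Λ.comp K)
    (fun v => (hΛ (K v)).trans (interpN_map_le (fun _ => apply_nonneg _ _) K v)) z
    (fun φ ψ hφ hψ wφ wψ => ?_)
  · refine injN_le ((norm_nonneg _).trans (hR 0 ?_)) fun f g hf hg => ?_
    · refine ⟨0, 0, ?_, ?_, ?_⟩
      · exact (hJ b 0).1 fun v => by simp
      · exact (hJ' b 0).1 fun v => by simp
      · ext p
        simp
    · rw [tensorFun_coordTensor]
      refine hR _ ⟨fun k i => f (J (Pi.single (k, i) 1)), fun k i => g (J' (Pi.single (k, i) 1)),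
        (hJ b _).1 fun v => ?_, (hJ' b _).1 fun v => ?_, rfl⟩
      · refine le_of_eq_of_le ?_ (hf (J v))
        rw [coord_eq_sum J v]
        simp [map_sum, mul_comm]
      · refine le_of_eq_of_le ?_ (hg (J' v))
        rw [coord_eq_sum J' v]
        simp [map_sum, mul_comm]
  · obtain ⟨l, hl, hlJ⟩ := exists_controlled h0 hθ1 (S := (S : Set V)) J hSJ
      (φ := fun t p => φ t p.1 p.2) (fun p => hφ _ _) (by
        filter_upwards [wφ] with t h2
        exact (hJ _ _).2 h2)
    obtain ⟨l', hl', hlJ'⟩ := exists_controlled h0 hθ1 (S := (S' : Set W)) J' hSJ'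
      (φ := fun t p => ψ t p.1 p.2) (fun p => hψ _ _) (by
        filter_upwards [wψ] with t h2
        exact (hJ' _ _).2 h2)
    refine le_of_eq_of_le ?_ (hcon l l' hl hl').le
    have e1 : ∀ j, l (s j) = l (J (c j)) := fun j => by
      rw [← sub_eq_zero, ← map_sub, ← norm_le_zero_iff]
      refine (hl.1 _).trans ?_
      simp [hc]
    have e2 : ∀ j, l' (t j) = l' (J' (d j)) := fun j => by
      rw [← sub_eq_zero, ← map_sub, ← norm_le_zero_iff]
      refine (hl'.1 _).trans ?_
      simp [hd]
    congr 1
    simp only [e1, e2, hlJ, hlJ', z, Finset.sum_mul, Finset.mul_sum]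
    rw [Finset.sum_comm]
    refine Finset.sum_congr rfl fun j _ => ?_
    rw [Fintype.sum_prod_type, Finset.sum_comm]
    exact Finset.sum_congr rfl fun p _ => Finset.sum_congr rfl fun q _ => by ring

theorem interpN_injN_le {θ : ℝ} (h0 : 0 < θ) (hθ1 : θ < 1) (N : Bool → Seminorm ℂ V)
    (N' : Bool → Seminorm ℂ W) {T M : ℝ} (h1 : 0 < T) (hM : 0 ≤ M)
    (hS : ∀ S, HasCoord N T M S) (hS' : ∀ S, HasCoord N' T M S) (z : TensorProduct ℂ V W) :
    interpN θ (injN (N true) (N' true)) (injN (N false) (N' false)) z ≤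
      1024 * T ^ 4 * (3 + T ^ 4) * (M + 2) ^ 2 *
        injN (interpN θ (N true) (N false)) (interpN θ (N' true) (N' false)) z := by
  classical
  set C : ℝ := 1024 * T ^ 4 * (3 + T ^ 4) * (M + 2) ^ 2
  have hC : 0 < C := by positivity
  by_contra! hlt
  obtain ⟨Λ, hΛz, hΛ⟩ := exists_dual_vector_seminorm (interpSeminorm θ
    (injSeminorm (N true) (N' true)) (injSeminorm (N false) (N' false))) z
  obtain ⟨r, s, t, hz⟩ := exists_tensor_sum z
  obtain ⟨κ, hκ1, hκ2⟩ := exists_between ((lt_div_iff₀' hC).2 hlt)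
  have hκ : C * κ < ‖Λ (∑ j, s j ⊗ₜ[ℂ] t j)‖ := by
    rw [← hz, hΛz, Complex.norm_real, Real.norm_of_nonneg (apply_nonneg _ _)]
    exact (lt_div_iff₀' hC).1 hκ2
  have key : ∀ i : Finset V × Finset W, ∃ l l', ControlledOn θ N i.1 l ∧ ControlledOn θ N' i.2 l' ∧
      κ ≤ ‖∑ j, l (s j) * l' (t j)‖ := fun i => by
    obtain ⟨l, l', h2, h3, h4⟩ := exists_controlled_pair h0 hθ1 h1
      (hS (i.1 ∪ univ.image s)) (hS' (i.2 ∪ univ.image t)) hΛ (s := s) (t := t)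
      (fun j => by simp) (fun j => by simp) hκ
    exact ⟨l, l', h2.mono (by simp), h3.mono (by simp), h4⟩
  choose l l' hl hl' hll using key
  let U : Ultrafilter (Finset V × Finset W) := Ultrafilter.of Filter.atTop
  have hU : (U : Filter (Finset V × Finset W)) ≤ Filter.atTop := Ultrafilter.of_le _
  obtain ⟨f, hf⟩ := exists_limit_functional U l _ fun i => (hl i).1
  obtain ⟨g, hg⟩ := exists_limit_functional U l' _ fun i => (hl' i).1
  have hfN := controlled_limit U hl (fun x => hU (by
    filter_upwards [Filter.eventually_ge_atTop (({x}, ∅) : Finset V × Finset W)] with i hi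
    exact hi.1 (Finset.mem_singleton_self x))) hf
  have hgN := controlled_limit U hl' (fun x => hU (by
    filter_upwards [Filter.eventually_ge_atTop ((∅, {x}) : Finset V × Finset W)] with i hi
    exact hi.2 (Finset.mem_singleton_self x))) hg
  have hlim := ge_of_tendsto (tendsto_finsetSum univ fun j _ => (hf (s j)).mul (hg (t j))).norm
    (Filter.Eventually.of_forall hll)
  have hle := le_injN z hfN hgN
  rw [hz, map_sum] at hle
  simp only [tensorFun_tmul] at hle
  rw [← hz] at hle
  linarith

end TensorUpperMain

section DualSeminorm

variable {A : Type*} [Fintype A]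

theorem exists_norm_le_of_definite (p : Seminorm ℂ (A → ℂ)) (hp : ∀ v, p v = 0 → v = 0) :
    ∃ C : ℝ, 0 ≤ C ∧ ∀ v, ‖v‖ ≤ C * p v := by
  rcases (Metric.sphere (0 : A → ℂ) 1).eq_empty_or_nonempty with h | h
  · refine ⟨0, le_rfl, fun v => ?_⟩
    by_contra! hv
    rw [zero_mul, norm_pos_iff] at hv
    have : (‖v‖⁻¹ : ℂ) • v ∈ Metric.sphere (0 : A → ℂ) 1 := by
      simp [norm_smul, hv]
    simp [h] at this
  · obtain ⟨u, hu, hmin⟩ := (isCompact_sphere (0 : A → ℂ) 1).exists_isMinOn h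
      (seminorm_continuous_pi p).continuousOn
    have hu0 : 0 < p u := (apply_nonneg p u).lt_of_ne' fun h0 => by
      simp [hp u h0] at hu
    refine ⟨(p u)⁻¹, by positivity, fun v => ?_⟩
    rcases eq_or_ne v 0 with rfl | hv
    · simp
    have hv0 : 0 < ‖v‖ := norm_pos_iff.2 hv
    have h2 : p u ≤ p ((‖v‖⁻¹ : ℂ) • v) := hmin (by simp [norm_smul, hv])
    rw [map_smul_eq_mul, norm_inv, Complex.norm_real, norm_norm, ← div_eq_inv_mul,
      le_div_iff₀ hv0] at h2
    rw [← div_eq_inv_mul, le_div_iff₀ hu0]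
    linarith

theorem pairing_exists_bound (p : Seminorm ℂ (A → ℂ)) (hp : ∀ v, p v = 0 → v = 0) (φ : A → ℂ) :
    ∃ C : ℝ, 0 ≤ C ∧ ∀ v, ‖∑ a, φ a * v a‖ ≤ C * p v := by
  obtain ⟨C, hC, h⟩ := exists_norm_le_of_definite p hp
  refine ⟨(∑ a, ‖φ a‖) * C, by positivity, fun v => ?_⟩
  refine (norm_sum_le _ _).trans ?_
  rw [mul_assoc, Finset.sum_mul]
  refine Finset.sum_le_sum fun a _ => ?_
  rw [norm_mul]
  exact mul_le_mul_of_nonneg_left ((norm_le_pi_norm v a).trans (h v)) (norm_nonneg _)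

/-- The value of the dual norm of `p`. -/
def dualVal (p : Seminorm ℂ (A → ℂ)) (φ : A → ℂ) : ℝ :=
  sSup {r : ℝ | ∃ v, p v ≤ 1 ∧ r = ‖∑ a, φ a * v a‖}

theorem dualVal_le {p : Seminorm ℂ (A → ℂ)} {φ : A → ℂ} {C : ℝ} (hC : 0 ≤ C)
    (h : ∀ v, ‖∑ a, φ a * v a‖ ≤ C * p v) : dualVal p φ ≤ C := by
  refine Real.sSup_le ?_ hC
  rintro _ ⟨v, hv, rfl⟩
  exact (h v).trans (mul_le_of_le_one_right hC hv)

theorem dualVal_nonneg (p : Seminorm ℂ (A → ℂ)) (φ : A → ℂ) : 0 ≤ dualVal p φ := by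
  refine Real.sSup_nonneg ?_
  rintro _ ⟨v, hv, rfl⟩
  exact norm_nonneg _

theorem pairing_le {p : Seminorm ℂ (A → ℂ)} (hp : ∀ v, p v = 0 → v = 0) (φ v : A → ℂ) :
    ‖∑ a, φ a * v a‖ ≤ dualVal p φ * p v := by
  obtain ⟨C, hC, h⟩ := pairing_exists_bound p hp φ
  rcases eq_or_ne (p v) 0 with h0 | h0
  · simpa [h0] using h v
  have hpos : 0 < p v := (apply_nonneg p v).lt_of_ne' h0
  have hle : ‖∑ a, φ a * ((p v : ℂ)⁻¹ • v) a‖ ≤ dualVal p φ := by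
    refine le_csSup ⟨C, ?_⟩ ⟨_, ?_, rfl⟩
    · rintro _ ⟨w, hw, rfl⟩
      exact (h w).trans (mul_le_of_le_one_right hC hw)
    · rw [map_smul_eq_mul, norm_inv, Complex.norm_real, Real.norm_of_nonneg hpos.le,
        inv_mul_cancel₀ h0]
  have e : ∑ a, φ a * ((p v : ℂ)⁻¹ • v) a = (p v : ℂ)⁻¹ * ∑ a, φ a * v a := by
    rw [Finset.mul_sum]
    exact Finset.sum_congr rfl fun a _ => by simp only [Pi.smul_apply, smul_eq_mul]; ring
  rw [e, norm_mul, norm_inv, Complex.norm_real, Real.norm_of_nonneg hpos.le, ← div_eq_inv_mul,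
    div_le_iff₀ hpos] at hle
  exact hle

/-- The dual norm of a norm on `ℂᴬ`, as a seminorm. -/
def dualSemi (p : Seminorm ℂ (A → ℂ)) (hp : ∀ v, p v = 0 → v = 0) : Seminorm ℂ (A → ℂ) :=
  Seminorm.ofSMulLE (dualVal p)
    (le_antisymm (dualVal_le le_rfl fun v => by simp) (dualVal_nonneg _ _))
    (fun φ ψ => dualVal_le (add_nonneg (dualVal_nonneg _ _) (dualVal_nonneg _ _)) fun v => by
      simp only [Pi.add_apply, add_mul, Finset.sum_add_distrib]
      exact (norm_add_le _ _).trans (add_le_add (pairing_le hp _ _) (pairing_le hp _ _)))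
    (fun a φ => dualVal_le (mul_nonneg (norm_nonneg _) (dualVal_nonneg _ _)) fun v => by
      simp only [Pi.smul_apply, smul_eq_mul, mul_assoc, ← Finset.mul_sum]
      rw [norm_mul]
      exact mul_le_mul_of_nonneg_left (pairing_le hp _ _) (norm_nonneg _))

theorem dualSemi_apply (p : Seminorm ℂ (A → ℂ)) (hp : ∀ v, p v = 0 → v = 0) (φ : A → ℂ) :
    dualSemi p hp φ = dualVal p φ := rfl

theorem exists_norming_vector (p : Seminorm ℂ (A → ℂ)) (hp : ∀ v, p v = 0 → v = 0) (φ : A → ℂ) :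
    ∃ v, p v ≤ 1 ∧ ∑ a, φ a * v a = dualVal p φ := by
  classical
  obtain ⟨l, h1, h2⟩ := exists_dual_vector_seminorm (dualSemi p hp) φ
  have hl : ∀ y, l y = ∑ a, y a * l (Pi.single a 1) := fun y => by
    rw [coord_eq_sum l y]
    simp
  refine ⟨fun a => l (Pi.single a 1), ?_, by rw [← hl, h1, dualSemi_apply]⟩
  obtain ⟨g, h3, h4⟩ := exists_dual_vector_seminorm p fun a => l (Pi.single a 1)
  have hg : ∀ y, g y = ∑ a, g (Pi.single a 1) * y a := fun y => by
    rw [coord_eq_sum g y]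
    simp [mul_comm]
  have h5 := h2 fun a => g (Pi.single a 1)
  rw [hl, ← hg, h3, Complex.norm_real, Real.norm_of_nonneg (apply_nonneg _ _)] at h5
  refine h5.trans (dualVal_le zero_le_one fun v => ?_)
  rw [← hg, one_mul]
  exact h4 v

end DualSeminorm

section TypeTwoDual

variable {V : Type*} [AddCommGroup V] [Module ℂ V] {N : V → ℝ}

/-- A norm as a seminorm. -/
def IsNormC.seminorm (h : IsNormC N) : Seminorm ℂ V :=
  Seminorm.of N h.2.2.2 h.2.2.1

theorem IsNormC.coe_seminorm (h : IsNormC N) : ⇑h.seminorm = N := rfl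

theorem dualNC_le {φ : V →ₗ[ℂ] ℂ} {C : ℝ} (hC : 0 ≤ C) (h : ∀ x, ‖φ x‖ ≤ C * N x) :
    dualNC N φ ≤ C := by
  refine Real.sSup_le ?_ hC
  rintro _ ⟨v, hv, rfl⟩
  exact (h v).trans (mul_le_of_le_one_right hC hv)

theorem dualNC_nonneg (φ : V →ₗ[ℂ] ℂ) : 0 ≤ dualNC N φ := by
  refine Real.sSup_nonneg ?_
  rintro _ ⟨v, hv, rfl⟩
  exact norm_nonneg _

theorem IsNormC.norm_apply_le (hN : IsNormC N) {φ : V →ₗ[ℂ] ℂ} (hφ : φ ∈ BddDual N) (x : V) :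
    ‖φ x‖ ≤ dualNC N φ * N x := by
  obtain ⟨C, hC⟩ := hφ
  rcases eq_or_ne (N x) 0 with h0 | h0
  · simp [hN.2.1 x h0, hN.coe_seminorm ▸ map_zero hN.seminorm]
  have hpos : 0 < N x := (hN.1 x).lt_of_ne' h0
  have hle : ‖φ ((N x : ℂ)⁻¹ • x)‖ ≤ dualNC N φ := by
    refine le_csSup ⟨|C|, ?_⟩ ⟨_, ?_, rfl⟩
    · rintro _ ⟨w, hw, rfl⟩
      refine (hC w).trans ((mul_le_mul_of_nonneg_right (le_abs_self C) (hN.1 w)).trans ?_)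
      exact mul_le_of_le_one_right (abs_nonneg C) hw
    · rw [hN.2.2.1, norm_inv, Complex.norm_real, Real.norm_of_nonneg hpos.le, inv_mul_cancel₀ h0]
  rw [map_smul, norm_smul, norm_inv, Complex.norm_real, Real.norm_of_nonneg hpos.le,
    ← div_eq_inv_mul, div_le_iff₀ hpos] at hle
  exact hle

theorem typeTwo_dualSemi (hN : IsNormC N) {T : ℝ}
    (hT : Type2With (fun φ : BddDual N => dualNC N φ.1) T) {A : Type*} [Fintype A]
    (J : (A → ℂ) →ₗ[ℂ] V) (hp : ∀ v, hN.seminorm.comp J v = 0 → v = 0) :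
    TypeTwo (dualSemi (hN.seminorm.comp J) hp) |T| := by
  classical
  intro m x
  have hext : ∀ i, ∃ l : V →ₗ[ℂ] ℂ, (∀ v, l (J v) = ∑ a, x i a * v a) ∧
      ∀ y, ‖l y‖ ≤ dualVal (hN.seminorm.comp J) (x i) * N y := fun i => by
    obtain ⟨c, hc⟩ : ∃ c : NNReal, (c : ℝ) = dualVal (hN.seminorm.comp J) (x i) :=
      ⟨⟨_, dualVal_nonneg _ _⟩, rfl⟩
    rw [← hc]
    obtain ⟨l, h1, h2⟩ := exists_dominated_extension J (Fintype.linearCombination ℂ (x i))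
      (c • hN.seminorm) fun v => by
        rw [Fintype.linearCombination_apply]
        have := pairing_le hp (x i) v
        rw [← hc] at this
        simp only [smul_eq_mul, mul_comm] at this ⊢
        exact this
    refine ⟨l, fun v => ?_, fun y => h2 y⟩
    rw [h1, Fintype.linearCombination_apply]
    simp only [smul_eq_mul, mul_comm]
  choose l hl hln using hext
  let L : Fin m → BddDual N := fun i => ⟨l i, _, hln i⟩
  have h1 := hT m L
  have hr0 : 0 ≤ radAvg (fun φ : BddDual N => dualNC N φ.1) L :=
    mul_nonneg (by positivity) (Finset.sum_nonneg fun _ _ => sq_nonneg _)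
  have hs0 : 0 ≤ ∑ i, dualNC N (L i).1 ^ 2 := Finset.sum_nonneg fun _ _ => sq_nonneg _
  have h2 : radAvg (fun φ : BddDual N => dualNC N φ.1) L ≤ T ^ 2 * ∑ i, dualNC N (L i).1 ^ 2 := by
    have h3 := pow_le_pow_left₀ (Real.sqrt_nonneg _) h1 2
    rwa [Real.sq_sqrt hr0, mul_pow, Real.sq_sqrt hs0] at h3
  rw [radAvg, inv_mul_le_iff₀ (by positivity)] at h2
  rw [sq_abs]
  refine le_trans (Finset.sum_le_sum fun e _ => ?_) (h2.trans ?_)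
  · refine pow_le_pow_left₀ (dualVal_nonneg _ _) (dualVal_le (dualNC_nonneg _) fun v => ?_) 2
    have e1 : ∑ a, radSum e x a * v a = (radSum e L).1 (J v) := by
      have e2 : (radSum e L).1 = radSum e l := radSum_map (BddDual N).subtype.toAddMonoidHom e L
      rw [e2]
      have e3 : radSum e l (J v) = radSum e fun i => l i (J v) :=
        radSum_map (LinearMap.applyₗ (R := ℂ) (J v)).toAddMonoidHom e l
      rw [e3]
      simp only [hl]
      exact radSum_map (Fintype.linearCombination ℂ v : (A → ℂ) →ₗ[ℂ] ℂ).toAddMonoidHom e x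
    rw [e1]
    exact hN.norm_apply_le (radSum e L).2 (J v)
  · gcongr with i
    · exact dualNC_nonneg _
    · exact dualNC_le (dualVal_nonneg _ _) (hln i)

end TypeTwoDual

section Labels

variable {Ω : Type*} [MeasurableSpace Ω] {μ : Measure Ω}

/-- The function that is constant, equal to `r k`, on the set labelled `k`. -/
def step {Ω P V : Type*} [Zero V] (a : Ω → Option P) (r : P → V) : Ω → V :=
  fun ω => (a ω).elim 0 r

/-- A measurable labelling by sets of finite measure. -/
structure IsLabel {P : Type} (μ : Measure Ω) (a : Ω → Option P) : Prop where
  meas : ∀ k, MeasurableSet {ω | a ω = some k}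
  fin : ∀ k, μ {ω | a ω = some k} < ⊤

theorem step_eq_sum {Ω P V : Type*} [Fintype P] [AddCommMonoid V] (a : Ω → Option P) (r : P → V) :
    step a r = ∑ k, {ω | a ω = some k}.indicator fun _ => r k := by
  classical
  funext ω
  rw [Finset.sum_apply]
  have h : ∀ k, {ω | a ω = some k}.indicator (fun _ => r k) ω = if a ω = some k then r k else 0 :=
    fun k => by by_cases h : a ω = some k <;> simp [h]
  simp only [h, step]
  cases a ω <;> simp

theorem IsLabel.measurableSet_none {P : Type} [Fintype P] {a : Ω → Option P} (h : IsLabel μ a) :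
    MeasurableSet {ω | a ω = none} := by
  have : {ω | a ω = none} = (⋃ k, {ω | a ω = some k})ᶜ := by
    ext ω
    cases h : a ω <;> simp [h]
  rw [this]
  exact (MeasurableSet.iUnion h.meas).compl

/-- Two labellings have a common refinement. -/
theorem IsLabel.exists_refine {P Q : Type} [Fintype P] [Fintype Q] {a : Ω → Option P}
    {b : Ω → Option Q} (ha : IsLabel μ a) (hb : IsLabel μ b) (V : Type*) [Zero V] :
    ∃ (R : Type) (_ : Fintype R) (c : Ω → Option R), IsLabel μ c ∧
      (∀ G : P → V, ∃ H, step a G = step c H) ∧ ∀ G : Q → V, ∃ H, step b G = step c H := by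
  classical
  let R := {q : Option P × Option Q // q ≠ (none, none)}
  let c : Ω → Option R := fun ω => if h : (a ω, b ω) ≠ (none, none) then some ⟨_, h⟩ else none
  have hset : ∀ q : R, {ω | c ω = some q} = {ω | a ω = q.1.1} ∩ {ω | b ω = q.1.2} := by
    intro q
    ext ω
    have hq := q.2
    simp only [Set.mem_ofPred_eq, Set.mem_inter_iff, c]
    constructor
    · intro h
      split_ifs at h with h'
      rw [Option.some_inj] at h
      rw [← h]
      exact ⟨rfl, rfl⟩
    · rintro ⟨h1, h2⟩
      have h3 : (a ω, b ω) = q.1 := Prod.ext h1 h2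
      rw [dif_pos (h3 ▸ hq)]
      exact congrArg some (Subtype.ext h3)
  have hma : ∀ o, MeasurableSet {ω | a ω = o} := fun o => by
    cases o with
    | none => exact ha.measurableSet_none
    | some k => exact ha.meas k
  have hmb : ∀ o, MeasurableSet {ω | b ω = o} := fun o => by
    cases o with
    | none => exact hb.measurableSet_none
    | some k => exact hb.meas k
  refine ⟨R, inferInstance, c, ⟨fun q => ?_, fun q => ?_⟩, fun G => ?_, fun G => ?_⟩
  · rw [hset]
    exact (hma _).inter (hmb _)
  · rw [hset]
    obtain ⟨⟨o₁, o₂⟩, hq⟩ := q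
    cases o₁ with
    | some k => exact (measure_mono Set.inter_subset_left).trans_lt (ha.fin k)
    | none =>
      cases o₂ with
      | some k => exact (measure_mono Set.inter_subset_right).trans_lt (hb.fin k)
      | none => exact absurd rfl hq
  · refine ⟨fun q => q.1.1.elim 0 G, funext fun ω => ?_⟩
    simp only [step, c]
    split_ifs with h
    · rfl
    · rw [not_not, Prod.mk.injEq] at h
      simp [h.1]
  · refine ⟨fun q => q.1.2.elim 0 G, funext fun ω => ?_⟩
    simp only [step, c]
    split_ifs with h
    · rfl
    · rw [not_not, Prod.mk.injEq] at h
      simp [h.2]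

variable {V : Type*} [AddCommGroup V] [Module ℂ V]

theorem exists_label {f : Ω → V} (hf : f ∈ SimpleSub μ V) :
    ∃ (P : Type) (_ : Fintype P) (a : Ω → Option P), IsLabel μ a ∧ ∃ G, f = step a G := by
  classical
  refine Submodule.span_induction ?_ ?_ ?_ ?_ hf
  · rintro _ ⟨s, v, hs, hfin, rfl⟩
    have e : ∀ k, {ω | (if ω ∈ s then some () else none) = some k} = s := fun k => by
      ext ω
      simp
    refine ⟨Unit, inferInstance, fun ω => if ω ∈ s then some () else none,
      ⟨fun k => by rw [e]; exact hs, fun k => by rw [e]; exact hfin⟩, fun _ => v, ?_⟩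
    funext ω
    by_cases h : ω ∈ s <;> simp [step, h]
  · exact ⟨Empty, inferInstance, fun _ => none, ⟨nofun, nofun⟩, nofun, rfl⟩
  · rintro f g - - ⟨P, _, a, ha, F, rfl⟩ ⟨Q, _, b, hb, G, rfl⟩
    obtain ⟨R, _, c, hc, h1, h2⟩ := ha.exists_refine hb V
    obtain ⟨F', hF⟩ := h1 F
    obtain ⟨G', hG⟩ := h2 G
    refine ⟨R, inferInstance, c, hc, F' + G', ?_⟩
    rw [hF, hG]
    funext ω
    simp only [step, Pi.add_apply]
    cases c ω <;> simp
  · rintro z f - ⟨P, _, a, ha, F, rfl⟩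
    refine ⟨P, inferInstance, a, ha, z • F, ?_⟩
    funext ω
    simp only [step, Pi.smul_apply]
    cases a ω <;> simp

theorem exists_common_label (S : Finset (SimpleSub μ V)) :
    ∃ (P : Type) (_ : Fintype P) (a : Ω → Option P), IsLabel μ a ∧
      ∀ f ∈ S, ∃ G, (f : Ω → V) = step a G := by
  classical
  induction S using Finset.induction_on with
  | empty => exact ⟨Empty, inferInstance, fun _ => none, ⟨nofun, nofun⟩, by simp⟩
  | insert f S hf ih =>
    obtain ⟨P, _, a, ha, h⟩ := ih
    obtain ⟨Q, _, b, hb, F, hF⟩ := exists_label f.2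
    obtain ⟨R, _, c, hc, h1, h2⟩ := ha.exists_refine hb V
    refine ⟨R, inferInstance, c, hc, fun g hg => ?_⟩
    rcases Finset.mem_insert.1 hg with rfl | hg
    · obtain ⟨H, hH⟩ := h2 F
      exact ⟨H, hF.trans hH⟩
    · obtain ⟨G, hG⟩ := h g hg
      obtain ⟨H, hH⟩ := h1 G
      exact ⟨H, hG.trans hH⟩

/-- The labels of null sets may be dropped, at the cost of changing functions on a null set. -/
theorem exists_common_label_pos (S : Finset (SimpleSub μ V)) :
    ∃ (P : Type) (_ : Fintype P) (a : Ω → Option P), IsLabel μ a ∧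
      (∀ k, μ {ω | a ω = some k} ≠ 0) ∧ ∀ f ∈ S, ∃ G, (f : Ω → V) =ᵐ[μ] step a G := by
  classical
  obtain ⟨P, _, a, ha, h⟩ := exists_common_label S
  let Q := {k : P // μ {ω | a ω = some k} ≠ 0}
  let b : Ω → Option Q := fun ω =>
    (a ω).bind fun k => if hk : μ {ω | a ω = some k} ≠ 0 then some ⟨k, hk⟩ else none
  have hset : ∀ q : Q, {ω | b ω = some q} = {ω | a ω = some q.1} := by
    intro q
    ext ω
    simp only [Set.mem_ofPred_eq, b]
    cases a ω with
    | none => simp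
    | some k =>
      simp only [Option.bind_some, Option.some_inj]
      constructor
      · intro h
        split_ifs at h
        rw [Option.some_inj] at h
        rw [← h]
      · rintro rfl
        rw [dif_pos q.2]
  refine ⟨Q, inferInstance, b, ⟨fun q => ?_, fun q => ?_⟩, fun q => ?_, fun f hf => ?_⟩
  · rw [hset]
    exact ha.meas _
  · rw [hset]
    exact ha.fin _
  · rw [hset]
    exact q.2
  · obtain ⟨G, hG⟩ := h f hf
    have hae : ∀ᵐ ω ∂μ, ∀ k, a ω = some k → μ {ω | a ω = some k} ≠ 0 := by
      rw [ae_all_iff]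
      intro k
      by_cases hk : μ {ω | a ω = some k} = 0
      · have : ∀ᵐ ω ∂μ, ¬ a ω = some k := by
          rw [ae_iff]
          simpa using hk
        filter_upwards [this] with ω h1 h2
        exact absurd h2 h1
      · exact Filter.Eventually.of_forall fun _ _ => hk
    refine ⟨fun q => G q.1, ?_⟩
    rw [hG]
    filter_upwards [hae] with ω hω
    simp only [step, b]
    cases hk : a ω with
    | none => rfl
    | some k =>
      simp only [Option.elim_some, Option.bind_some]
      rw [dif_pos (hω k hk)]
      rfl

theorem step_mem_simpleSub {P : Type} [Fintype P] {a : Ω → Option P} (ha : IsLabel μ a)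
    (G : P → V) : step a G ∈ SimpleSub μ V := by
  rw [step_eq_sum]
  exact Submodule.sum_mem _ fun k _ => Submodule.subset_span ⟨_, _, ha.meas k, ha.fin k, rfl⟩

/-- The step functions for a given labelling. -/
def stepL {P : Type} [Fintype P] {a : Ω → Option P} (ha : IsLabel μ a) :
    (P → V) →ₗ[ℂ] SimpleSub μ V where
  toFun G := ⟨step a G, step_mem_simpleSub ha G⟩
  map_add' F G := Subtype.ext <| funext fun ω => by
    simp only [step, Submodule.coe_add, Pi.add_apply]
    cases a ω <;> simp
  map_smul' z F := Subtype.ext <| funext fun ω => by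
    simp only [step, Submodule.coe_smul, Pi.smul_apply, RingHom.id_apply]
    cases a ω <;> simp

theorem comp_step {Ω P V W : Type*} [Zero V] [Zero W] (a : Ω → Option P) (G : P → V) (N : V → W)
    (hN : N 0 = 0) : (fun ω => N (step a G ω)) = step a fun k => N (G k) := by
  funext ω
  simp only [step]
  cases a ω <;> simp [hN]

end Labels

section Lattice

variable {Ω : Type*} [MeasurableSpace Ω] {μ : Measure Ω} (X : BFS Ω μ ℝ)

theorem BFS.mem_sum {ι : Type*} (s : Finset ι) (f : ι → Ω → ℝ) (h : ∀ i ∈ s, X.mem (f i)) :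
    X.mem (∑ i ∈ s, f i) := by
  classical
  induction s using Finset.induction_on with
  | empty => exact X.mem_zero
  | insert i s hi ih =>
    rw [Finset.sum_insert hi]
    exact X.mem_add _ _ (h i (Finset.mem_insert_self _ _))
      (ih fun j hj => h j (Finset.mem_insert_of_mem hj))

theorem BFS.nrm_zero : X.nrm 0 = 0 := by
  simpa using X.nrm_smul 0 0

theorem BFS.step_mem {P : Type} [Fintype P] {a : Ω → Option P} (ha : IsLabel μ a) (r : P → ℝ) :
    X.mem (step a r) := by
  rw [step_eq_sum]
  refine X.mem_sum _ _ fun k _ => ?_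
  have : ({ω | a ω = some k}.indicator fun _ => r k) =
      r k • {ω | a ω = some k}.indicator fun _ => (1 : ℝ) := by
    funext ω
    by_cases h : a ω = some k <;> simp [h]
  rw [this]
  exact X.mem_smul _ _ (X.mem_indicator _ (ha.meas k) (ha.fin k))

theorem BFS.nrm_step_mono {P : Type} [Fintype P] {a : Ω → Option P} (ha : IsLabel μ a)
    {r r' : P → ℝ} (h0 : ∀ k, 0 ≤ r k) (h : ∀ k, r k ≤ r' k) :
    X.nrm (step a r) ≤ X.nrm (step a r') := by
  refine (X.ideal _ _ (X.mem_meas _ (X.step_mem ha r)) (X.step_mem ha r') ?_).2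
  refine Filter.Eventually.of_forall fun ω => ?_
  simp only [step]
  cases a ω with
  | none => simp
  | some k =>
    simp only [Option.elim_some, Real.norm_eq_abs]
    exact abs_le_abs_of_nonneg (h0 k) (h k)

theorem BFS.latData {P : Type} [Fintype P] {a : Ω → Option P} (ha : IsLabel μ a)
    (hpos : ∀ k, μ {ω | a ω = some k} ≠ 0) {M M' : ℝ} (hX : X.RConcaveWith 2 M) (hM : |M| ≤ M') :
    LatData (fun r : P → ℝ => X.nrm (step a r)) M' := by
  classical
  have hM0 : 0 ≤ M' := (abs_nonneg M).trans hM
  refine ⟨fun r => X.nrm_nonneg _, fun r r' h0 h => X.nrm_step_mono ha h0 h, fun m g hg => ?_,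
    ?_, hM0⟩
  · have h1 := hX m (fun l => step a (g l)) fun l => X.step_mem ha _
    have e : (fun ω => (((∑ i, ‖step a (g i) ω‖ ^ (2 : ℝ)) ^ (1 / (2 : ℝ)) : ℝ) : ℝ)) =
        step a fun k => √(∑ l, g l k ^ 2) := by
      funext ω
      rw [← Real.sqrt_eq_rpow]
      simp only [step, Real.rpow_two, Real.norm_eq_abs, sq_abs]
      cases a ω <;> simp
    simp only [RCLike.ofReal_real_eq_id, id_eq] at h1
    rw [e, ← Real.sqrt_eq_rpow] at h1
    simp only [Real.rpow_two] at h1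
    have hs : 0 ≤ ∑ l, X.nrm (step a (g l)) ^ 2 := Finset.sum_nonneg fun _ _ => sq_nonneg _
    have h2 := pow_le_pow_left₀ (Real.sqrt_nonneg _) h1 2
    rw [Real.sq_sqrt hs, mul_pow, ← sq_abs M] at h2
    refine h2.trans ?_
    gcongr
  · have hρ : ∀ k, 0 < X.nrm (step a (Pi.single k (1 : ℝ))) := fun k => by
      refine (X.nrm_nonneg _).lt_of_ne' fun h0 => hpos k ?_
      have h1 := X.nrm_eq_zero _ (X.step_mem ha _) h0
      rw [Filter.EventuallyEq, ae_iff] at h1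
      refine measure_mono_null (fun ω hω => ?_) h1
      have hω' : a ω = some k := hω
      simp [step, hω']
    set D := ∑ k, (X.nrm (step a (Pi.single k (1 : ℝ))))⁻¹ + 1 with hD
    have hD0 : 0 < D := by
      have : 0 ≤ ∑ k, (X.nrm (step a (Pi.single k (1 : ℝ))))⁻¹ :=
        Finset.sum_nonneg fun k _ => (inv_pos.2 (hρ k)).le
      linarith
    refine ⟨D⁻¹, inv_pos.2 hD0, fun r hr => ?_⟩
    rw [inv_mul_le_iff₀ hD0, hD, add_mul, Finset.sum_mul, one_mul]
    have : ∑ k, r k ≤ ∑ k, (X.nrm (step a (Pi.single k (1 : ℝ))))⁻¹ * X.nrm (step a r) := by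
      refine Finset.sum_le_sum fun k _ => ?_
      rw [← div_eq_inv_mul, le_div_iff₀ (hρ k)]
      have e : step a (Pi.single k (r k)) = r k • step a (Pi.single k (1 : ℝ)) := by
        funext ω
        simp only [step, Pi.smul_apply]
        cases a ω with
        | none => simp
        | some j => by_cases h : j = k <;> simp [h]
      have h1 := X.nrm_smul (r k) (step a (Pi.single k (1 : ℝ)))
      rw [← e, Real.norm_of_nonneg (hr k)] at h1
      rw [← h1]
      refine X.nrm_step_mono ha (fun j => ?_) fun j => ?_
      · by_cases h : j = k
        · subst h; simpa using hr j
        · simp [h]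
      · by_cases h : j = k
        · subst h; simp
        · simpa [h] using hr j
    linarith [X.nrm_nonneg (step a r)]

variable {V : Type*} [AddCommGroup V] [Module ℂ V] {N : V → ℝ}

theorem IsNormC.map_zero (hN : IsNormC N) : N 0 = 0 := by
  simpa using hN.2.2.1 0 0

theorem BFS.mem_norm_simple (hN : IsNormC N) (f : SimpleSub μ V) :
    X.mem fun ω => N ((f : Ω → V) ω) := by
  obtain ⟨P, _, a, ha, G, hG⟩ := exists_label f.2
  rw [hG, comp_step a G N hN.map_zero]
  exact X.step_mem ha _

/-- The norm of `X(E)` on the simple functions. -/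
def BFS.vecSeminorm (hN : IsNormC N) : Seminorm ℂ (SimpleSub μ V) :=
  Seminorm.of (fun f : SimpleSub μ V => X.nrm fun ω => N ((f : Ω → V) ω))
    (fun f g => by
      have hf := X.mem_norm_simple hN f
      have hg := X.mem_norm_simple hN g
      refine (X.ideal _ _ (X.mem_meas _ (X.mem_norm_simple hN (f + g))) (X.mem_add _ _ hf hg)
        (Filter.Eventually.of_forall fun ω => ?_)).2.trans (X.nrm_add _ _ hf hg)
      simp only [Submodule.coe_add, Pi.add_apply]
      rw [Real.norm_of_nonneg (hN.1 _), Real.norm_of_nonneg (add_nonneg (hN.1 _) (hN.1 _))]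
      exact hN.2.2.2 _ _)
    (fun z f => by
      have e : (fun ω => N (((z • f : SimpleSub μ V) : Ω → V) ω)) =
          ‖z‖ • fun ω => N ((f : Ω → V) ω) := by
        funext ω
        simp [hN.2.2.1]
      rw [e, X.nrm_smul, norm_norm])

theorem BFS.vecSeminorm_apply (hN : IsNormC N) (f : SimpleSub μ V) :
    X.vecSeminorm hN f = X.nrm fun ω => N ((f : Ω → V) ω) := rfl

theorem BFS.vecSeminorm_eq_zero (hN : IsNormC N) {f : SimpleSub μ V}
    (hf : (f : Ω → V) =ᵐ[μ] 0) : X.vecSeminorm hN f = 0 := by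
  refine le_antisymm ?_ (apply_nonneg _ _)
  rw [← X.nrm_zero, X.vecSeminorm_apply]
  refine (X.ideal _ _ (X.mem_meas _ (X.mem_norm_simple hN f)) X.mem_zero ?_).2
  filter_upwards [hf] with ω hω
  rw [hω]
  simp [hN.map_zero]

theorem BFS.vecSeminorm_stepL (hN : IsNormC N) {P : Type} [Fintype P] {a : Ω → Option P}
    (ha : IsLabel μ a) (G : P → V) :
    X.vecSeminorm hN (stepL ha G) = X.nrm (step a fun k => N (G k)) := by
  rw [← comp_step a G N hN.map_zero]
  rfl

end Lattice

theorem forall_pairing_le_iff {P I : Type} [Fintype P] [Fintype I] {ρ : (P → ℝ) → ℝ} {M : ℝ}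
    (hρ : LatData ρ M) (p : Seminorm ℂ (I → ℂ)) (hp : ∀ v, p v = 0 → v = 0) (φ : P → I → ℂ) :
    (∀ v : P × I → ℂ, ‖∑ q, φ q.1 q.2 * v q‖ ≤ ρ fun k => p fun i => v (k, i)) ↔
      WBound ρ 1 fun k => dualSemi p hp (φ k) := by
  constructor
  · intro h r hr
    choose u hu1 hu2 using fun k => exists_norming_vector p hp (φ k)
    have h1 := h fun q => (r q.1 : ℂ) * u q.1 q.2
    have e : ∑ q : P × I, φ q.1 q.2 * ((r q.1 : ℂ) * u q.1 q.2) =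
        ((∑ k, dualSemi p hp (φ k) * r k : ℝ) : ℂ) := by
      rw [Fintype.sum_prod_type]
      push_cast
      refine Finset.sum_congr rfl fun k _ => ?_
      rw [dualSemi_apply, ← hu2, Finset.sum_mul]
      exact Finset.sum_congr rfl fun i _ => by ring
    rw [e, Complex.norm_real] at h1
    rw [one_mul]
    refine (le_abs_self _).trans (h1.trans (hρ.mono _ _ (fun k => apply_nonneg _ _) fun k => ?_))
    have e2 : (fun i => (r k : ℂ) * u k i) = (r k : ℂ) • u k := rfl
    rw [e2, map_smul_eq_mul, Complex.norm_real, Real.norm_of_nonneg (hr k)]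
    exact mul_le_of_le_one_right (hr k) (hu1 k)
  · intro h v
    have h1 := h (fun k => p fun i => v (k, i)) fun k => apply_nonneg _ _
    rw [one_mul] at h1
    rw [Fintype.sum_prod_type]
    refine (norm_sum_le _ _).trans (le_trans (Finset.sum_le_sum fun k _ => ?_) h1)
    exact pairing_le hp (φ k) fun i => v (k, i)

theorem exists_injective_coord {V : Type*} [AddCommGroup V] [Module ℂ V] {ι : Type*} [Finite ι]
    (w : ι → V) : ∃ (d : ℕ) (J : (Fin d → ℂ) →ₗ[ℂ] V), Function.Injective J ∧ ∀ i, ∃ u, J u = w i := by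
  let U := Submodule.span ℂ (Set.range w)
  have : Module.Finite ℂ U := Module.Finite.span_of_finite ℂ (Set.finite_range w)
  let e := (Module.finBasis ℂ U).equivFun
  refine ⟨_, U.subtype ∘ₗ e.symm.toLinearMap, U.injective_subtype.comp e.symm.injective,
    fun i => ⟨e ⟨w i, Submodule.subset_span ⟨i, rfl⟩⟩, by simp⟩⟩

theorem hasCoord_simpleSub {Ω V : Type*} [MeasurableSpace Ω] {μ : Measure Ω} [AddCommGroup V]
    [Module ℂ V] (X : Bool → BFS Ω μ ℝ) {N : Bool → V → ℝ} (hN : ∀ c, IsNormC (N c))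
    {M T : Bool → ℝ} (hX : ∀ c, (X c).RConcaveWith 2 (M c))
    (hT : ∀ c, Type2With (fun φ : BddDual (N c) => dualNC (N c) φ.1) (T c)) {M' T' : ℝ}
    (hM' : ∀ c, |M c| ≤ M') (hT' : ∀ c, |T c| ≤ T') (S : Finset (SimpleSub μ V)) :
    HasCoord (fun c => (X c).vecSeminorm (hN c)) T' M' S := by
  classical
  obtain ⟨P, _, a, ha, hpos, hS⟩ := exists_common_label_pos S
  choose! G hG using hS
  obtain ⟨d, J, hJ, hw⟩ := exists_injective_coord fun q : S × P => G q.1.1 q.2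
  choose u hu using hw
  have hp : ∀ c v, (hN c).seminorm.comp J v = 0 → v = 0 := fun c v h =>
    hJ (((hN c).2.1 _ h).trans (map_zero J).symm)
  let L : (P × Fin d → ℂ) →ₗ[ℂ] SimpleSub μ V := stepL ha ∘ₗ
    LinearMap.pi fun k => J ∘ₗ LinearMap.funLeft ℂ ℂ fun i => (k, i)
  have hL : ∀ c v, (X c).vecSeminorm (hN c) (L v) =
      (X c).nrm (step a fun k => (hN c).seminorm.comp J fun i => v (k, i)) := fun c v =>
    (X c).vecSeminorm_stepL (hN c) ha _
  have hlat : ∀ c, LatData (fun r : P → ℝ => (X c).nrm (step a r)) M' := fun c =>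
    (X c).latData ha hpos (hX c) (hM' c)
  refine ⟨P, Fin d, inferInstance, inferInstance, L,
    fun c => dualSemi ((hN c).seminorm.comp J) (hp c), fun c r => (X c).nrm (step a r),
    fun c => (typeTwo_dualSemi (hN c) (hT c) J (hp c)).mono (abs_nonneg _) (hT' c), hlat,
    fun c φ => ?_, fun s hs => ⟨fun q => u (⟨s, hs⟩, q.1) q.2, fun c => ?_⟩⟩
  · simp only [hL]
    exact forall_pairing_le_iff (hlat c) _ (hp c) φ
  · refine (X c).vecSeminorm_eq_zero (hN c) ?_
    have e : (fun k => J fun i => u (⟨s, hs⟩, k) i) = G s := funext fun k => hu (⟨s, hs⟩, k)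
    have e' : ((L fun q => u (⟨s, hs⟩, q.1) q.2 : SimpleSub μ V) : Ω → V) = step a (G s) := by
      rw [← e]
      rfl
    filter_upwards [hG s hs] with ω hω
    simp only [Submodule.coe_sub, Pi.sub_apply, Pi.zero_apply]
    rw [e', hω, sub_self]

/-- Main Theorem, case (1): the Kouba-type interpolation
formula for injective tensor products of vector-valued Banach function spaces
with 2-concave lattices and type-2 duals, expressed as a two-sided norm
equivalence on the dense subspace of strictly simple functions. -/
theorem statement17 {Ω₁ Ω₂ : Type*} [MeasurableSpace Ω₁] [MeasurableSpace Ω₂]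
    (μ : Measure Ω₁) (ν : Measure Ω₂) [SigmaFinite μ] [SigmaFinite ν]
    (hμc : μ.IsComplete) (hνc : ν.IsComplete)
    (X₀ X₁ : BFS Ω₁ μ ℝ) (Y₀ Y₁ : BFS Ω₂ ν ℝ)
    (MX₀ MX₁ MY₀ MY₁ : ℝ)
    (hX₀ : X₀.RConcaveWith 2 MX₀) (hX₁ : X₁.RConcaveWith 2 MX₁)
    (hY₀ : Y₀.RConcaveWith 2 MY₀) (hY₁ : Y₁.RConcaveWith 2 MY₁)
    {VE VF : Type*} [AddCommGroup VE] [Module ℂ VE] [AddCommGroup VF] [Module ℂ VF]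
    (NE₀ NE₁ : VE → ℝ) (NF₀ NF₁ : VF → ℝ)
    (hE₀ : IsNormC NE₀) (hE₁ : IsNormC NE₁) (hF₀ : IsNormC NF₀) (hF₁ : IsNormC NF₁)
    (TE₀ TE₁ TF₀ TF₁ : ℝ)
    (htE₀ : Type2With (fun φ : BddDual NE₀ => dualNC NE₀ φ.1) TE₀)
    (htE₁ : Type2With (fun φ : BddDual NE₁ => dualNC NE₁ φ.1) TE₁)
    (htF₀ : Type2With (fun φ : BddDual NF₀ => dualNC NF₀ φ.1) TF₀)
    (htF₁ : Type2With (fun φ : BddDual NF₁ => dualNC NF₁ φ.1) TF₁)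
    (θ : ℝ) (hθ : 0 < θ) (hθ1 : θ < 1) :
    ∃ C : ℝ, 0 < C ∧ ∀ z : TensorProduct ℂ (SimpleSub μ VE) (SimpleSub ν VF),
      injN (interpN θ (fun f : SimpleSub μ VE => X₀.nrm fun ω => NE₀ ((f : Ω₁ → VE) ω))
            (fun f : SimpleSub μ VE => X₁.nrm fun ω => NE₁ ((f : Ω₁ → VE) ω)))
          (interpN θ (fun g : SimpleSub ν VF => Y₀.nrm fun ω => NF₀ ((g : Ω₂ → VF) ω))
            (fun g : SimpleSub ν VF => Y₁.nrm fun ω => NF₁ ((g : Ω₂ → VF) ω))) z ≤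
        interpN θ
          (injN (fun f : SimpleSub μ VE => X₀.nrm fun ω => NE₀ ((f : Ω₁ → VE) ω))
            (fun g : SimpleSub ν VF => Y₀.nrm fun ω => NF₀ ((g : Ω₂ → VF) ω)))
          (injN (fun f : SimpleSub μ VE => X₁.nrm fun ω => NE₁ ((f : Ω₁ → VE) ω))
            (fun g : SimpleSub ν VF => Y₁.nrm fun ω => NF₁ ((g : Ω₂ → VF) ω))) z ∧
      interpN θ
          (injN (fun f : SimpleSub μ VE => X₀.nrm fun ω => NE₀ ((f : Ω₁ → VE) ω))
            (fun g : SimpleSub ν VF => Y₀.nrm fun ω => NF₀ ((g : Ω₂ → VF) ω)))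
          (injN (fun f : SimpleSub μ VE => X₁.nrm fun ω => NE₁ ((f : Ω₁ → VE) ω))
            (fun g : SimpleSub ν VF => Y₁.nrm fun ω => NF₁ ((g : Ω₂ → VF) ω))) z ≤
        C * injN (interpN θ (fun f : SimpleSub μ VE => X₀.nrm fun ω => NE₀ ((f : Ω₁ → VE) ω))
            (fun f : SimpleSub μ VE => X₁.nrm fun ω => NE₁ ((f : Ω₁ → VE) ω)))
          (interpN θ (fun g : SimpleSub ν VF => Y₀.nrm fun ω => NF₀ ((g : Ω₂ → VF) ω))
            (fun g : SimpleSub ν VF => Y₁.nrm fun ω => NF₁ ((g : Ω₂ → VF) ω))) z := by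
  let X : Bool → BFS Ω₁ μ ℝ := fun c => cond c X₀ X₁
  let Y : Bool → BFS Ω₂ ν ℝ := fun c => cond c Y₀ Y₁
  have hE : ∀ c, IsNormC (cond c NE₀ NE₁) := Bool.rec hE₁ hE₀
  have hF : ∀ c, IsNormC (cond c NF₀ NF₁) := Bool.rec hF₁ hF₀
  let T := 1 + |TE₀| + |TE₁| + |TF₀| + |TF₁|
  let M := |MX₀| + |MX₁| + |MY₀| + |MY₁|
  have := abs_nonneg TE₀
  have := abs_nonneg TE₁
  have := abs_nonneg TF₀
  have := abs_nonneg TF₁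
  have := abs_nonneg MX₀
  have := abs_nonneg MX₁
  have := abs_nonneg MY₀
  have := abs_nonneg MY₁
  have hT : 0 < T := by positivity
  have hM : 0 ≤ M := by positivity
  have hS : ∀ S, HasCoord (fun c => (X c).vecSeminorm (hE c)) T M S :=
    hasCoord_simpleSub (M := fun c => cond c MX₀ MX₁) (T := fun c => cond c TE₀ TE₁) X hE
      (Bool.rec hX₁ hX₀) (Bool.rec htE₁ htE₀)
      (Bool.rec (by change |MX₁| ≤ M; linarith) (by change |MX₀| ≤ M; linarith))
      (Bool.rec (by change |TE₁| ≤ T; linarith) (by change |TE₀| ≤ T; linarith))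
  have hS' : ∀ S, HasCoord (fun c => (Y c).vecSeminorm (hF c)) T M S :=
    hasCoord_simpleSub (M := fun c => cond c MY₀ MY₁) (T := fun c => cond c TF₀ TF₁) Y hF
      (Bool.rec hY₁ hY₀) (Bool.rec htF₁ htF₀)
      (Bool.rec (by change |MY₁| ≤ M; linarith) (by change |MY₀| ≤ M; linarith))
      (Bool.rec (by change |TF₁| ≤ T; linarith) (by change |TF₀| ≤ T; linarith))
  exact ⟨1024 * T ^ 4 * (3 + T ^ 4) * (M + 2) ^ 2, by positivity, fun z =>
    ⟨injN_interpN_le hθ hθ1 (fun c => (X c).vecSeminorm (hE c))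
      (fun c => (Y c).vecSeminorm (hF c)) z,
    interpN_injN_le hθ hθ1 _ _ hT hM hS hS' z⟩⟩

end Paper
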